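/- Let f be a rational map of degree at least 2 with Julia set J. Assume f is non-exceptional, or f is exceptional but Σ ∩ J = ∅, and assume α⁻ < α⁺. Then for every α ∈ (α⁻, α⁺), dim_H 𝓛(α) ≥ F(α). -/

import Mathlib

open Filter Set Metric MeasureTheory Topology
open scoped ENNReal NNReal

noncomputable section

/-! ### The Riemann sphere with the chordal (spherical) metric -/

/-- The Riemann sphere `ℂ ∪ {∞}`. -/
structure RSphere : Type where
  val : Option ℂ

namespace RSphere

/-- The inclusion of `ℂ` into the Riemann sphere. -/
def ofC (z : ℂ) : RSphere := ⟨some z⟩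

/-- The point at infinity. -/
def infty : RSphere := ⟨none⟩

/-- Case elimination on a point of the Riemann sphere. -/
def elim {α : Sort*} (x : RSphere) (i : α) (h : ℂ → α) : α := Option.elim x.val i h

/-- Stereographic embedding of the Riemann sphere onto the round unit sphere in
`ℝ³ = ℂ ×₂ ℝ`.  It induces the chordal (spherical) metric on `RSphere`. -/
def embed (x : RSphere) : WithLp 2 (ℂ × ℝ) :=
  elim x ((WithLp.equiv 2 (ℂ × ℝ)).symm (0, 1))
    fun z => (WithLp.equiv 2 (ℂ × ℝ)).symm
      (((2 / (‖z‖ ^ 2 + 1)) : ℝ) • z, (‖z‖ ^ 2 - 1) / (‖z‖ ^ 2 + 1))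

/-- Inverse of the stereographic embedding. -/
def unembed (v : WithLp 2 (ℂ × ℝ)) : RSphere :=
  if (WithLp.equiv 2 (ℂ × ℝ) v).2 = 1 then infty
  else ofC ((1 - (WithLp.equiv 2 (ℂ × ℝ) v).2)⁻¹ • (WithLp.equiv 2 (ℂ × ℝ) v).1)

lemma leftInverse_unembed : Function.LeftInverse unembed embed := by
  rintro ⟨x⟩
  cases x with
  | none =>
      simp [embed, unembed, elim, infty]
  | some z =>
      have h1 : (0 : ℝ) < ‖z‖ ^ 2 + 1 := by positivity
      have ht : (‖z‖ ^ 2 - 1) / (‖z‖ ^ 2 + 1) ≠ 1 := by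
        intro h
        rw [div_eq_one_iff_eq h1.ne'] at h
        linarith
      simp only [embed, unembed, elim, Option.elim, Equiv.apply_symm_apply, ht, if_false, ofC]
      congr 2
      rw [smul_smul]
      have h2 : 1 - (‖z‖ ^ 2 - 1) / (‖z‖ ^ 2 + 1) = 2 / (‖z‖ ^ 2 + 1) := by
        field_simp
        ring
      rw [h2]
      rw [inv_mul_cancel₀ (by positivity), one_smul]

lemma embed_injective : Function.Injective embed := leftInverse_unembed.injective

/-- The chordal metric on the Riemann sphere, induced by the stereographic embedding
onto the round unit sphere in Euclidean 3-space. -/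
instance : MetricSpace RSphere := MetricSpace.induced embed embed_injective inferInstance

instance : MeasurableSpace RSphere := borel RSphere

instance : BorelSpace RSphere := ⟨rfl⟩

/-- Reading off a finite point (junk value `0` at `∞`). -/
def toC (x : RSphere) : ℂ := elim x 0 id

/-- The involution `z ↦ 1/z` of the Riemann sphere. -/
def inv (x : RSphere) : RSphere :=
  elim x (ofC 0) fun z => if z = 0 then infty else ofC z⁻¹

end RSphere

/-! ### Basic dynamical notions -/

/-- The norm of the derivative of `g` at `x`, measured in the spherical metric
(for a rational map this is the usual norm of the spherical derivative). -/
def sphDeriv (g : RSphere → RSphere) (x : RSphere) : ℝ :=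
  limsup (fun y => dist (g y) (g x) / dist y x) (𝓝[≠] x)

/-- The set of critical points. -/
def critSet (g : RSphere → RSphere) : Set RSphere := {x | sphDeriv g x = 0}

/-- The Fatou set: points having a neighbourhood on which the family of iterates is
equicontinuous (i.e. normal). -/
def fatouSet (f : RSphere → RSphere) : Set RSphere :=
  {x | ∃ U : Set RSphere, IsOpen U ∧ x ∈ U ∧ EquicontinuousOn (fun n : ℕ => f^[n]) U}

/-- The Julia set. -/
def juliaSet (f : RSphere → RSphere) : Set RSphere := (fatouSet f)ᶜ

/-- `f` is the rational map on the Riemann sphere given by the coprime pair of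
polynomials `p`, `q`. -/
structure IsRationalMap (f : RSphere → RSphere) (p q : Polynomial ℂ) : Prop where
  coprime : IsCoprime p q
  continuous : Continuous f
  eval : ∀ z : ℂ, q.eval z ≠ 0 → f (RSphere.ofC z) = RSphere.ofC (p.eval z / q.eval z)

/-- The degree of the rational map `p/q`. -/
def ratDeg (p q : Polynomial ℂ) : ℕ := max p.natDegree q.natDegree

/-- The lower Lyapunov exponent `χ̲(x) = liminf (1/n) log |(fⁿ)'(x)|`, as an extended real. -/
def lyapLower (f : RSphere → RSphere) (x : RSphere) : EReal :=
  liminf (fun n : ℕ => ((Real.log (sphDeriv (f^[n]) x) / n : ℝ) : EReal)) atTop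

/-- The upper Lyapunov exponent `χ̄(x) = limsup (1/n) log |(fⁿ)'(x)|`, as an extended real. -/
def lyapUpper (f : RSphere → RSphere) (x : RSphere) : EReal :=
  limsup (fun n : ℕ => ((Real.log (sphDeriv (f^[n]) x) / n : ℝ) : EReal)) atTop

/-- The level set `𝓛(a,b)` of points of the Julia set with lower exponent `a` and
upper exponent `b`. -/
def levelSet (f : RSphere → RSphere) (a b : EReal) : Set RSphere :=
  {x | x ∈ juliaSet f ∧ lyapLower f x = a ∧ lyapUpper f x = b}

/-- The set `𝓛̂(α,β)` of points of the Julia set with `χ̲ ≤ β`, `χ̄ ≥ α` and `χ̄ > 0`. -/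
def levelHat (f : RSphere → RSphere) (α β : ℝ) : Set RSphere :=
  {x | x ∈ juliaSet f ∧ lyapLower f x ≤ (β : EReal) ∧ (α : EReal) ≤ lyapUpper f x ∧
    0 < lyapUpper f x}

/-- Birkhoff sum `S_m φ = φ + φ∘g + ⋯ + φ∘g^{m-1}`. -/
def birkhoff (g : RSphere → RSphere) (φ : RSphere → ℝ) (m : ℕ) (x : RSphere) : ℝ :=
  ∑ k ∈ Finset.range m, φ (g^[k] x)

/-- An `(m,ε)`-separated finite subset of `Λ` for the map `g`. -/
def IsSepSet (g : RSphere → RSphere) (Λ : Set RSphere) (m : ℕ) (ε : ℝ)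
    (E : Finset RSphere) : Prop :=
  ↑E ⊆ Λ ∧ ∀ x ∈ E, ∀ y ∈ E, x ≠ y → ∃ k < m, ε ≤ dist (g^[k] x) (g^[k] y)

/-- Topological pressure of the potential `φ` for `g` restricted to `Λ`,
defined à la Bowen via `(m,ε)`-separated sets. -/
def pressureOn (g : RSphere → RSphere) (Λ : Set RSphere) (φ : RSphere → ℝ) : ℝ :=
  ⨆ ε : {ε : ℝ // 0 < ε}, limsup (fun m : ℕ =>
    Real.log (⨆ E : {E : Finset RSphere // IsSepSet g Λ m ε.1 E},
      ∑ x ∈ E.1, Real.exp (birkhoff g φ m x)) / m) atTop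

/-- `g` is uniformly expanding on `Λ`: `|(gᵐ)'(x)| ≥ c λᵐ` for some `c > 0`, `λ > 1`. -/
def ExpandingOn (g : RSphere → RSphere) (Λ : Set RSphere) : Prop :=
  ∃ c > (0 : ℝ), ∃ l : ℝ, 1 < l ∧ ∀ x ∈ Λ, ∀ m : ℕ, 1 ≤ m → c * l ^ m ≤ sphDeriv (g^[m]) x

/-- `Λ` is a repeller for `g`: a compact invariant isolated set. -/
def IsRepeller (g : RSphere → RSphere) (Λ : Set RSphere) : Prop :=
  IsCompact Λ ∧ g '' Λ = Λ ∧
    ∃ U : Set RSphere, IsOpen U ∧ Λ ⊆ U ∧ ∀ x, (∀ m : ℕ, g^[m] x ∈ U) → x ∈ Λ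

/-- Topological transitivity of `g` on `Λ`. -/
def TopTransOn (g : RSphere → RSphere) (Λ : Set RSphere) : Prop :=
  ∀ U V : Set RSphere, IsOpen U → IsOpen V → (U ∩ Λ).Nonempty → (V ∩ Λ).Nonempty →
    ∃ m : ℕ, (g^[m] '' (U ∩ Λ) ∩ V).Nonempty

/-- The topological pressure of `φ` with respect to `f` on its Julia set, given by
the supremum of the pressures on compact invariant uniformly expanding subsets of `J`. -/
def pressureTop (f : RSphere → RSphere) (φ : RSphere → ℝ) : ℝ :=
  ⨆ L : {L : Set RSphere //
      L.Nonempty ∧ L ⊆ juliaSet f ∧ IsCompact L ∧ f '' L = L ∧ ExpandingOn f L},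
    pressureOn f L.1 φ

/-- The pressure function `d ↦ P(φ_d)` where `φ_d = -d log|f'|`. -/
def pressFamily (f : RSphere → RSphere) (d : ℝ) : ℝ :=
  pressureTop f fun x => -d * Real.log (sphDeriv f x)

/-- `F(α) = α⁻¹ inf_d (Q(d) + dα)` associated with a pressure function `Q` (for `α ≠ 0`). -/
def specF (Q : ℝ → ℝ) (α : ℝ) : EReal :=
  ((α⁻¹ : ℝ) : EReal) * ⨅ d : ℝ, ((Q d + d * α : ℝ) : EReal)

/-- `F(0) = lim_{α → 0⁺} F(α)`. -/
def specF0 (Q : ℝ → ℝ) : EReal := limsup (fun α : ℝ => specF Q α) (𝓝[>] (0 : ℝ))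

/-- The full spectrum function `F` associated with a pressure function `Q`. -/
def specFext (Q : ℝ → ℝ) (α : ℝ) : EReal := if α = 0 then specF0 Q else specF Q α

/-- The Lyapunov spectrum function `F` of `f`. -/
def Ffun (f : RSphere → RSphere) (α : ℝ) : EReal := specFext (pressFamily f) α

/-- `α⁻ = lim_{d → +∞} -Q(d)/d` for a pressure function `Q`. -/
def alphaMinusOf (Q : ℝ → ℝ) : ℝ := limsup (fun d : ℝ => -Q d / d) atTop

/-- `α⁺ = lim_{d → -∞} -Q(d)/d` for a pressure function `Q`. -/
def alphaPlusOf (Q : ℝ → ℝ) : ℝ := limsup (fun d : ℝ => -Q d / d) atBot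

/-- `α⁻` for the map `f`. -/
def alphaMinus (f : RSphere → RSphere) : ℝ := alphaMinusOf (pressFamily f)

/-- `α⁺` for the map `f`. -/
def alphaPlus (f : RSphere → RSphere) : ℝ := alphaPlusOf (pressFamily f)

/-- The Lyapunov exponent `χ(μ) = ∫ log|g'| dμ` of a measure. -/
def lyapMeas (g : RSphere → RSphere) (μ : Measure RSphere) : ℝ :=
  ∫ x, Real.log (sphDeriv g x) ∂μ

/-- `α⁻` as the infimum of Lyapunov exponents of invariant probability measures on `J`. -/
def alphaMinusMeas (f : RSphere → RSphere) : ℝ :=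
  sInf {r : ℝ | ∃ μ : Measure RSphere, IsProbabilityMeasure μ ∧ MeasurePreserving f μ μ ∧
    μ (juliaSet f)ᶜ = 0 ∧ r = lyapMeas f μ}

/-- `α⁺` as the supremum of Lyapunov exponents of invariant probability measures on `J`. -/
def alphaPlusMeas (f : RSphere → RSphere) : ℝ :=
  sSup {r : ℝ | ∃ μ : Measure RSphere, IsProbabilityMeasure μ ∧ MeasurePreserving f μ μ ∧
    μ (juliaSet f)ᶜ = 0 ∧ r = lyapMeas f μ}

/-- The maximal distortion `sup_{x,y ∈ Z} |g'(x)|/|g'(y)|` of `g` on `Z`. -/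
def distortionOn (g : RSphere → RSphere) (Z : Set RSphere) : ℝ :=
  sSup {r : ℝ | ∃ x ∈ Z, ∃ y ∈ Z, r = sphDeriv g x / sphDeriv g y}

/-- Conical points. -/
def IsConical (f : RSphere → RSphere) (x : RSphere) : Prop :=
  ∃ r : ℝ, 0 < r ∧ ∃ K : ℝ, ∃ n : ℕ → ℕ, StrictMono n ∧ ∃ U : ℕ → Set RSphere,
    ∀ i, U i ∈ 𝓝 x ∧ ball (f^[n i] x) r ⊆ f^[n i] '' U i ∧ distortionOn (f^[n i]) (U i) ≤ K

/-- A non-immediately postcritical point: there is a backward orbit through it that is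
dense in the Julia set and avoids the critical points. -/
def NonImmPostCrit (f : RSphere → RSphere) (x : RSphere) : Prop :=
  ∃ b : ℕ → RSphere, b 0 = x ∧ (∀ n, f (b (n + 1)) = b n) ∧
    juliaSet f ⊆ closure (Set.range b) ∧ ∀ n, b n ∉ critSet f

/-- `f` is exceptional: there is a finite nonempty set `Σ_f` with `f⁻¹(Σ_f) \ Crit = Σ_f`. -/
def IsExceptional (f : RSphere → RSphere) : Prop :=
  ∃ S : Set RSphere, S.Finite ∧ S.Nonempty ∧ f ⁻¹' S \ critSet f = S

/-- The largest exceptional set `Σ` of `f`. -/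
def maxExceptional (f : RSphere → RSphere) : Set RSphere :=
  ⋃₀ {S : Set RSphere | S.Finite ∧ S.Nonempty ∧ f ⁻¹' S \ critSet f = S}

/-- `0` not being exceptional, or having exceptional set away from the Julia set. -/
def GoodExc (f : RSphere → RSphere) : Prop :=
  ¬ IsExceptional f ∨ maxExceptional f ∩ juliaSet f = ∅

/-- A parabolic periodic point at a finite point `z`: a periodic point whose multiplier
is a root of unity. -/
def IsParabolicFix (g : RSphere → RSphere) (z : ℂ) : Prop :=
  ∃ m : ℕ, 0 < m ∧ g^[m] (RSphere.ofC z) = RSphere.ofC z ∧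
    ∃ lam : ℂ, (∃ k : ℕ, 0 < k ∧ lam ^ k = 1) ∧
      HasDerivAt (fun w => RSphere.toC (g^[m] (RSphere.ofC w))) lam z

/-- A parabolic periodic point of `f` (at a finite point, or at `∞` read in the chart `1/z`). -/
def IsParabolic (f : RSphere → RSphere) (x : RSphere) : Prop :=
  (∃ z : ℂ, x = RSphere.ofC z ∧ IsParabolicFix f z) ∨
  (x = RSphere.infty ∧ IsParabolicFix (fun y => RSphere.inv (f (RSphere.inv y))) 0)

/-- A recurrent point. -/
def IsRecurrentPt (f : RSphere → RSphere) (x : RSphere) : Prop :=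
  ∃ n : ℕ → ℕ, StrictMono n ∧ Tendsto (fun i => f^[n i] x) atTop (𝓝 x)

/-! ### Graph directed systems and expanding Cantor repellers -/

/-- A graph directed system (GDS) satisfying the strong separation condition with
respect to the map `g`. -/
structure GDS (g : RSphere → RSphere) where
  /-- number of vertices -/
  n : ℕ
  npos : 0 < n
  /-- the open domains -/
  U : Fin n → Set RSphere
  /-- the admissible edges -/
  edge : Fin n → Fin n → Prop
  /-- the inverse branches -/
  br : Fin n → Fin n → RSphere → RSphere
  isOpen : ∀ k, IsOpen (U k)
  isConnected : ∀ k, IsConnected (U k)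
  disjClosure : ∀ k l, k ≠ l → closure (U k) ∩ closure (U l) = ∅
  mapsTo : ∀ k l, edge k l → Set.MapsTo (br k l) (closure (U l)) (U k)
  isBranch : ∀ k l, edge k l → ∀ x ∈ closure (U l), g (br k l x) = x
  bddDistortion : ∃ C : ℝ, ∀ k l, edge k l → distortionOn (br k l) (closure (U l)) ≤ C

/-- The cylinder sets of depth `m` of a GDS. -/
def gdsCyl {g : RSphere → RSphere} (G : GDS g) : ℕ → Set RSphere
  | 0 => ⋃ k, G.U k
  | m + 1 => ⋃ (k : Fin G.n) (l : Fin G.n) (_ : G.edge k l),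
      G.br k l '' (gdsCyl G m ∩ G.U l)

/-- The limit set of a GDS. -/
def gdsLimit {g : RSphere → RSphere} (G : GDS g) : Set RSphere := ⋂ m, gdsCyl G m

/-- An expanding Cantor repeller (ECR) for `g`: a uniformly expanding repeller which is
the limit set of a GDS satisfying the strong separation condition, with `g(Λ) = Λ`. -/
def IsECR (g : RSphere → RSphere) (Λ : Set RSphere) : Prop :=
  ExpandingOn g Λ ∧ IsRepeller g Λ ∧ ∃ G : GDS g, gdsLimit G = Λ

/-- A Cantor set: compact, perfect and totally disconnected. -/
def IsCantorSet (s : Set RSphere) : Prop :=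
  IsCompact s ∧ Perfect s ∧ IsTotallyDisconnected s

/-! ### Entropy, equilibrium states and dimensions -/

/-- The entropy of a countable partition (given by the fibers of `p`). -/
def partEntropy {ι : Type} [Countable ι] (μ : Measure RSphere) (p : RSphere → ι) : ℝ :=
  ∑' i : ι, Real.negMulLog (μ (p ⁻¹' {i})).toReal

/-- Measure-theoretic (Kolmogorov–Sinai) entropy of `T` with respect to `μ`:
supremum over finite measurable partitions of the exponential growth rate of the
entropies of the dynamical refinements. -/
def entropyOf (T : RSphere → RSphere) (μ : Measure RSphere) : ℝ :=
  ⨆ p : {p : RSphere → ℕ // Measurable p ∧ (Set.range p).Finite},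
    ⨅ n : {n : ℕ // 0 < n},
      partEntropy μ (fun x => fun k : Fin n.1 => p.1 (T^[(k : ℕ)] x)) / (n.1 : ℝ)

/-- An equilibrium state for the potential `φ` with respect to `g` restricted to `Λ`. -/
def IsEquilibrium (g : RSphere → RSphere) (Λ : Set RSphere) (φ : RSphere → ℝ)
    (μ : Measure RSphere) : Prop :=
  IsProbabilityMeasure μ ∧ μ Λᶜ = 0 ∧ MeasurePreserving g μ μ ∧
    entropyOf g μ + ∫ x, φ x ∂μ = pressureOn g Λ φ

/-- The Hausdorff dimension of a measure: the infimum of the Hausdorff dimensions of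
sets of full measure. -/
def dimHMeasure (μ : Measure RSphere) : ℝ≥0∞ :=
  ⨅ (s : Set RSphere) (_ : μ sᶜ = 0), dimH s

/-- The minimal number of `ε`-balls needed to cover `s`. -/
def coverNum (s : Set RSphere) (ε : ℝ) : ℕ :=
  sInf {n : ℕ | ∃ t : Finset RSphere, t.card = n ∧ s ⊆ ⋃ x ∈ t, ball x ε}

/-- The upper box-counting dimension. -/
def upperBoxDim (s : Set RSphere) : ℝ :=
  limsup (fun n : ℕ => Real.log (coverNum s (1 / n)) / Real.log n) atTop

/-- The packing dimension, via countable covers and upper box dimensions. -/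
def dimP (s : Set RSphere) : ℝ≥0∞ :=
  ⨅ c : {c : ℕ → Set RSphere // s ⊆ ⋃ n, c n},
    ⨆ n : ℕ, ENNReal.ofReal (upperBoxDim (c.1 n))

/-- The connected component of `y` in `g⁻¹(B)`: the pull-back of `B` along the inverse
branch of `g` sending (the image of) `y` to `y`. -/
def invBranchSet (g : RSphere → RSphere) (B : Set RSphere) (y : RSphere) : Set RSphere :=
  connectedComponentIn (g ⁻¹' B) y

end

namespace RSphere

lemma dist_sq_ofC (z w : ℂ) : dist (ofC z) (ofC w) ^ 2 =
    4 * ‖z - w‖ ^ 2 / ((1 + ‖z‖ ^ 2) * (1 + ‖w‖ ^ 2)) := by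
  change dist (embed (ofC z)) (embed (ofC w)) ^ 2 = _
  rw [WithLp.prod_dist_eq_of_L2, Real.sq_sqrt (by positivity)]
  simp only [embed, ofC, elim, Option.elim, WithLp.equiv_symm_apply, WithLp.toLp_fst,
    WithLp.toLp_snd]
  rw [dist_eq_norm, dist_eq_norm, Real.norm_eq_abs, sq_abs]
  have hz : ‖z‖ ^ 2 = z.re ^ 2 + z.im ^ 2 := by rw [Complex.sq_norm, Complex.normSq_apply]; ring
  have hw : ‖w‖ ^ 2 = w.re ^ 2 + w.im ^ 2 := by rw [Complex.sq_norm, Complex.normSq_apply]; ring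
  rw [Complex.sq_norm (z - w), Complex.sq_norm (_ - _), Complex.normSq_apply, Complex.normSq_apply,
    hz, hw]
  simp only [Complex.sub_re, Complex.sub_im, Complex.smul_re, Complex.smul_im, smul_eq_mul]
  have h1 : z.re ^ 2 + z.im ^ 2 + 1 ≠ 0 := by positivity
  have h2 : w.re ^ 2 + w.im ^ 2 + 1 ≠ 0 := by positivity
  have h3 : 1 + (z.re ^ 2 + z.im ^ 2) ≠ 0 := by positivity
  have h4 : 1 + (w.re ^ 2 + w.im ^ 2) ≠ 0 := by positivity
  field_simp
  ring

lemma dist_ofC (z w : ℂ) : dist (ofC z) (ofC w) =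
    2 * ‖z - w‖ / (√(1 + ‖z‖ ^ 2) * √(1 + ‖w‖ ^ 2)) := by
  rw [← Real.sqrt_sq (dist_nonneg (x := ofC z) (y := ofC w)), dist_sq_ofC,
    ← Real.sqrt_mul (by positivity), Real.sqrt_div (by positivity)]
  congr 1
  rw [Real.sqrt_eq_iff_mul_self_eq (by positivity) (by positivity)]
  ring

lemma dist_ofC_infty (z : ℂ) : dist (ofC z) infty = 2 / √(1 + ‖z‖ ^ 2) := by
  have : dist (ofC z) infty ^ 2 = 4 / (1 + ‖z‖ ^ 2) := by
    change dist (embed (ofC z)) (embed infty) ^ 2 = _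
    rw [WithLp.prod_dist_eq_of_L2, Real.sq_sqrt (by positivity)]
    simp only [embed, ofC, infty, elim, Option.elim, WithLp.equiv_symm_apply, WithLp.toLp_fst,
      WithLp.toLp_snd]
    rw [dist_eq_norm, dist_eq_norm, Real.norm_eq_abs, sq_abs, sub_zero, norm_smul, mul_pow,
      Real.norm_eq_abs, sq_abs]
    have h3 : 1 + ‖z‖ ^ 2 ≠ 0 := by positivity
    have h1 : ‖z‖ ^ 2 + 1 ≠ 0 := by positivity
    field_simp
    ring
  rw [← Real.sqrt_sq (dist_nonneg (x := ofC z) (y := infty)), this, Real.sqrt_div (by positivity)]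
  congr 1
  rw [Real.sqrt_eq_iff_mul_self_eq (by positivity) (by positivity)]
  ring

@[simp] lemma ofC_inj {z w : ℂ} : ofC z = ofC w ↔ z = w := by simp [ofC]

@[simp] lemma ofC_ne_infty (z : ℂ) : ofC z ≠ infty := by simp [ofC, infty]

@[simp] lemma toC_ofC (z : ℂ) : toC (ofC z) = z := rfl

lemma cases_ofC (x : RSphere) : x = infty ∨ ∃ z, x = ofC z := by
  rcases x with ⟨_ | z⟩
  · exact Or.inl rfl
  · exact Or.inr ⟨z, rfl⟩

@[simp] lemma inv_ofC_zero : inv (ofC 0) = infty := by simp [inv, ofC, elim]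

lemma inv_ofC {z : ℂ} (hz : z ≠ 0) : inv (ofC z) = ofC z⁻¹ := by simp [inv, ofC, elim, hz]

@[simp] lemma inv_infty : inv infty = ofC 0 := by simp [inv, infty, elim]

@[simp] lemma inv_inv (x : RSphere) : inv (inv x) = x := by
  rcases cases_ofC x with rfl | ⟨z, rfl⟩
  · simp
  · by_cases hz : z = 0
    · simp [hz]
    · rw [inv_ofC hz, inv_ofC (inv_ne_zero hz), _root_.inv_inv]

lemma isometry_inv : Isometry inv := by
  have key : ∀ x y : RSphere, dist (inv (ofC x.toC)) (inv (ofC y.toC)) =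
      dist (ofC x.toC) (ofC y.toC) := by
    intro x y
    generalize x.toC = z
    generalize y.toC = w
    have h0 : ∀ z : ℂ, z ≠ 0 → dist (inv (ofC z)) (inv (ofC 0)) = dist (ofC z) (ofC 0) := by
      intro z hz
      rw [inv_ofC hz, inv_ofC_zero, dist_ofC_infty, dist_ofC]
      have hz' : 0 < ‖z‖ := norm_pos_iff.2 hz
      have : √(1 + ‖z⁻¹‖ ^ 2) = √(1 + ‖z‖ ^ 2) / ‖z‖ := by
        rw [norm_inv, Real.sqrt_eq_iff_mul_self_eq (by positivity) (by positivity)]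
        have := Real.mul_self_sqrt (show 0 ≤ 1 + ‖z‖ ^ 2 by positivity)
        field_simp
        nlinarith
      rw [this]
      simp only [sub_zero, norm_zero, ne_eq, OfNat.ofNat_ne_zero, not_false_eq_true, zero_pow,
        add_zero, Real.sqrt_one, mul_one]
      field_simp
    by_cases hz : z = 0
    · by_cases hw : w = 0
      · simp [hz, hw]
      · rw [hz, dist_comm, h0 w hw, dist_comm]
    · by_cases hw : w = 0
      · rw [hw, h0 z hz]
      · rw [inv_ofC hz, inv_ofC hw]
        rw [← sq_eq_sq₀ dist_nonneg dist_nonneg, dist_sq_ofC, dist_sq_ofC]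
        have hz' : 0 < ‖z‖ := norm_pos_iff.2 hz
        have hw' : 0 < ‖w‖ := norm_pos_iff.2 hw
        have : z⁻¹ - w⁻¹ = (w - z) / (z * w) := by field_simp
        rw [this, norm_div, norm_mul, norm_inv, norm_inv, norm_sub_rev]
        field_simp
        ring
  have h1 : ∀ z : ℂ, dist (inv (ofC z)) (inv infty) = dist (ofC z) infty := by
    intro z
    rw [inv_infty]
    by_cases hz : z = 0
    · simp [hz, dist_comm]
    · rw [inv_ofC hz, ← inv_inv infty, inv_infty]
      have := key (ofC z⁻¹) (ofC 0)
      simp only [toC_ofC] at this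
      rw [← this, inv_ofC (inv_ne_zero hz), _root_.inv_inv]
  refine Isometry.of_dist_eq fun x y => ?_
  rcases cases_ofC x with rfl | ⟨z, rfl⟩
  · rcases cases_ofC y with rfl | ⟨w, rfl⟩
    · simp
    · rw [dist_comm, h1, dist_comm]
  · rcases cases_ofC y with rfl | ⟨w, rfl⟩
    · exact h1 z
    · exact key (ofC z) (ofC w)

lemma continuous_inv : Continuous inv := isometry_inv.continuous

lemma dist_ofC_le (z w : ℂ) : dist (ofC z) (ofC w) ≤ 2 * ‖z - w‖ := by
  rw [dist_ofC]
  refine div_le_self (by positivity) ?_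
  have h1 : (1 : ℝ) ≤ √(1 + ‖z‖ ^ 2) := by rw [Real.one_le_sqrt]; nlinarith [sq_nonneg ‖z‖]
  have h2 : (1 : ℝ) ≤ √(1 + ‖w‖ ^ 2) := by rw [Real.one_le_sqrt]; nlinarith [sq_nonneg ‖w‖]
  nlinarith

lemma continuous_ofC : Continuous ofC := by
  have : LipschitzWith 2 ofC := LipschitzWith.of_dist_le_mul fun z w => by
    rw [dist_eq_norm z w]; exact_mod_cast dist_ofC_le z w
  exact this.continuous

lemma continuousAt_toC (z : ℂ) : ContinuousAt toC (ofC z) := by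
  have hz : 0 < √(1 + ‖z‖ ^ 2) := Real.sqrt_pos.2 (by positivity)
  have hfin : ∀ᶠ x in 𝓝 (ofC z), x ≠ infty :=
    isOpen_ne.mem_nhds (ofC_ne_infty z)
  -- `‖w‖` is controlled by the distance to infinity, then invert the distance formula
  have hd : Tendsto (fun x : RSphere => dist x (ofC z) * √(1 + ‖z‖ ^ 2) / dist x infty) (𝓝 (ofC z))
      (𝓝 0) := by
    have : Tendsto (fun x : RSphere => dist x (ofC z) * √(1 + ‖z‖ ^ 2) / dist x infty) (𝓝 (ofC z))
      (𝓝 (dist (ofC z) (ofC z) * √(1 + ‖z‖ ^ 2) / dist (ofC z) infty)) := by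
      refine Tendsto.div ?_ ?_ (dist_ne_zero.2 (ofC_ne_infty z))
      · exact ((continuous_id.dist continuous_const).mul continuous_const).tendsto _
      · exact (continuous_id.dist continuous_const).tendsto _
    simpa using this
  rw [ContinuousAt, tendsto_iff_dist_tendsto_zero]
  refine hd.congr' ?_
  filter_upwards [hfin] with x hx
  rcases cases_ofC x with rfl | ⟨w, rfl⟩
  · exact absurd rfl hx
  · have hw : 0 < √(1 + ‖w‖ ^ 2) := Real.sqrt_pos.2 (by positivity)
    rw [dist_ofC, dist_ofC_infty, toC_ofC, toC_ofC, dist_eq_norm]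
    field_simp

lemma isOpen_range_ofC : IsOpen (range ofC) := by
  have : range ofC = {infty}ᶜ := by
    ext x
    rcases cases_ofC x with rfl | ⟨z, rfl⟩ <;> simp
  rw [this]; exact isOpen_compl_singleton

lemma map_ofC_nhds (z : ℂ) : Filter.map ofC (𝓝 z) = 𝓝 (ofC z) := by
  apply le_antisymm (continuous_ofC.tendsto z)
  have h1 : (fun x => ofC (toC x)) =ᶠ[𝓝 (ofC z)] id := by
    filter_upwards [isOpen_range_ofC.mem_nhds ⟨z, rfl⟩]
    rintro _ ⟨w, rfl⟩
    rfl
  calc 𝓝 (ofC z) = Filter.map id (𝓝 (ofC z)) := Filter.map_id.symm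
    _ = Filter.map (fun x => ofC (toC x)) (𝓝 (ofC z)) := (Filter.map_congr h1).symm
    _ = Filter.map ofC (Filter.map toC (𝓝 (ofC z))) := by rw [Filter.map_map]; rfl
    _ ≤ Filter.map ofC (𝓝 z) := Filter.map_mono (continuousAt_toC z)

lemma map_ofC_nhdsNE (z : ℂ) : Filter.map ofC (𝓝[≠] z) = 𝓝[≠] (ofC z) := by
  have hinj : Function.Injective ofC := fun a b h => ofC_inj.1 h
  rw [nhdsWithin, nhdsWithin, Filter.map_inf hinj, map_ofC_nhds, Filter.map_principal]
  have : ofC '' {z}ᶜ = {ofC z}ᶜ ∩ range ofC := by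
    ext x
    constructor
    · rintro ⟨w, hw, rfl⟩
      exact ⟨by simpa using hw, w, rfl⟩
    · rintro ⟨h, w, rfl⟩
      exact ⟨w, by simpa using h, rfl⟩
  rw [this, ← Filter.inf_principal, inf_comm (𝓟 _), ← inf_assoc]
  congr 1
  rw [inf_eq_left, le_principal_iff]
  exact isOpen_range_ofC.mem_nhds ⟨z, rfl⟩

/-- The involution `inv` as a homeomorphism. -/
noncomputable def invHomeo : RSphere ≃ₜ RSphere where
  toFun := inv
  invFun := inv
  left_inv := inv_inv
  right_inv := inv_inv
  continuous_toFun := continuous_inv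
  continuous_invFun := continuous_inv

lemma map_inv_nhds (x : RSphere) : Filter.map inv (𝓝 x) = 𝓝 (inv x) := invHomeo.map_nhds_eq x

lemma map_inv_nhdsNE (x : RSphere) : Filter.map inv (𝓝[≠] x) = 𝓝[≠] (inv x) :=
  invHomeo.map_punctured_nhds_eq x

instance : CompactSpace RSphere := by
  have h1 : IsCompact (ofC '' closedBall 0 1) :=
    (isCompact_closedBall 0 1).image continuous_ofC
  have h2 : IsCompact (inv '' (ofC '' closedBall 0 1)) := h1.image continuous_inv
  refine ⟨(h1.union h2).of_isClosed_subset isClosed_univ fun x _ => ?_⟩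
  rcases cases_ofC x with rfl | ⟨z, rfl⟩
  · exact Or.inr ⟨ofC 0, ⟨0, by simp, rfl⟩, by simp⟩
  · by_cases hz : ‖z‖ ≤ 1
    · exact Or.inl ⟨z, by simpa using hz, rfl⟩
    · right
      push Not at hz
      have hz0 : z ≠ 0 := by rintro rfl; simp at hz; linarith
      refine ⟨ofC z⁻¹, ⟨z⁻¹, ?_, rfl⟩, ?_⟩
      · simp only [mem_closedBall, dist_zero_right, norm_inv]
        exact inv_le_one_of_one_le₀ hz.le
      · rw [inv_ofC (inv_ne_zero hz0), _root_.inv_inv]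

instance (x : RSphere) : (𝓝[≠] x).NeBot := by
  rcases cases_ofC x with rfl | ⟨z, rfl⟩
  · rw [← inv_ofC_zero, ← map_inv_nhdsNE, ← map_ofC_nhdsNE]; infer_instance
  · rw [← map_ofC_nhdsNE]; infer_instance

instance : PerfectSpace RSphere := perfectSpace_iff_forall_not_isolated.2 inferInstance

end RSphere

section

open RSphere

/-- `s` is the strict metric derivative of `f` at `x`: nearby distances are scaled by `s` up to a
relative error tending to zero. -/
def HasScaling (f : RSphere → RSphere) (x : RSphere) (s : ℝ) : Prop :=
  ∀ ε > 0, ∀ᶠ p : RSphere × RSphere in 𝓝 (x, x),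
    |dist (f p.1) (f p.2) - s * dist p.1 p.2| ≤ ε * dist p.1 p.2

lemma hasScaling_aux {g : ℂ → ℂ} {g' w : ℂ} (hg : HasStrictDerivAt g g' w) :
    ∀ ε > 0, ∀ᶠ p : ℂ × ℂ in 𝓝 (w, w),
      |dist (ofC (g p.1)) (ofC (g p.2)) -
        ‖g'‖ * (1 + ‖w‖ ^ 2) / (1 + ‖g w‖ ^ 2) * dist (ofC p.1) (ofC p.2)| ≤
        ε * dist (ofC p.1) (ofC p.2) := by
  intro ε hε
  set s := ‖g'‖ * (1 + ‖w‖ ^ 2) / (1 + ‖g w‖ ^ 2) with hs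
  have hgc : ContinuousAt g w := hg.hasDerivAt.continuousAt
  let k : ℂ × ℂ → ℝ := fun p => 2 / (√(1 + ‖p.1‖ ^ 2) * √(1 + ‖p.2‖ ^ 2))
  have hkc : ∀ a : ℂ, ContinuousAt k (a, a) := by
    intro a
    refine ContinuousAt.div continuousAt_const ?_ (by positivity)
    fun_prop
  have hk0 : ∀ a : ℂ, k (a, a) = 2 / (1 + ‖a‖ ^ 2) := by
    intro a
    simp only [k]
    rw [Real.mul_self_sqrt (by positivity)]
  have hkpos : ∀ p, 0 < k p := fun p => by positivity
  have hdist : ∀ a b, dist (ofC a) (ofC b) = k (a, b) * ‖a - b‖ := by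
    intro a b
    rw [dist_ofC]; simp only [k]; ring
  set η := ε * k (w, w) / (2 * k (g w, g w)) with hη
  have hηpos : 0 < η := by
    have := hkpos (w, w); have := hkpos (g w, g w); positivity
  have h1 : ∀ᶠ p : ℂ × ℂ in 𝓝 (w, w), ‖g p.1 - g p.2 - (p.1 - p.2) * g'‖ ≤ η * ‖p.1 - p.2‖ := by
    have := hg.hasStrictFDerivAt.isLittleO.def hηpos
    simpa [smul_eq_mul] using this
  have hG : Tendsto (fun p : ℂ × ℂ => (g p.1, g p.2)) (𝓝 (w, w)) (𝓝 (g w, g w)) := by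
    rw [nhds_prod_eq, nhds_prod_eq]
    exact (hgc.tendsto).prodMap hgc
  have hlim : Tendsto (fun p : ℂ × ℂ => (η * k (g p.1, g p.2) +
      |‖g'‖ * k (g p.1, g p.2) - s * k p|) / k p) (𝓝 (w, w))
      (𝓝 ((η * k (g w, g w) + |‖g'‖ * k (g w, g w) - s * k (w, w)|) / k (w, w))) := by
    have hk1 := (hkc (g w)).tendsto.comp hG
    have hk2 := (hkc w).tendsto
    exact ((hk1.const_mul η).add ((hk1.const_mul ‖g'‖).sub (hk2.const_mul s)).abs).div hk2
      (hkpos _).ne'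
  have hval : (η * k (g w, g w) + |‖g'‖ * k (g w, g w) - s * k (w, w)|) / k (w, w) < ε := by
    have : ‖g'‖ * k (g w, g w) - s * k (w, w) = 0 := by
      rw [hk0, hk0, hs]
      have h3 : 1 + ‖g w‖ ^ 2 ≠ 0 := by positivity
      have h4 : 1 + ‖w‖ ^ 2 ≠ 0 := by positivity
      field_simp
      ring
    rw [this, abs_zero, add_zero, div_lt_iff₀ (hkpos _), hη]
    have := hkpos (w, w); have := hkpos (g w, g w)
    field_simp
    linarith
  filter_upwards [h1, hlim.eventually_lt_const hval] with p hp1 hp2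
  rw [div_lt_iff₀ (hkpos _)] at hp2
  rw [hdist, hdist]
  set K := k (g p.1, g p.2)
  have hK : 0 < K := hkpos _
  have hd : |‖g p.1 - g p.2‖ - ‖g'‖ * ‖p.1 - p.2‖| ≤ η * ‖p.1 - p.2‖ := by
    rw [mul_comm ‖g'‖, ← norm_mul]
    exact (abs_norm_sub_norm_le _ _).trans hp1
  calc |K * ‖g p.1 - g p.2‖ - s * (k (p.1, p.2) * ‖p.1 - p.2‖)|
      = |K * (‖g p.1 - g p.2‖ - ‖g'‖ * ‖p.1 - p.2‖) +
          (‖g'‖ * K - s * k p) * ‖p.1 - p.2‖| := by congr 1; ring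
    _ ≤ K * (η * ‖p.1 - p.2‖) + |‖g'‖ * K - s * k p| * ‖p.1 - p.2‖ := by
        refine (abs_add_le _ _).trans (add_le_add ?_ ?_)
        · rw [abs_mul, abs_of_pos hK]
          gcongr
        · rw [abs_mul, abs_norm]
    _ = (η * K + |‖g'‖ * K - s * k p|) * ‖p.1 - p.2‖ := by ring
    _ ≤ (ε * k p) * ‖p.1 - p.2‖ := by gcongr
    _ = ε * (k (p.1, p.2) * ‖p.1 - p.2‖) := by ring

namespace HasScaling

variable {f g : RSphere → RSphere} {x : RSphere} {s t : ℝ}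

lemma tendsto (h : HasScaling f x s) :
    Tendsto (fun y => dist (f y) (f x) / dist y x) (𝓝[≠] x) (𝓝 s) := by
  rw [Metric.tendsto_nhds]
  intro ε hε
  have h1 := h (ε / 2) (by positivity)
  have h2 : Tendsto (fun y : RSphere => (y, x)) (𝓝[≠] x) (𝓝 (x, x)) :=
    ((continuous_id.prodMk continuous_const).tendsto x).mono_left nhdsWithin_le_nhds
  filter_upwards [h2.eventually h1, self_mem_nhdsWithin] with y hy hyx
  have hd : 0 < dist y x := dist_pos.2 hyx
  rw [Real.dist_eq, div_sub' hd.ne', abs_div, abs_of_pos hd, div_lt_iff₀ hd, mul_comm (dist y x)]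
  nlinarith

lemma sphDeriv_eq (h : HasScaling f x s) : sphDeriv f x = s := h.tendsto.limsup_eq

lemma nonneg (h : HasScaling f x s) : 0 ≤ s :=
  ge_of_tendsto' h.tendsto fun _ => by positivity

lemma eventually_le (h : HasScaling f x s) (ht : s < t) :
    ∀ᶠ p : RSphere × RSphere in 𝓝 (x, x), dist (f p.1) (f p.2) ≤ t * dist p.1 p.2 := by
  filter_upwards [h (t - s) (by linarith)] with p hp
  linarith [(abs_le.1 hp).2]

lemma eventually_ge (h : HasScaling f x s) (ht : t < s) :
    ∀ᶠ p : RSphere × RSphere in 𝓝 (x, x), t * dist p.1 p.2 ≤ dist (f p.1) (f p.2) := by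
  filter_upwards [h (s - t) (by linarith)] with p hp
  linarith [(abs_le.1 hp).1]

lemma continuousAt (h : HasScaling f x s) : ContinuousAt f x := by
  have h1 := h.eventually_le (lt_add_one s)
  have h2 : Tendsto (fun y : RSphere => (y, x)) (𝓝 x) (𝓝 (x, x)) :=
    (continuous_id.prodMk continuous_const).tendsto x
  rw [ContinuousAt, tendsto_iff_dist_tendsto_zero]
  refine squeeze_zero' (Eventually.of_forall fun _ => dist_nonneg) (h2.eventually h1) ?_
  have : Tendsto (fun y => (s + 1) * dist y x) (𝓝 x) (𝓝 ((s + 1) * dist x x)) :=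
    ((continuous_id.dist continuous_const).const_mul (s + 1) |>.tendsto x)
  simpa using this

lemma comp (hg : HasScaling g (f x) t) (hf : HasScaling f x s) :
    HasScaling (g ∘ f) x (t * s) := by
  intro ε hε
  have hs := hf.nonneg
  have ht := hg.nonneg
  obtain ⟨δ, hδ, hδ'⟩ : ∃ δ : ℝ, 0 < δ ∧ δ * (s + 1) + t * δ ≤ ε := by
    refine ⟨ε / (s + 1 + t), by positivity, ?_⟩
    rw [mul_comm t, ← mul_add, div_mul_cancel₀ _ (by positivity)]
  have hF : Tendsto (fun p : RSphere × RSphere => (f p.1, f p.2)) (𝓝 (x, x)) (𝓝 (f x, f x)) := by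
    rw [nhds_prod_eq, nhds_prod_eq]
    exact hf.continuousAt.tendsto.prodMap hf.continuousAt
  filter_upwards [hf δ hδ, hf 1 one_pos, hF.eventually (hg δ hδ)] with p h1 h2 h3
  simp only [Function.comp]
  have h4 : dist (f p.1) (f p.2) ≤ (s + 1) * dist p.1 p.2 := by linarith [(abs_le.1 h2).2]
  have hd : 0 ≤ dist p.1 p.2 := dist_nonneg
  calc |dist (g (f p.1)) (g (f p.2)) - t * s * dist p.1 p.2|
      = |(dist (g (f p.1)) (g (f p.2)) - t * dist (f p.1) (f p.2)) +
          t * (dist (f p.1) (f p.2) - s * dist p.1 p.2)| := by congr 1; ring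
    _ ≤ δ * ((s + 1) * dist p.1 p.2) + t * (δ * dist p.1 p.2) := by
        refine (abs_add_le _ _).trans (add_le_add (h3.trans (by gcongr)) ?_)
        rw [abs_mul, abs_of_nonneg ht]
        gcongr
    _ = (δ * (s + 1) + t * δ) * dist p.1 p.2 := by ring
    _ ≤ ε * dist p.1 p.2 := by gcongr

end HasScaling

/-- `u` is holomorphic at `w` as a map into the Riemann sphere. -/
def SHolAt (u : ℂ → RSphere) (w : ℂ) : Prop :=
  ∃ g : ℂ → ℂ, AnalyticAt ℂ g w ∧
    ((u =ᶠ[𝓝 w] fun ζ => ofC (g ζ)) ∨ (u =ᶠ[𝓝 w] fun ζ => inv (ofC (g ζ))))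

/-- Holomorphic self-maps of the Riemann sphere. -/
def SHol (f : RSphere → RSphere) : Prop :=
  ∀ w, SHolAt (fun ζ => f (ofC ζ)) w ∧ SHolAt (fun ζ => f (inv (ofC ζ))) w

lemma SHol.comp_at {f : RSphere → RSphere} (hf : SHol f) {u : ℂ → RSphere} {w : ℂ}
    (hu : SHolAt u w) : SHolAt (fun ζ => f (u ζ)) w := by
  have key : ∀ (v : ℂ → RSphere) (g : ℂ → ℂ), AnalyticAt ℂ g w → SHolAt v (g w) →
      SHolAt (fun ζ => v (g ζ)) w := by
    rintro v g hg ⟨k, hk, h⟩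
    refine ⟨k ∘ g, hk.comp hg, h.imp ?_ ?_⟩ <;> intro h <;> exact hg.continuousAt.eventually h
  obtain ⟨g, hg, hu | hu⟩ := hu
  · obtain ⟨k, hk, h⟩ := key _ g hg (hf (g w)).1
    have e : (fun ζ => f (u ζ)) =ᶠ[𝓝 w] fun ζ => f (ofC (g ζ)) := hu.fun_comp f
    exact ⟨k, hk, h.imp e.trans e.trans⟩
  · obtain ⟨k, hk, h⟩ := key _ g hg (hf (g w)).2
    have e : (fun ζ => f (u ζ)) =ᶠ[𝓝 w] fun ζ => f (inv (ofC (g ζ))) := hu.fun_comp f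
    exact ⟨k, hk, h.imp e.trans e.trans⟩

lemma sHol_id : SHol id := fun _ =>
  ⟨⟨id, analyticAt_id, Or.inl .rfl⟩, ⟨id, analyticAt_id, Or.inr .rfl⟩⟩

lemma SHol.iterate {f : RSphere → RSphere} (hf : SHol f) (n : ℕ) : SHol f^[n] := by
  induction n with
  | zero => exact sHol_id
  | succ n ih =>
    intro w
    simp only [Function.iterate_succ', Function.comp]
    exact ⟨hf.comp_at (ih w).1, hf.comp_at (ih w).2⟩

/-- Local normal form of a holomorphic self-map of the sphere. -/
lemma SHol.exists_chart {f : RSphere → RSphere} (hf : SHol f) (x : RSphere) :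
    ∃ (σ τ : RSphere → RSphere) (w : ℂ) (g : ℂ → ℂ), (σ = id ∨ σ = inv) ∧ (τ = id ∨ τ = inv) ∧
      x = σ (ofC w) ∧ AnalyticAt ℂ g w ∧ ∀ᶠ ζ in 𝓝 w, f (σ (ofC ζ)) = τ (ofC (g ζ)) := by
  obtain ⟨σ, w, hσ, hx, hu⟩ : ∃ (σ : RSphere → RSphere) (w : ℂ), (σ = id ∨ σ = inv) ∧
      x = σ (ofC w) ∧ SHolAt (fun ζ => f (σ (ofC ζ))) w := by
    rcases cases_ofC x with rfl | ⟨w, rfl⟩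
    · exact ⟨inv, 0, Or.inr rfl, by simp, (hf 0).2⟩
    · refine ⟨id, w, Or.inl rfl, by simp, ?_⟩
      simpa only [id] using (hf w).1
  obtain ⟨g, hg, h | h⟩ := hu
  · exact ⟨σ, id, w, g, hσ, Or.inl rfl, hx, hg, h⟩
  · exact ⟨σ, inv, w, g, hσ, Or.inr rfl, hx, hg, h⟩

lemma isometry_chart {σ : RSphere → RSphere} (h : σ = id ∨ σ = inv) : Isometry σ := by
  rcases h with rfl | rfl
  exacts [isometry_id, RSphere.isometry_inv]

lemma map_chart_nhds {σ : RSphere → RSphere} (h : σ = id ∨ σ = inv) (w : ℂ) :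
    Filter.map (fun ζ => σ (ofC ζ)) (𝓝 w) = 𝓝 (σ (ofC w)) := by
  rcases h with rfl | rfl
  · exact map_ofC_nhds w
  · rw [← map_inv_nhds, ← map_ofC_nhds, Filter.map_map]; rfl

lemma map_chart_nhdsNE {σ : RSphere → RSphere} (h : σ = id ∨ σ = inv) (w : ℂ) :
    Filter.map (fun ζ => σ (ofC ζ)) (𝓝[≠] w) = 𝓝[≠] (σ (ofC w)) := by
  rcases h with rfl | rfl
  · exact map_ofC_nhdsNE w
  · rw [← map_inv_nhdsNE, ← map_ofC_nhdsNE, Filter.map_map]; rfl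

lemma hasScaling_of_chart {f σ τ : RSphere → RSphere} (hσ : σ = id ∨ σ = inv)
    (hτ : τ = id ∨ τ = inv) {w : ℂ} {g : ℂ → ℂ} (hg : AnalyticAt ℂ g w)
    (h : ∀ᶠ ζ in 𝓝 w, f (σ (ofC ζ)) = τ (ofC (g ζ))) :
    HasScaling f (σ (ofC w)) (‖deriv g w‖ * (1 + ‖w‖ ^ 2) / (1 + ‖g w‖ ^ 2)) := by
  intro ε hε
  rw [nhds_prod_eq, ← map_chart_nhds hσ, Filter.prod_map_map_eq, ← nhds_prod_eq,
    Filter.eventually_map]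
  have h1 : ∀ᶠ p : ℂ × ℂ in 𝓝 (w, w), f (σ (ofC p.1)) = τ (ofC (g p.1)) :=
    (continuous_fst.tendsto (w, w)).eventually h
  have h2 : ∀ᶠ p : ℂ × ℂ in 𝓝 (w, w), f (σ (ofC p.2)) = τ (ofC (g p.2)) :=
    (continuous_snd.tendsto (w, w)).eventually h
  filter_upwards [hasScaling_aux hg.hasStrictDerivAt ε hε, h1, h2] with p hp h1 h2
  rw [h1, h2, (isometry_chart hσ).dist_eq, (isometry_chart hτ).dist_eq]
  exact hp

lemma SHol.hasScaling {f : RSphere → RSphere} (hf : SHol f) (x : RSphere) :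
    HasScaling f x (sphDeriv f x) := by
  obtain ⟨σ, τ, w, g, hσ, hτ, rfl, hg, h⟩ := hf.exists_chart x
  have := hasScaling_of_chart hσ hτ hg h
  rwa [this.sphDeriv_eq]

lemma sHolAt_of_ratio {u : ℂ → RSphere} (hu : Continuous u) {P Q : Polynomial ℂ} (hQ : Q ≠ 0)
    {w : ℂ} (hw : P.eval w ≠ 0 ∨ Q.eval w ≠ 0)
    (h : ∀ᶠ ζ in 𝓝[≠] w, Q.eval ζ ≠ 0 → u ζ = ofC (P.eval ζ / Q.eval ζ)) : SHolAt u w := by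
  have hP : AnalyticAt ℂ (fun ζ => P.eval ζ) w :=
    AnalyticOnNhd.eval_polynomial P w (mem_univ w)
  have hQa : AnalyticAt ℂ (fun ζ => Q.eval ζ) w :=
    AnalyticOnNhd.eval_polynomial Q w (mem_univ w)
  have hQne : ∀ᶠ ζ in 𝓝[≠] w, Q.eval ζ ≠ 0 := by
    have : (Q.rootSet ℂ)ᶜ ∈ 𝓝[≠] w := by
      refine mem_nhdsWithin.2 ?_
      refine ⟨((Q.rootSet ℂ) \ {w})ᶜ, ?_, by simp, ?_⟩
      · exact ((Q.rootSet_finite ℂ).subset sdiff_subset).isClosed.isOpen_compl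
      · rintro x ⟨hx, hxw⟩ hx'
        exact hx ⟨hx', hxw⟩
    filter_upwards [this] with ζ hζ h0
    exact hζ (by simpa [Polynomial.mem_rootSet, hQ] using h0)
  by_cases hq : Q.eval w = 0
  · have hp : P.eval w ≠ 0 := hw.resolve_right (by simpa using hq)
    refine ⟨fun ζ => Q.eval ζ / P.eval ζ, hQa.div hP hp, Or.inr ?_⟩
    have hc : ContinuousAt (fun ζ => inv (ofC (Q.eval ζ / P.eval ζ))) w :=
      RSphere.continuous_inv.continuousAt.comp
        (continuous_ofC.continuousAt.comp (hQa.div hP hp).continuousAt)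
    refine (ContinuousAt.eventuallyEq_nhds_iff_eventuallyEq_nhdsNE hu.continuousAt hc).1 ?_
    filter_upwards [h, hQne, (hP.continuousAt.eventually_ne hp).filter_mono nhdsWithin_le_nhds]
      with ζ h1 h2 h3
    rw [h1 h2, inv_ofC (div_ne_zero h2 h3), inv_div]
  · refine ⟨fun ζ => P.eval ζ / Q.eval ζ, hP.div hQa hq, Or.inl ?_⟩
    refine (ContinuousAt.eventuallyEq_nhds_iff_eventuallyEq_nhdsNE hu.continuousAt
      (continuous_ofC.continuousAt.comp (hP.div hQa hq).continuousAt)).1 ?_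
    filter_upwards [h, hQne] with ζ h1 h2
    exact h1 h2

namespace IsRationalMap

variable {f : RSphere → RSphere} {p q : Polynomial ℂ}

lemma den_ne_zero (hf : IsRationalMap f p q) (hdeg : 2 ≤ ratDeg p q) : q ≠ 0 := by
  rintro rfl
  have h := isCoprime_zero_right.1 hf.coprime
  have := Polynomial.natDegree_eq_zero_of_isUnit h
  simp [ratDeg, this] at hdeg

lemma eval_ne_zero_or (hf : IsRationalMap f p q) (w : ℂ) : p.eval w ≠ 0 ∨ q.eval w ≠ 0 := by
  by_contra! h
  obtain ⟨a, b, hab⟩ := hf.coprime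
  have := congrArg (Polynomial.eval w) hab
  simp [h.1, h.2] at this

lemma sHol (hf : IsRationalMap f p q) (hdeg : 2 ≤ ratDeg p q) : SHol f := by
  intro w
  have hq := hf.den_ne_zero hdeg
  refine ⟨sHolAt_of_ratio (hf.continuous.comp continuous_ofC) hq (hf.eval_ne_zero_or w)
    (Eventually.of_forall fun ζ => hf.eval ζ), ?_⟩
  set D := ratDeg p q
  have hev : ∀ (r : Polynomial ℂ), r.natDegree ≤ D → ∀ ζ : ℂ, ζ ≠ 0 →
      (r.reflect D).eval ζ = r.eval ζ⁻¹ * ζ ^ D := by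
    intro r hr ζ hζ
    have : Invertible ζ⁻¹ := invertibleOfNonzero (inv_ne_zero hζ)
    have := Polynomial.eval₂_reflect_mul_pow (RingHom.id ℂ) ζ⁻¹ D r hr
    simp only [Polynomial.eval₂_id, invOf_eq_inv, _root_.inv_inv] at this
    rw [← this, mul_assoc, ← mul_pow, inv_mul_cancel₀ hζ, one_pow, mul_one]
  refine sHolAt_of_ratio (P := p.reflect D) (Q := q.reflect D)
    (hf.continuous.comp (RSphere.continuous_inv.comp continuous_ofC)) (by simpa using hq) ?_ ?_
  · by_cases hw : w = 0
    · subst hw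
      rw [← Polynomial.coeff_zero_eq_eval_zero, ← Polynomial.coeff_zero_eq_eval_zero,
        Polynomial.coeff_reflect, Polynomial.coeff_reflect]
      have hq' := Polynomial.leadingCoeff_ne_zero.2 hq
      simp only [Polynomial.revAt_zero]
      rcases le_total p.natDegree q.natDegree with h | h
      · right
        simpa [D, ratDeg, h] using hq
      · left
        have hp : p ≠ 0 := by
          rintro rfl
          have : q.natDegree = 0 := by simpa using h
          simp [D, ratDeg, this] at hdeg
        simpa [D, ratDeg, h] using hp
    · rw [hev p (le_max_left _ _) w hw, hev q (le_max_right _ _) w hw]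
      have hD : w ^ D ≠ 0 := pow_ne_zero _ hw
      exact (hf.eval_ne_zero_or w⁻¹).imp (fun h => mul_ne_zero h hD) fun h => mul_ne_zero h hD
  · have : ∀ᶠ ζ in 𝓝[≠] w, ζ ≠ 0 := by
      by_cases hw : w = 0
      · subst hw; exact self_mem_nhdsWithin
      · exact (continuousAt_id.eventually_ne hw).filter_mono nhdsWithin_le_nhds
    filter_upwards [this] with ζ hζ hQ
    have hD : ζ ^ D ≠ 0 := pow_ne_zero _ hζ
    rw [hev q (le_max_right _ _) ζ hζ] at hQ
    rw [hev q (le_max_right _ _) ζ hζ, hev p (le_max_left _ _) ζ hζ, Function.comp_apply,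
      Function.comp_apply, inv_ofC hζ, mul_div_mul_right _ _ hD]
    exact hf.eval _ (left_ne_zero_of_mul hQ)

end IsRationalMap

/-- A holomorphic self-map of the sphere with finite fibres. -/
structure FinHol (f : RSphere → RSphere) : Prop where
  hol : SHol f
  finite_fiber : ∀ y, (f ⁻¹' {y}).Finite

lemma IsRationalMap.finHol {f : RSphere → RSphere} {p q : Polynomial ℂ} (hf : IsRationalMap f p q)
    (hdeg : 2 ≤ ratDeg p q) : FinHol f := by
  refine ⟨hf.sHol hdeg, fun y => ?_⟩
  have hq := hf.den_ne_zero hdeg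
  set r := p - Polynomial.C (toC y) * q with hr
  have hr0 : r ≠ 0 := by
    intro h
    have hp : p = Polynomial.C (toC y) * q := sub_eq_zero.1 (hr ▸ h)
    obtain ⟨a, b, hab⟩ := hf.coprime
    have hu : IsUnit q := by
      refine IsUnit.of_mul_eq_one (a * Polynomial.C (toC y) + b) ?_
      rw [← hab, hp]; ring
    have h1 := Polynomial.natDegree_eq_zero_of_isUnit hu
    have h2 : p.natDegree ≤ 0 := by
      rw [hp, ← h1]
      exact Polynomial.natDegree_C_mul_le _ _
    simp only [ratDeg, h1] at hdeg
    omega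
  refine Set.Finite.subset (((finite_singleton infty).union
    ((q.rootSet_finite ℂ).image ofC)).union ((r.rootSet_finite ℂ).image ofC)) ?_
  intro x hx
  rcases cases_ofC x with rfl | ⟨z, rfl⟩
  · simp
  · by_cases hz : q.eval z = 0
    · refine Or.inl (Or.inr ⟨z, ?_, rfl⟩)
      simpa [Polynomial.mem_rootSet, hq] using hz
    · refine Or.inr ⟨z, ?_, rfl⟩
      have h1 : ofC (p.eval z / q.eval z) = y := by rw [← hf.eval z hz]; exact hx
      have h2 : toC y = p.eval z / q.eval z := by rw [← h1, toC_ofC]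
      rw [Polynomial.mem_rootSet]
      refine ⟨hr0, ?_⟩
      simp only [hr, map_sub, Polynomial.coe_aeval_eq_eval, map_mul, Polynomial.eval_C, h2]
      field_simp
      ring

lemma SHol.continuous {f : RSphere → RSphere} (hf : SHol f) : Continuous f :=
  continuous_iff_continuousAt.2 fun x => (hf.hasScaling x).continuousAt

lemma SHol.sphDeriv_nonneg {f : RSphere → RSphere} (hf : SHol f) (x : RSphere) :
    0 ≤ sphDeriv f x := (hf.hasScaling x).nonneg

lemma SHol.continuous_sphDeriv {f : RSphere → RSphere} (hf : SHol f) :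
    Continuous (sphDeriv f) := by
  refine continuous_iff_continuousAt.2 fun x => ?_
  rw [ContinuousAt, Metric.tendsto_nhds]
  intro ε hε
  have h := hf.hasScaling x (ε / 2) (by positivity)
  rw [nhds_prod_eq] at h
  obtain ⟨U, hU, hUh⟩ := eventually_prod_self_iff'.1 h
  filter_upwards [eventually_mem_nhds_iff.2 hU] with y hy
  have h1 : |sphDeriv f y - sphDeriv f x| ≤ ε / 2 := by
    have ht := ((hf.hasScaling y).tendsto.sub_const (sphDeriv f x)).abs
    refine le_of_tendsto ht ?_
    filter_upwards [mem_nhdsWithin_of_mem_nhds hy, self_mem_nhdsWithin] with u hu huy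
    have hd : 0 < dist u y := dist_pos.2 huy
    have : |dist (f u) (f y) - sphDeriv f x * dist u y| ≤ ε / 2 * dist u y :=
      hUh u hu y (mem_of_mem_nhds hy)
    rw [div_sub' hd.ne', abs_div, abs_of_pos hd, div_le_iff₀ hd, mul_comm (dist u y)]
    exact this
  rw [Real.dist_eq]
  linarith

lemma SHol.sphDeriv_comp {f g : RSphere → RSphere} (hg : SHol g) (hf : SHol f) (x : RSphere) :
    sphDeriv (g ∘ f) x = sphDeriv g (f x) * sphDeriv f x :=
  ((hg.hasScaling _).comp (hf.hasScaling x)).sphDeriv_eq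

lemma SHol.sphDeriv_iterate_add {f : RSphere → RSphere} (hf : SHol f) (m n : ℕ) (x : RSphere) :
    sphDeriv f^[m + n] x = sphDeriv f^[m] (f^[n] x) * sphDeriv f^[n] x := by
  rw [Function.iterate_add]
  exact (hf.iterate m).sphDeriv_comp (hf.iterate n) x

lemma sphDeriv_id (x : RSphere) : sphDeriv id x = 1 := by
  have : HasScaling id x 1 := fun ε hε => Eventually.of_forall fun p => by simp; positivity
  exact this.sphDeriv_eq

lemma SHol.sphDeriv_iterate {f : RSphere → RSphere} (hf : SHol f) (n : ℕ) (x : RSphere) :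
    sphDeriv f^[n] x = ∏ k ∈ Finset.range n, sphDeriv f (f^[k] x) := by
  induction n with
  | zero => simp [sphDeriv_id]
  | succ n ih =>
    rw [Finset.prod_range_succ, ← ih, add_comm n 1, hf.sphDeriv_iterate_add 1 n, mul_comm]
    simp

lemma exists_dist_le : ∃ C : ℝ, ∀ u v : RSphere, dist u v ≤ C :=
  ⟨Metric.diam (univ : Set RSphere), fun u v =>
    Metric.dist_le_diam_of_mem isCompact_univ.isBounded (mem_univ u) (mem_univ v)⟩

/-- A holomorphic self-map of the sphere is Lipschitz. -/
lemma SHol.exists_lipschitz {f : RSphere → RSphere} (hf : SHol f) :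
    ∃ K : ℝ, 1 ≤ K ∧ ∀ x y, dist (f x) (f y) ≤ K * dist x y := by
  have hcomp : IsCompact (univ : Set (RSphere × RSphere)) := isCompact_univ
  let P : Set (RSphere × RSphere) → Prop := fun s => ∃ K : ℝ, 1 ≤ K ∧ ∀ p ∈ s,
    dist (f p.1) (f p.2) ≤ K * dist p.1 p.2
  have key : P univ := by
    refine hcomp.induction_on (p := P) ⟨1, le_rfl, fun p hp => absurd hp (notMem_empty p)⟩ ?_ ?_ ?_
    · rintro s t hst ⟨K, hK, h⟩
      exact ⟨K, hK, fun p hp => h p (hst hp)⟩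
    · rintro s t ⟨K, hK, h⟩ ⟨K', hK', h'⟩
      refine ⟨max K K', le_max_of_le_left hK, ?_⟩
      rintro p (hp | hp)
      · exact (h p hp).trans (by gcongr; exact le_max_left _ _)
      · exact (h' p hp).trans (by gcongr; exact le_max_right _ _)
    · rintro ⟨x, y⟩ -
      rw [nhdsWithin_univ]
      by_cases hxy : x = y
      · subst hxy
        have h1 := (hf.hasScaling x).eventually_le (lt_add_one _)
        refine ⟨_, h1, max 1 (sphDeriv f x + 1), le_max_left _ _, fun p hp => ?_⟩
        have hp' : dist (f p.1) (f p.2) ≤ (sphDeriv f x + 1) * dist p.1 p.2 := hp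
        exact hp'.trans (by gcongr; exact le_max_right _ _)
      · have hd : 0 < dist x y := dist_pos.2 hxy
        have hc : ContinuousAt (fun p : RSphere × RSphere => dist p.1 p.2) (x, y) :=
          (continuous_fst.dist continuous_snd).continuousAt
        have h1 := hc.eventually (lt_mem_nhds (show dist x y / 2 < dist x y by linarith))
        obtain ⟨C, hC⟩ := exists_dist_le
        refine ⟨_, h1, max 1 (C / (dist x y / 2)), le_max_left _ _, fun p hp => ?_⟩
        have hp' : dist x y / 2 < dist p.1 p.2 := hp
        have hC0 : 0 ≤ C := dist_nonneg.trans (hC x y)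
        calc dist (f p.1) (f p.2) ≤ C := hC _ _
          _ = C / (dist x y / 2) * (dist x y / 2) := by field_simp
          _ ≤ C / (dist x y / 2) * dist p.1 p.2 := by gcongr
          _ ≤ _ := by gcongr; exact le_max_right _ _
  obtain ⟨K, hK, h⟩ := key
  exact ⟨K, hK, fun x y => h (x, y) (mem_univ _)⟩

lemma sphDeriv_le_of_lipschitz {f : RSphere → RSphere} (hf : SHol f) {K : ℝ}
    (hK : ∀ x y, dist (f x) (f y) ≤ K * dist x y) (x : RSphere) : sphDeriv f x ≤ K := by
  refine le_of_tendsto (hf.hasScaling x).tendsto ?_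
  filter_upwards [self_mem_nhdsWithin] with y hy
  exact (div_le_iff₀ (dist_pos.2 hy)).2 (hK y x)

namespace FinHol

variable {f : RSphere → RSphere}

lemma not_eventually_const (hf : FinHol f) (x y : RSphere) : ¬ ∀ᶠ u in 𝓝 x, f u = y := by
  intro h
  exact (infinite_of_mem_nhds x h) (hf.finite_fiber y)

lemma nhds_le_map (hf : FinHol f) (x : RSphere) : 𝓝 (f x) ≤ map f (𝓝 x) := by
  obtain ⟨σ, τ, w, g, hσ, hτ, rfl, hg, h⟩ := hf.hol.exists_chart x
  have hfw : f (σ (ofC w)) = τ (ofC (g w)) := h.self_of_nhds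
  rcases hg.eventually_constant_or_nhds_le_map_nhds with h1 | h1
  · exfalso
    refine hf.not_eventually_const (σ (ofC w)) (τ (ofC (g w))) ?_
    rw [← map_chart_nhds hσ, eventually_map]
    filter_upwards [h, h1] with ζ h2 h3
    rw [h2, h3]
  · rw [hfw, ← map_chart_nhds hσ, ← map_chart_nhds hτ, map_map]
    refine (map_mono h1).trans ?_
    rw [map_map]
    refine (map_congr ?_).le
    filter_upwards [h] with ζ h2
    simp [h2]

lemma isOpenMap (hf : FinHol f) : IsOpenMap f := isOpenMap_iff_nhds_le.2 hf.nhds_le_map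

lemma iterate (hf : FinHol f) (n : ℕ) : FinHol f^[n] := by
  refine ⟨hf.hol.iterate n, ?_⟩
  induction n with
  | zero => intro y; simp
  | succ n ih =>
    intro y
    rw [Function.iterate_succ, preimage_comp]
    exact (ih y).preimage' fun b _ => hf.finite_fiber b

lemma finite_critSet (hf : FinHol f) : (critSet f).Finite := by
  have hloc : ∀ x, ∀ᶠ u in 𝓝[≠] x, u ∉ critSet f := by
    intro x
    obtain ⟨σ, τ, w, g, hσ, hτ, rfl, hg, h⟩ := hf.hol.exists_chart x
    rw [← map_chart_nhdsNE hσ, eventually_map]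
    have hev : ∀ᶠ ζ in 𝓝 w, sphDeriv f (σ (ofC ζ)) =
        ‖deriv g ζ‖ * (1 + ‖ζ‖ ^ 2) / (1 + ‖g ζ‖ ^ 2) := by
      filter_upwards [hg.eventually_analyticAt, h.eventually_nhds] with ζ h1 h2
      exact (hasScaling_of_chart hσ hτ h1 h2).sphDeriv_eq
    rcases hg.deriv.eventually_eq_zero_or_eventually_ne_zero with h1 | h1
    · exfalso
      have hd : ∀ᶠ ζ in 𝓝 w, DifferentiableAt ℂ g ζ :=
        hg.eventually_analyticAt.mono fun _ h => h.differentiableAt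
      obtain ⟨r, hr, hball⟩ := Metric.eventually_nhds_iff_ball.1 (h1.and hd)
      refine hf.not_eventually_const (σ (ofC w)) (τ (ofC (g w))) ?_
      rw [← map_chart_nhds hσ, eventually_map]
      filter_upwards [h, ball_mem_nhds w hr] with ζ h2 h3
      have : g ζ = g w := by
        refine (convex_ball w r).is_const_of_fderivWithin_eq_zero (𝕜 := ℂ)
          (fun z hz => (hball z hz).2.differentiableWithinAt) ?_ h3 (mem_ball_self hr)
        intro z hz
        rw [fderivWithin_of_isOpen isOpen_ball hz]
        ext
        simpa using (hball z hz).1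
      rw [h2, this]
    · filter_upwards [h1, hev.filter_mono nhdsWithin_le_nhds] with ζ h2 h3
      simp only [critSet, mem_ofPred_eq, h3]
      have : 0 < ‖deriv g ζ‖ := norm_pos_iff.2 h2
      positivity
  by_contra hinf
  obtain ⟨x, hx⟩ := Set.Infinite.exists_accPt_principal hinf
  exact (accPt_iff_frequently_nhdsNE.1 hx) ((hloc x).mono fun u hu => hu)

end FinHol

lemma exists_log_on_ball {h : ℂ → ℂ} {c : ℂ} {r : ℝ} (hr : 0 < r)
    (hh : DifferentiableOn ℂ h (ball c r)) (h0 : ∀ z ∈ ball c r, h z ≠ 0) :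
    ∃ g : ℂ → ℂ, DifferentiableOn ℂ g (ball c r) ∧ (∀ z ∈ ball c r, Complex.exp (g z) = h z) ∧
      g c = Complex.log (h c) := by
  have hd : DifferentiableOn ℂ (fun z => deriv h z / h z) (ball c r) :=
    (hh.deriv isOpen_ball).div hh h0
  obtain ⟨g, hgc, hg⟩ := hd.isExactOn_ball.with_val_at c (Complex.log (h c))
  have hgd : DifferentiableOn ℂ g (ball c r) := fun z hz =>
    (hg z hz).differentiableAt.differentiableWithinAt
  refine ⟨g, hgd, fun z hz => ?_, hgc⟩
  have hc : c ∈ ball c r := mem_ball_self hr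
  have hder : ∀ z ∈ ball c r, HasDerivAt (fun z => Complex.exp (-g z) * h z) 0 z := by
    intro z hz
    have h1 := (hh.differentiableAt (isOpen_ball.mem_nhds hz)).hasDerivAt
    have h2 := ((hg z hz).neg.cexp).mul h1
    have h3 : Complex.exp (-g z) * -(deriv h z / h z) * h z + Complex.exp (-g z) * deriv h z = 0 := by
      have := h0 z hz
      field_simp
      ring
    exact h2.congr_deriv h3
  have hconst : Complex.exp (-g z) * h z = Complex.exp (-g c) * h c := by
    refine (convex_ball c r).is_const_of_fderivWithin_eq_zero (𝕜 := ℂ)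
      (f := fun z => Complex.exp (-g z) * h z)
      (fun z hz => (hder z hz).differentiableAt.differentiableWithinAt) ?_ hz hc
    intro z hz
    rw [fderivWithin_of_isOpen isOpen_ball hz]
    ext
    simpa using (hder z hz).deriv
  rw [hgc, Complex.exp_neg (Complex.log _), Complex.exp_log (h0 c hc), inv_mul_cancel₀ (h0 c hc),
    Complex.exp_neg] at hconst
  field_simp at hconst
  exact hconst.symm

/-- Bloch's theorem: the image of a holomorphic function on a disc contains a disc of radius
comparable to the derivative at the centre. -/
lemma exists_ball_subset_image {F : ℂ → ℂ} {c : ℂ} {r : ℝ} (hr : 0 < r)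
    (hF : DifferentiableOn ℂ F (ball c r)) (h0 : deriv F c ≠ 0) :
    ∃ a, ball a (r * ‖deriv F c‖ / 96) ⊆ F '' ball c r := by
  have hF' := hF.deriv isOpen_ball
  have hsub : closedBall c (r / 2) ⊆ ball c r := closedBall_subset_ball (by linarith)
  have hcont : ContinuousOn (fun z => (r / 2 - dist z c) * ‖deriv F z‖) (closedBall c (r / 2)) :=
    (Continuous.continuousOn (by fun_prop)).mul (hF'.continuousOn.mono hsub).norm
  obtain ⟨a, ha, hmax⟩ := (isCompact_closedBall c (r / 2)).exists_isMaxOn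
    ⟨c, mem_closedBall_self (by linarith)⟩ hcont
  have hmax' : ∀ z, dist z c ≤ r / 2 →
      (r / 2 - dist z c) * ‖deriv F z‖ ≤ (r / 2 - dist a c) * ‖deriv F a‖ := fun z hz => hmax hz
  have hM : 0 < ‖deriv F c‖ := norm_pos_iff.2 h0
  have h1 := hmax' c (by simp; linarith)
  rw [dist_self, sub_zero] at h1
  have h2 : 0 < (r / 2 - dist a c) * ‖deriv F a‖ := lt_of_lt_of_le (by positivity) h1
  have ha' : 0 ≤ r / 2 - dist a c := sub_nonneg.2 ha
  set t := (r / 2 - dist a c) / 2 with ht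
  set m := ‖deriv F a‖ with hm
  have hm0 : 0 < m := by
    by_contra! h
    nlinarith
  have ht0 : 0 < t := by
    have : 0 < r / 2 - dist a c := by
      by_contra! h
      nlinarith
    positivity
  have hballt : ball a t ⊆ ball c r := by
    intro z hz
    have := dist_triangle z a c
    rw [mem_ball] at hz ⊢
    linarith
  have hbd : ∀ z ∈ ball a t, ‖deriv F z‖ ≤ 2 * m := by
    intro z hz
    rw [mem_ball] at hz
    have h3 := dist_triangle z a c
    have h4 : t ≤ r / 2 - dist z c := by linarith
    have h5 := hmax' z (by linarith)
    have h6 : t * ‖deriv F z‖ ≤ 2 * t * m := by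
      calc t * ‖deriv F z‖ ≤ (r / 2 - dist z c) * ‖deriv F z‖ := by gcongr
        _ ≤ _ := h5
        _ = 2 * t * m := by rw [ht]; ring
    nlinarith
  have hmaps : MapsTo (deriv F) (ball a t) (closedBall (deriv F a) (3 * m)) := by
    intro z hz
    rw [mem_closedBall_iff_norm]
    calc ‖deriv F z - deriv F a‖ ≤ ‖deriv F z‖ + ‖deriv F a‖ := norm_sub_le _ _
      _ ≤ 3 * m := by linarith [hbd z hz]
  have hsch : ∀ z ∈ closedBall a (t / 6), ‖deriv F z - deriv F a‖ ≤ m / 2 := by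
    intro z hz
    have hzt : z ∈ ball a t := closedBall_subset_ball (by linarith) hz
    have := Complex.dist_le_div_mul_dist_of_mapsTo_ball (hF'.mono hballt) hmaps hzt
    rw [dist_eq_norm] at this
    calc _ ≤ 3 * m / t * dist z a := this
      _ ≤ 3 * m / t * (t / 6) := by gcongr; exact hz
      _ = m / 2 := by field_simp; norm_num
  have hsub2 : closedBall a (t / 6) ⊆ ball c r :=
    (closedBall_subset_ball (by linarith)).trans hballt
  have hdF : ∀ z ∈ closedBall a (t / 6), HasDerivAt F (deriv F z) z := fun z hz =>
    (hF.differentiableAt (isOpen_ball.mem_nhds (hsub2 hz))).hasDerivAt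
  have haa : a ∈ closedBall a (t / 6) := mem_closedBall_self (by linarith)
  have hdG : ∀ z ∈ closedBall a (t / 6),
      HasDerivAt (fun z => F z - deriv F a * z) (deriv F z - deriv F a) z := fun z hz => by
    have := (hdF z hz).sub ((hasDerivAt_id z).const_mul (deriv F a))
    rw [mul_one] at this
    exact this
  have hlow : ∀ z ∈ sphere a (t / 6), m * t / 12 ≤ ‖F z - F a‖ := by
    intro z hz
    have hz' : z ∈ closedBall a (t / 6) := sphere_subset_closedBall hz
    have h3 := (convex_closedBall a (t / 6)).norm_image_sub_le_of_norm_hasDerivWithin_le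
      (f := fun z => F z - deriv F a * z) (f' := fun z => deriv F z - deriv F a) (C := m / 2)
      (fun z hz => (hdG z hz).hasDerivWithinAt) hsch haa hz'
    have h4 : ‖z - a‖ = t / 6 := by rw [← dist_eq_norm]; exact hz
    have h5 : ‖deriv F a * (z - a)‖ = m * (t / 6) := by rw [norm_mul, h4]
    have h6 : ‖deriv F a * (z - a)‖ ≤ ‖F z - F a‖ +
        ‖F z - deriv F a * z - (F a - deriv F a * a)‖ := by
      refine le_trans (le_of_eq ?_) (norm_sub_le _ _)
      congr 1
      ring
    simp only [h4] at h3
    linarith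
  have hfreq : ∃ᶠ z in 𝓝 a, F z ≠ F a :=
    ((hdF a haa).eventually_ne (norm_pos_iff.1 hm0)).frequently.filter_mono nhdsWithin_le_nhds
  have hdc : DiffContOnCl ℂ F (ball a (t / 6)) := by
    refine ⟨hF.mono (ball_subset_closedBall.trans hsub2), ?_⟩
    exact hF.continuousOn.mono (closure_ball_subset_closedBall.trans hsub2)
  have hres := hdc.ball_subset_image_closedBall (by linarith) hlow hfreq
  refine ⟨F a, fun z hz => ?_⟩
  refine image_mono hsub2 (hres (ball_subset_ball ?_ hz))
  have : 2 * t * m = (r / 2 - dist a c) * m := by rw [ht]; ring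
  nlinarith

lemma exists_log_sqrt_near (y : ℝ) : ∃ n : ℕ, 1 ≤ n ∧ ∃ x : ℝ, 0 < x ∧
    (x = √n + √(n - 1 : ℝ) ∨ x = √n - √(n - 1 : ℝ)) ∧ |Real.log x - y| ≤ 2 := by
  have main : ∀ y : ℝ, 0 ≤ y → ∃ n : ℕ, 1 ≤ n ∧ |Real.log (√n + √(n - 1 : ℝ)) - y| ≤ 2 := by
    intro y hy
    have h1 : (1 : ℝ) ≤ Real.exp (2 * y) := Real.one_le_exp (by linarith)
    set n := ⌈Real.exp (2 * y)⌉₊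
    have hn1 : Real.exp (2 * y) ≤ n := Nat.le_ceil _
    have hn2 : (n : ℝ) < Real.exp (2 * y) + 1 := Nat.ceil_lt_add_one (by linarith)
    have hn : (1 : ℝ) ≤ n := h1.trans hn1
    have he : Real.exp (2 * y) = Real.exp y ^ 2 := by rw [← Real.exp_nat_mul]; norm_num
    have hs1 : Real.exp y ≤ √n := Real.le_sqrt_of_sq_le (he ▸ hn1)
    have hs2 : √n ≤ 2 * Real.exp y := by
      apply Real.sqrt_le_iff.2
      refine ⟨by positivity, ?_⟩
      nlinarith
    have hs3 : √(n - 1 : ℝ) ≤ √n := Real.sqrt_le_sqrt (by linarith)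
    have hs4 : 0 ≤ √(n - 1 : ℝ) := Real.sqrt_nonneg _
    refine ⟨n, by exact_mod_cast hn, ?_⟩
    have hpos := Real.exp_pos y
    have hx : 0 < √n + √(n - 1 : ℝ) := by linarith
    rw [abs_le]
    constructor
    · have : y ≤ Real.log (√n + √(n - 1 : ℝ)) := (Real.le_log_iff_exp_le hx).2 (by linarith)
      linarith
    · have : Real.log (√n + √(n - 1 : ℝ)) ≤ y + 2 := by
        rw [Real.log_le_iff_le_exp hx, Real.exp_add]
        have h4 : (4 : ℝ) ≤ Real.exp 2 := by
          have := Real.add_one_le_exp (1 : ℝ)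
          have h : Real.exp 2 = Real.exp 1 * Real.exp 1 := by rw [← Real.exp_add]; norm_num
          nlinarith
        nlinarith
      linarith
  have hinv : ∀ n : ℕ, 1 ≤ n → (√n - √(n - 1 : ℝ)) * (√n + √(n - 1 : ℝ)) = 1 := by
    intro n hn
    have hn' : (1 : ℝ) ≤ n := by exact_mod_cast hn
    have h1 := Real.sq_sqrt (show (0 : ℝ) ≤ n by linarith)
    have h2 := Real.sq_sqrt (show (0 : ℝ) ≤ n - 1 by linarith)
    nlinarith
  have hpos : ∀ n : ℕ, 1 ≤ n → 0 < √n + √(n - 1 : ℝ) := by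
    intro n hn
    have hn' : (0 : ℝ) < n := by exact_mod_cast hn
    have := Real.sqrt_pos.2 hn'
    positivity
  rcases le_total 0 y with hy | hy
  · obtain ⟨n, hn, h⟩ := main y hy
    exact ⟨n, hn, _, hpos n hn, Or.inl rfl, h⟩
  · obtain ⟨n, hn, h⟩ := main (-y) (by linarith)
    have h3 : √n - √(n - 1 : ℝ) = (√n + √(n - 1 : ℝ))⁻¹ :=
      eq_inv_of_mul_eq_one_left (hinv n hn)
    refine ⟨n, hn, _, ?_, Or.inr rfl, ?_⟩
    · rw [h3]; exact inv_pos.2 (hpos n hn)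
    · rw [h3, Real.log_inv, ← abs_neg]
      convert h using 2
      ring

/-- A holomorphic function on a disc omitting `0` and `1`: the derivative at the centre is
controlled by any choice of logarithm. -/
lemma norm_deriv_le_of_omit {h : ℂ → ℂ} {c : ℂ} {r : ℝ} (hr : 0 < r)
    (hh : DifferentiableOn ℂ h (ball c r)) (h0 : ∀ z ∈ ball c r, h z ≠ 0)
    (h1 : ∀ z ∈ ball c r, h z ≠ 1) :
    ‖deriv h c‖ ≤ 40000 / r * (‖h c‖ * (1 + ‖Complex.log (h c)‖)) := by
  have hc : c ∈ ball c r := mem_ball_self hr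
  obtain ⟨g, hgd, hg, hgc⟩ := exists_log_on_ball hr hh h0
  set κ : ℂ := 2 * Real.pi * Complex.I with hκ
  have hκ0 : κ ≠ 0 := Complex.two_pi_I_ne_zero
  have hA : ∀ z ∈ ball c r, ∀ n : ℤ, g z ≠ n * κ := by
    intro z hz n hn
    refine h1 z hz ?_
    rw [← hg z hz, hn, hκ, Complex.exp_int_mul_two_pi_mul_I]
  have hA0 : ∀ z ∈ ball c r, g z / κ ≠ 0 := fun z hz h => hA z hz 0 (by
    rw [div_eq_iff hκ0] at h; simpa using h)
  have hA1 : ∀ z ∈ ball c r, g z / κ - 1 ≠ 0 := fun z hz h => hA z hz 1 (by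
    rw [sub_eq_zero, div_eq_iff hκ0] at h; simpa using h)
  have hAd : DifferentiableOn ℂ (fun z => g z / κ) (ball c r) := hgd.div_const κ
  obtain ⟨b, hbd, hb, -⟩ := exists_log_on_ball hr hAd hA0
  obtain ⟨e, hed, he, -⟩ := exists_log_on_ball hr (hAd.sub_const 1) hA1
  set B : ℂ → ℂ := fun z => Complex.exp (b z / 2) with hB
  set C : ℂ → ℂ := fun z => Complex.exp (e z / 2) with hC
  have hB2 : ∀ z ∈ ball c r, B z ^ 2 = g z / κ := by
    intro z hz
    rw [← hb z hz, hB, ← Complex.exp_nat_mul]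
    congr 1; push_cast; ring
  have hC2 : ∀ z ∈ ball c r, C z ^ 2 = g z / κ - 1 := by
    intro z hz
    rw [← he z hz, hC, ← Complex.exp_nat_mul]
    congr 1; push_cast; ring
  have hBd : DifferentiableOn ℂ B (ball c r) := (hbd.div_const 2).cexp
  have hCd : DifferentiableOn ℂ C (ball c r) := (hed.div_const 2).cexp
  have hBC : ∀ z ∈ ball c r, (B z - C z) * (B z + C z) = 1 := by
    intro z hz
    linear_combination hB2 z hz - hC2 z hz
  have hD0 : ∀ z ∈ ball c r, B z - C z ≠ 0 := fun z hz h => by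
    have := hBC z hz
    rw [h, zero_mul] at this
    exact zero_ne_one this
  obtain ⟨F, hFd, hF, -⟩ := exists_log_on_ball (h := fun z => B z - C z) hr (hBd.sub hCd) hD0
  -- `F` omits a net
  have homit : ∀ z ∈ ball c r, ∀ n : ℕ, 1 ≤ n → ∀ x : ℝ, 0 < x →
      (x = √n + √(n - 1 : ℝ) ∨ x = √n - √(n - 1 : ℝ)) → ∀ k : ℤ, F z ≠ Real.log x + k * κ := by
    intro z hz n hn x hx hxn k hFz
    have h2 : B z - C z = x := by
      rw [← hF z hz, hFz, Complex.exp_add, hκ, Complex.exp_int_mul_two_pi_mul_I, mul_one,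
        ← Complex.ofReal_exp, Real.exp_log hx]
    have h3 := hBC z hz
    have hn' : (1 : ℝ) ≤ n := by exact_mod_cast hn
    have hx0 : (x : ℂ) ≠ 0 := by exact_mod_cast hx.ne'
    have h4 : ∃ x' : ℝ, x * x' = 1 ∧ x + x' = 2 * √n := by
      have h5 := Real.sq_sqrt (show (0 : ℝ) ≤ n by linarith)
      have h6 := Real.sq_sqrt (show (0 : ℝ) ≤ n - 1 by linarith)
      rcases hxn with h | h
      · exact ⟨√n - √(n - 1 : ℝ), by rw [h]; nlinarith, by rw [h]; ring⟩
      · exact ⟨√n + √(n - 1 : ℝ), by rw [h]; nlinarith, by rw [h]; ring⟩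
    obtain ⟨x', hxx', hs⟩ := h4
    have h5 : B z + C z = x' := by
      rw [h2] at h3
      refine mul_left_cancel₀ hx0 (h3.trans ?_)
      exact_mod_cast hxx'.symm
    have h6 : B z = (√n : ℝ) := by
      have : (x : ℂ) + x' = 2 * (√n : ℝ) := by exact_mod_cast hs
      linear_combination (h2 + h5 + this) / 2
    have h7 : g z / κ = n := by
      rw [← hB2 z hz, h6]
      exact_mod_cast Real.sq_sqrt (show (0 : ℝ) ≤ n by linarith)
    rw [div_eq_iff hκ0] at h7
    exact hA z hz n (by simpa using h7)
  have hF' : ‖deriv F c‖ ≤ 960 / r := by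
    by_contra! hlt
    have hne : deriv F c ≠ 0 := by
      intro h
      rw [h, norm_zero] at hlt
      exact absurd hlt (not_lt.2 (by positivity))
    obtain ⟨a, ha⟩ := exists_ball_subset_image hr hFd hne
    have hrad : 10 < r * ‖deriv F c‖ / 96 := by
      rw [div_lt_iff₀ hr] at hlt
      linarith
    obtain ⟨n, hn, x, hx, hxn, hxa⟩ := exists_log_sqrt_near a.re
    set k : ℤ := round (a.im / (2 * Real.pi)) with hk
    have hmem : (Real.log x + k * κ : ℂ) ∈ ball a (r * ‖deriv F c‖ / 96) := by
      rw [mem_ball_iff_norm]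
      refine lt_of_le_of_lt (Complex.norm_le_abs_re_add_abs_im _) ?_
      have hre : (Real.log x + k * κ - a : ℂ).re = Real.log x - a.re := by simp [hκ]
      have him : (Real.log x + k * κ - a : ℂ).im = k * (2 * Real.pi) - a.im := by simp [hκ]
      rw [hre, him]
      have h8 := abs_sub_round (a.im / (2 * Real.pi))
      have hpi := Real.pi_pos
      have hpi4 := Real.pi_le_four
      have h9 : |(k : ℝ) * (2 * Real.pi) - a.im| = |a.im / (2 * Real.pi) - k| * (2 * Real.pi) := by
        rw [← abs_of_pos (show 0 < 2 * Real.pi by positivity), ← abs_mul, abs_of_pos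
          (show 0 < 2 * Real.pi by positivity), abs_sub_comm]
        congr 1
        field_simp
      rw [h9]
      have : |a.im / (2 * Real.pi) - k| * (2 * Real.pi) ≤ 1 / 2 * (2 * Real.pi) := by gcongr
      linarith
    obtain ⟨z, hz, hz'⟩ := ha hmem
    exact homit z hz n hn x hx hxn k hz'
  -- express the derivative of `h` through that of `F`
  have hnhds : ball c r ∈ 𝓝 c := isOpen_ball.mem_nhds hc
  have dB := (hBd.differentiableAt hnhds).hasDerivAt
  have dC := (hCd.differentiableAt hnhds).hasDerivAt
  have dF := (hFd.differentiableAt hnhds).hasDerivAt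
  have dg := (hgd.differentiableAt hnhds).hasDerivAt
  have e1 : 2 * B c * deriv B c = deriv g c / κ := by
    have l : HasDerivAt (fun z => B z ^ 2) (2 * B c * deriv B c) c :=
      (dB.pow 2).congr_deriv (by simp)
    have r' : HasDerivAt (fun z => B z ^ 2) (deriv g c / κ) c :=
      (dg.div_const κ).congr_of_eventuallyEq (by filter_upwards [hnhds] with z hz using hB2 z hz)
    exact l.unique r'
  have e2 : 2 * C c * deriv C c = deriv g c / κ := by
    have l : HasDerivAt (fun z => C z ^ 2) (2 * C c * deriv C c) c :=
      (dC.pow 2).congr_deriv (by simp)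
    have r' : HasDerivAt (fun z => C z ^ 2) (deriv g c / κ) c :=
      ((dg.div_const κ).sub_const 1).congr_of_eventuallyEq
        (by filter_upwards [hnhds] with z hz using hC2 z hz)
    exact l.unique r'
  have e3 : (B c - C c) * deriv F c = deriv B c - deriv C c := by
    have l : HasDerivAt (fun z => Complex.exp (F z)) (Complex.exp (F c) * deriv F c) c := dF.cexp
    have r' : HasDerivAt (fun z => Complex.exp (F z)) (deriv B c - deriv C c) c :=
      (dB.sub dC).congr_of_eventuallyEq (by filter_upwards [hnhds] with z hz using hF z hz)
    rw [← l.unique r', hF c hc]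
  have e4 : h c * deriv g c = deriv h c := by
    have l : HasDerivAt (fun z => Complex.exp (g z)) (Complex.exp (g c) * deriv g c) c := dg.cexp
    have r' : HasDerivAt (fun z => Complex.exp (g z)) (deriv h c) c :=
      (hh.differentiableAt hnhds).hasDerivAt.congr_of_eventuallyEq
        (by filter_upwards [hnhds] with z hz using hg z hz)
    rw [← l.unique r', hg c hc]
  have e5 : deriv g c / κ = -2 * (B c * C c) * deriv F c := by
    refine mul_left_cancel₀ (hD0 c hc) ?_
    linear_combination 2 * B c * C c * e3 + C c * e1 - B c * e2
  have e6 : deriv h c = h c * (-2 * κ * (B c * C c) * deriv F c) := by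
    rw [← e4]
    rw [div_eq_iff hκ0] at e5
    rw [e5]; ring
  have hκn : ‖κ‖ = 2 * Real.pi := by simp [hκ, abs_of_pos Real.pi_pos]
  have hgn : ‖g c / κ‖ ≤ ‖Complex.log (h c)‖ := by
    rw [norm_div, hκn, hgc]
    refine div_le_self (norm_nonneg _) ?_
    linarith [Real.pi_gt_three]
  have hBn : ‖B c‖ ^ 2 ≤ 1 + ‖Complex.log (h c)‖ := by
    rw [← norm_pow, hB2 c hc]; linarith
  have hCn : ‖C c‖ ^ 2 ≤ 1 + ‖Complex.log (h c)‖ := by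
    rw [← norm_pow, hC2 c hc]
    refine (norm_sub_le _ _).trans ?_
    rw [norm_one]; linarith
  have hBCn : ‖B c‖ * ‖C c‖ ≤ 1 + ‖Complex.log (h c)‖ := by nlinarith [sq_nonneg (‖B c‖ - ‖C c‖)]
  have hpi4 := Real.pi_le_four
  have hpi := Real.pi_pos
  rw [e6]
  simp only [norm_mul, norm_neg, Complex.norm_ofNat, hκn]
  calc ‖h c‖ * (2 * (2 * Real.pi) * (‖B c‖ * ‖C c‖) * ‖deriv F c‖)
      ≤ ‖h c‖ * (2 * (2 * 4) * (1 + ‖Complex.log (h c)‖) * (960 / r)) := by gcongr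
    _ = 15360 / r * (‖h c‖ * (1 + ‖Complex.log (h c)‖)) := by ring
    _ ≤ _ := by gcongr; norm_num

lemma mul_one_add_norm_log_le (z : ℂ) : ‖z‖ * (1 + ‖Complex.log z‖) ≤ 6 * (1 + ‖z‖ ^ 2) := by
  by_cases hz : z = 0
  · subst hz; simp
  have hz0 : 0 < ‖z‖ := norm_pos_iff.2 hz
  have h1 : ‖Complex.log z‖ ≤ |Real.log ‖z‖| + 4 := by
    refine (Complex.norm_le_abs_re_add_abs_im _).trans ?_
    rw [Complex.log_re, Complex.log_im]
    gcongr
    exact (Complex.abs_arg_le_pi z).trans Real.pi_le_four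
  have h2 : ‖z‖ * |Real.log ‖z‖| ≤ 1 + ‖z‖ ^ 2 := by
    rcases abs_cases (Real.log ‖z‖) with ⟨h, -⟩ | ⟨h, -⟩ <;> rw [h]
    · have := Real.log_le_self hz0.le
      nlinarith
    · have h3 : -Real.log ‖z‖ ≤ ‖z‖⁻¹ := by
        rw [← Real.log_inv]
        exact Real.log_le_self (by positivity)
      have h4 : ‖z‖ * -Real.log ‖z‖ ≤ ‖z‖ * ‖z‖⁻¹ := by gcongr
      rw [mul_inv_cancel₀ hz0.ne'] at h4
      nlinarith [sq_nonneg ‖z‖]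
  nlinarith [sq_nonneg (‖z‖ - 1)]

lemma exists_norm_deriv_le_of_omit {a b : ℂ} (hab : a ≠ b) : ∃ K : ℝ, 0 ≤ K ∧
    ∀ (h : ℂ → ℂ) (c : ℂ) (r : ℝ), 0 < r → DifferentiableOn ℂ h (ball c r) →
      (∀ z ∈ ball c r, h z ≠ a) → (∀ z ∈ ball c r, h z ≠ b) →
      ‖deriv h c‖ ≤ K / r * (1 + ‖h c‖ ^ 2) := by
  have hba : b - a ≠ 0 := sub_ne_zero.2 hab.symm
  have hd : 0 < ‖b - a‖ := norm_pos_iff.2 hba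
  set M : ℝ := 1 + (2 + 2 * ‖a‖ ^ 2) / ‖b - a‖ ^ 2 with hM
  refine ⟨‖b - a‖ * (240000 * M), by positivity, fun h c r hr hh h1 h2 => ?_⟩
  have hc : c ∈ ball c r := mem_ball_self hr
  have key := norm_deriv_le_of_omit (h := fun z => (h z - a) / (b - a)) hr
    ((hh.sub_const a).div_const _) (fun z hz => div_ne_zero (sub_ne_zero.2 (h1 z hz)) hba)
    (fun z hz => by
      rw [Ne, div_eq_one_iff_eq hba]
      intro h3
      exact h2 z hz (sub_left_injective h3))
  have hder : deriv (fun z => (h z - a) / (b - a)) c = deriv h c / (b - a) := by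
    rw [deriv_div_const, deriv_sub_const]
  rw [hder, norm_div, div_le_iff₀ hd] at key
  refine key.trans ?_
  have h3 := mul_one_add_norm_log_le ((h c - a) / (b - a))
  have h4 : 1 + ‖(h c - a) / (b - a)‖ ^ 2 ≤ M * (1 + ‖h c‖ ^ 2) := by
    rw [norm_div, div_pow]
    have h5 : ‖h c - a‖ ^ 2 ≤ (2 + 2 * ‖a‖ ^ 2) * (1 + ‖h c‖ ^ 2) := by
      have := norm_sub_le (h c) a
      have h6 : ‖h c - a‖ ^ 2 ≤ (‖h c‖ + ‖a‖) ^ 2 := by gcongr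
      nlinarith [sq_nonneg (‖h c‖ - ‖a‖), mul_nonneg (sq_nonneg ‖a‖) (sq_nonneg ‖h c‖)]
    have h7 : ‖h c - a‖ ^ 2 / ‖b - a‖ ^ 2 ≤
        (2 + 2 * ‖a‖ ^ 2) * (1 + ‖h c‖ ^ 2) / ‖b - a‖ ^ 2 := by gcongr
    rw [hM, add_mul, one_mul, div_mul_eq_mul_div]
    nlinarith [sq_nonneg ‖h c‖]
  calc 40000 / r * (‖(h c - a) / (b - a)‖ * (1 + ‖Complex.log ((h c - a) / (b - a))‖)) * ‖b - a‖
      ≤ 40000 / r * (6 * (M * (1 + ‖h c‖ ^ 2))) * ‖b - a‖ := by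
        refine mul_le_mul_of_nonneg_right (mul_le_mul_of_nonneg_left ?_ (by positivity)) hd.le
        linarith
    _ = _ := by ring

/-- The Möbius map sending `c` to infinity, read as a complex-valued function. -/
noncomputable def moebiusAt (c : ℂ) (x : RSphere) : ℂ := RSphere.elim x 0 fun z => (z - c)⁻¹

@[simp] lemma moebiusAt_ofC (c z : ℂ) : moebiusAt c (ofC z) = (z - c)⁻¹ := rfl

@[simp] lemma moebiusAt_infty (c : ℂ) : moebiusAt c infty = 0 := rfl

lemma moebiusAt_inj {c : ℂ} {x y : RSphere} (hx : x ≠ ofC c) (hy : y ≠ ofC c)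
    (h : moebiusAt c x = moebiusAt c y) : x = y := by
  rcases cases_ofC x with rfl | ⟨z, rfl⟩ <;> rcases cases_ofC y with rfl | ⟨w, rfl⟩
  · rfl
  · rw [moebiusAt_ofC, moebiusAt_infty, eq_comm, inv_eq_zero, sub_eq_zero] at h
    exact absurd (congrArg ofC h) hy
  · rw [moebiusAt_ofC, moebiusAt_infty, inv_eq_zero, sub_eq_zero] at h
    exact absurd (congrArg ofC h) hx
  · rw [moebiusAt_ofC, moebiusAt_ofC, inv_inj, sub_left_inj] at h
    rw [h]

lemma moebiusAt_inv_ofC {c z : ℂ} (h : inv (ofC z) ≠ ofC c) :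
    1 - c * z ≠ 0 ∧ moebiusAt c (inv (ofC z)) = z / (1 - c * z) := by
  by_cases hz : z = 0
  · subst hz; simp
  · rw [inv_ofC hz, Ne, ofC_inj] at h
    have h1 : 1 - c * z ≠ 0 := by
      intro h2
      refine h ((eq_inv_of_mul_eq_one_left ?_).symm)
      linear_combination -h2
    refine ⟨h1, ?_⟩
    rw [inv_ofC hz, moebiusAt_ofC]
    have h3 : z⁻¹ - c = (1 - c * z) / z := by field_simp
    rw [h3, inv_div]

lemma SHolAt.differentiableAt_moebiusAt {u : ℂ → RSphere} {w c : ℂ} (hu : SHolAt u w)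
    (hc : u w ≠ ofC c) : DifferentiableAt ℂ (fun ζ => moebiusAt c (u ζ)) w := by
  obtain ⟨g, hg, h | h⟩ := hu
  · have hw : g w - c ≠ 0 := by
      rw [h.self_of_nhds, Ne, ofC_inj] at hc
      exact sub_ne_zero.2 hc
    have : (fun ζ => moebiusAt c (u ζ)) =ᶠ[𝓝 w] fun ζ => (g ζ - c)⁻¹ := by
      filter_upwards [h] with ζ hζ
      rw [hζ, moebiusAt_ofC]
    exact ((hg.differentiableAt.sub_const c).inv hw).congr_of_eventuallyEq this
  · have hw : inv (ofC (g w)) ≠ ofC c := by rwa [h.self_of_nhds] at hc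
    have h1 := (moebiusAt_inv_ofC hw).1
    have hd : DifferentiableAt ℂ (fun ζ => 1 - c * g ζ) w :=
      (hg.differentiableAt.const_mul c).const_sub 1
    have hcont : ContinuousAt (fun ζ => inv (ofC (g ζ))) w :=
      RSphere.continuous_inv.continuousAt.comp (continuous_ofC.continuousAt.comp hg.continuousAt)
    have : (fun ζ => moebiusAt c (u ζ)) =ᶠ[𝓝 w] fun ζ => g ζ / (1 - c * g ζ) := by
      filter_upwards [h, hcont.eventually_ne hw] with ζ hζ h2
      rw [hζ, (moebiusAt_inv_ofC h2).2]
    exact (hg.differentiableAt.div hd h1).congr_of_eventuallyEq this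

lemma norm_deriv_moebiusAt_ge {u : ℂ → RSphere} {w c : ℂ} {g : ℂ → ℂ} (hg : AnalyticAt ℂ g w)
    (h : (u =ᶠ[𝓝 w] fun ζ => ofC (g ζ)) ∨ (u =ᶠ[𝓝 w] fun ζ => inv (ofC (g ζ))))
    (hc : u w ≠ ofC c) :
    ‖deriv g w‖ / (1 + ‖g w‖ ^ 2) ≤ (3 + 2 * ‖c‖ ^ 2) *
      (‖deriv (fun ζ => moebiusAt c (u ζ)) w‖ / (1 + ‖moebiusAt c (u w)‖ ^ 2)) := by
  have hgd := hg.differentiableAt.hasDerivAt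
  have aux : ∀ X : ℝ, 0 < X → X ≤ (3 + 2 * ‖c‖ ^ 2) * (1 + ‖g w‖ ^ 2) →
      ‖deriv g w‖ / (1 + ‖g w‖ ^ 2) ≤ (3 + 2 * ‖c‖ ^ 2) * (‖deriv g w‖ / X) := by
    intro X hX hle
    rw [div_le_iff₀ (by positivity), mul_comm, ← mul_assoc, ← mul_div_assoc, le_div_iff₀ hX,
      mul_comm]
    calc X * ‖deriv g w‖ ≤ ((3 + 2 * ‖c‖ ^ 2) * (1 + ‖g w‖ ^ 2)) * ‖deriv g w‖ := by gcongr
      _ = _ := by ring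
  rcases h with h | h
  · have hw : g w - c ≠ 0 := by
      rw [h.self_of_nhds, Ne, ofC_inj] at hc
      exact sub_ne_zero.2 hc
    have e : (fun ζ => moebiusAt c (u ζ)) =ᶠ[𝓝 w] fun ζ => (g ζ - c)⁻¹ := by
      filter_upwards [h] with ζ hζ
      rw [hζ, moebiusAt_ofC]
    have hder := ((hgd.sub_const c).fun_inv hw).congr_of_eventuallyEq e
    have hn : 0 < ‖g w - c‖ := norm_pos_iff.2 hw
    have e2 : ‖deriv (fun ζ => moebiusAt c (u ζ)) w‖ / (1 + ‖moebiusAt c (u w)‖ ^ 2) =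
        ‖deriv g w‖ / (‖g w - c‖ ^ 2 + 1) := by
      have e0 : moebiusAt c (u w) = (g w - c)⁻¹ := e.self_of_nhds
      rw [hder.deriv, e0, norm_div, norm_neg, norm_pow, norm_inv]
      field_simp
    rw [e2]
    refine aux _ (by positivity) ?_
    have h6 : ‖g w - c‖ ^ 2 ≤ (‖g w‖ + ‖c‖) ^ 2 := by gcongr; exact norm_sub_le _ _
    nlinarith [sq_nonneg (‖g w‖ - ‖c‖), mul_nonneg (sq_nonneg ‖c‖) (sq_nonneg ‖g w‖)]
  · have hw : inv (ofC (g w)) ≠ ofC c := by rwa [h.self_of_nhds] at hc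
    have h1 := (moebiusAt_inv_ofC hw).1
    have hcont : ContinuousAt (fun ζ => inv (ofC (g ζ))) w :=
      RSphere.continuous_inv.continuousAt.comp (continuous_ofC.continuousAt.comp hg.continuousAt)
    have e : (fun ζ => moebiusAt c (u ζ)) =ᶠ[𝓝 w] fun ζ => g ζ / (1 - c * g ζ) := by
      filter_upwards [h, hcont.eventually_ne hw] with ζ hζ h2
      rw [hζ, (moebiusAt_inv_ofC h2).2]
    have hder := (hgd.fun_div ((hgd.const_mul c).const_sub 1) h1).congr_of_eventuallyEq e
    have hn : 0 < ‖1 - c * g w‖ := norm_pos_iff.2 h1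
    have e2 : ‖deriv (fun ζ => moebiusAt c (u ζ)) w‖ / (1 + ‖moebiusAt c (u w)‖ ^ 2) =
        ‖deriv g w‖ / (‖1 - c * g w‖ ^ 2 + ‖g w‖ ^ 2) := by
      have e0 : moebiusAt c (u w) = g w / (1 - c * g w) := e.self_of_nhds
      rw [hder.deriv, e0, norm_div, norm_pow, norm_div]
      have : deriv g w * (1 - c * g w) - g w * -(c * deriv g w) = deriv g w := by ring
      rw [this]
      field_simp
    rw [e2]
    refine aux _ (by positivity) ?_
    have h6 : ‖1 - c * g w‖ ^ 2 ≤ (1 + ‖c‖ * ‖g w‖) ^ 2 := by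
      gcongr
      refine (norm_sub_le _ _).trans ?_
      simp
    nlinarith [sq_nonneg (1 - ‖c‖ * ‖g w‖), mul_nonneg (sq_nonneg ‖c‖) (sq_nonneg ‖g w‖),
      sq_nonneg ‖c‖, sq_nonneg ‖g w‖]

/-- Holomorphic self-maps of the sphere omitting three values on a neighbourhood of `x` have
uniformly bounded derivative at `x`. -/
lemma exists_sphDeriv_bound {x₁ x₂ x₃ : RSphere} (h₁₂ : x₁ ≠ x₂) (h₁₃ : x₁ ≠ x₃) (h₂₃ : x₂ ≠ x₃)
    {x : RSphere} {U : Set RSphere} (hU : U ∈ 𝓝 x) : ∃ K : ℝ, ∀ F : RSphere → RSphere, SHol F →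
      (∀ u ∈ U, F u ≠ x₁) → (∀ u ∈ U, F u ≠ x₂) → (∀ u ∈ U, F u ≠ x₃) → sphDeriv F x ≤ K := by
  wlog hfin : x₁ ≠ infty generalizing x₁ x₂ x₃
  · push Not at hfin
    subst hfin
    obtain ⟨K, hK⟩ := this h₁₂.symm h₂₃ h₁₃ h₁₂.symm
    exact ⟨K, fun F hF h1 h2 h3 => hK F hF h2 h1 h3⟩
  obtain ⟨c, rfl⟩ := (cases_ofC x₁).resolve_left hfin
  obtain ⟨σ, w, hσ, rfl⟩ : ∃ (σ : RSphere → RSphere) (w : ℂ), (σ = id ∨ σ = inv) ∧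
      x = σ (ofC w) := by
    rcases cases_ofC x with rfl | ⟨w, rfl⟩
    · exact ⟨inv, 0, Or.inr rfl, by simp⟩
    · exact ⟨id, w, Or.inl rfl, by simp⟩
  rw [← map_chart_nhds hσ, Filter.mem_map] at hU
  obtain ⟨r, hr, hball⟩ := Metric.mem_nhds_iff.1 hU
  have hne : moebiusAt c x₂ ≠ moebiusAt c x₃ := fun h =>
    h₂₃ (moebiusAt_inj h₁₂.symm h₁₃.symm h)
  obtain ⟨K, hK0, hK⟩ := exists_norm_deriv_le_of_omit hne
  refine ⟨(3 + 2 * ‖c‖ ^ 2) * (K / r) * (1 + ‖w‖ ^ 2), fun F hF h1 h2 h3 => ?_⟩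
  have hhol : ∀ ζ, SHolAt (fun ζ => F (σ (ofC ζ))) ζ := by
    intro ζ
    rcases hσ with rfl | rfl
    exacts [(hF ζ).1, (hF ζ).2]
  have hw : w ∈ ball w r := mem_ball_self hr
  have key := hK (fun ζ => moebiusAt c (F (σ (ofC ζ)))) w r hr
    (fun ζ hζ => ((hhol ζ).differentiableAt_moebiusAt (h1 _ (hball hζ))).differentiableWithinAt)
    (fun ζ hζ h => h2 _ (hball hζ) (moebiusAt_inj (h1 _ (hball hζ)) h₁₂.symm h))
    (fun ζ hζ h => h3 _ (hball hζ) (moebiusAt_inj (h1 _ (hball hζ)) h₁₃.symm h))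
  obtain ⟨g, hg, h⟩ := hhol w
  have hb := norm_deriv_moebiusAt_ge hg h (h1 _ (hball hw))
  have hs : sphDeriv F (σ (ofC w)) = ‖deriv g w‖ * (1 + ‖w‖ ^ 2) / (1 + ‖g w‖ ^ 2) := by
    rcases h with h | h
    · exact (hasScaling_of_chart (τ := id) hσ (Or.inl rfl) hg h).sphDeriv_eq
    · exact (hasScaling_of_chart (τ := inv) hσ (Or.inr rfl) hg h).sphDeriv_eq
  rw [hs, mul_div_right_comm]
  refine mul_le_mul_of_nonneg_right (hb.trans ?_) (by positivity)
  exact mul_le_mul_of_nonneg_left ((div_le_iff₀ (by positivity)).2 key) (by positivity)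

lemma ExpandingOn.pos {f : RSphere → RSphere} {L : Set RSphere}
    (hL : ExpandingOn f L) {x : RSphere} (hx : x ∈ L) (n : ℕ) : 0 < sphDeriv f^[n] x := by
  rcases Nat.eq_zero_or_pos n with rfl | hn
  · rw [Function.iterate_zero, sphDeriv_id]; exact one_pos
  · obtain ⟨c, hc, l, hl, h⟩ := hL
    exact (by positivity : 0 < c * l ^ n).trans_le (h x hx n hn)

lemma SHol.noncritical_of_iterate {f : RSphere → RSphere} (hf : SHol f) {m n : ℕ} {x : RSphere}
    (h : sphDeriv f^[m + n] x ≠ 0) : sphDeriv f^[m] (f^[n] x) ≠ 0 ∧ sphDeriv f^[n] x ≠ 0 := by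
  rw [hf.sphDeriv_iterate_add] at h
  exact ⟨left_ne_zero_of_mul h, right_ne_zero_of_mul h⟩

/-- Noncritical preimages of a point of the Julia set form an infinite set when the point is
periodic, repelling and the map has no exceptional set in the Julia set. -/
lemma SHol.infinite_noncritical_preimages {f : RSphere → RSphere} (hf : SHol f)
    (hexc : ∀ S : Set RSphere, S.Finite → S.Nonempty → f ⁻¹' S \ critSet f = S →
      S ∩ juliaSet f = ∅) {a : RSphere} (ha : a ∈ juliaSet f) {p : ℕ} (hp : 0 < p)
    (hpa : f^[p] a = a) (hcrit : sphDeriv f^[p] a ≠ 0) :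
    {y | ∃ n, f^[n] y = a ∧ sphDeriv f^[n] y ≠ 0}.Infinite := by
  intro hfin
  have hmem : a ∈ {y | ∃ n, f^[n] y = a ∧ sphDeriv f^[n] y ≠ 0} :=
    ⟨0, rfl, by rw [Function.iterate_zero, sphDeriv_id]; exact one_ne_zero⟩
  have := hexc _ hfin ⟨a, hmem⟩ ?_
  · exact (Set.ext_iff.1 this a).1 ⟨hmem, ha⟩
  have pos : ∀ n, 0 < n → ∀ y, f^[n] y = a → sphDeriv f^[n] y ≠ 0 →
      y ∈ f ⁻¹' {y | ∃ n, f^[n] y = a ∧ sphDeriv f^[n] y ≠ 0} \ critSet f := by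
    intro n hn y hy hy'
    obtain ⟨k, rfl⟩ : ∃ k, n = k + 1 := ⟨n - 1, by omega⟩
    have h := hf.noncritical_of_iterate hy'
    exact ⟨⟨k, by rw [← hy, Function.iterate_succ_apply], h.1⟩, h.2⟩
  ext y
  constructor
  · rintro ⟨⟨n, hn, hn'⟩, hy⟩
    refine ⟨n + 1, by rwa [Function.iterate_succ_apply], ?_⟩
    rw [hf.sphDeriv_iterate_add]
    exact mul_ne_zero hn' hy
  · rintro ⟨n, hn, hn'⟩
    rcases Nat.eq_zero_or_pos n with rfl | h0
    · have : y = a := hn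
      subst this
      exact pos p hp _ hpa hcrit
    · exact pos n h0 y hn hn'

lemma FinHol.exists_noncritical_preimage {f : RSphere → RSphere} (hf : FinHol f)
    (hexc : ∀ S : Set RSphere, S.Finite → S.Nonempty → f ⁻¹' S \ critSet f = S →
      S ∩ juliaSet f = ∅) {L : Set RSphere} (hLJ : L ⊆ juliaSet f) (hinv : f '' L = L)
    (hexp : ExpandingOn f L) {a : RSphere} (ha : a ∈ L) :
    ∃ z m, 2 ≤ m ∧ f^[m] z = a ∧ sphDeriv f^[m] z ≠ 0 ∧ z ≠ f z ∧ z ≠ f^[2] z ∧ f z ≠ f^[2] z ∧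
      ∀ c ∈ critSet f, ∀ j, f^[j] c ≠ f^[2] z := by
  have fixiter : ∀ (s : ℕ) (z : RSphere), f^[s] z = z → ∀ i, f^[s * i] z = z := fun s z h i => by
    rw [Function.iterate_mul]; exact Function.iterate_fixed h i
  by_cases hper : ∃ p, 0 < p ∧ f^[p] a = a
  · obtain ⟨p, hp, hpa⟩ := hper
    set O : Set RSphere := range fun j => f^[j] a with hO
    have hOinv : ∀ x ∈ O, ∀ i, f^[i] x ∈ O := by
      rintro _ ⟨j, rfl⟩ i
      exact ⟨i + j, Function.iterate_add_apply f i j a⟩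
    have haO : a ∈ O := ⟨0, rfl⟩
    have hOfin : O.Finite := by
      refine ((finite_lt_nat p).image fun j => f^[j] a).subset ?_
      rintro _ ⟨j, rfl⟩
      exact ⟨j % p, Nat.mod_lt _ hp, Function.IsPeriodicPt.iterate_mod_apply hpa j⟩
    have hT : ∀ c : RSphere, ∃ t, (∃ t, f^[t] c ∈ O) → f^[t] c ∈ O := by
      intro c
      by_cases h : ∃ t, f^[t] c ∈ O
      · obtain ⟨t, ht⟩ := h
        exact ⟨t, fun _ => ht⟩
      · exact ⟨0, fun h' => absurd h' h⟩
    choose t ht using hT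
    obtain ⟨T, hT⟩ := (hf.finite_critSet.image t).bddAbove
    have hpre : (f^[T + 2] ⁻¹' O).Finite := by
      rw [← biUnion_preimage_singleton]
      exact hOfin.biUnion fun y _ => (hf.iterate _).finite_fiber y
    have hinf := hf.hol.infinite_noncritical_preimages hexc (hLJ ha) hp hpa
      (hexp.pos ha p).ne'
    obtain ⟨z, ⟨m, hm, hm'⟩, hz⟩ := (hinf.sdiff hpre).nonempty
    have hnot : ∀ i ≤ T + 2, f^[i] z ∉ O := by
      intro i hi h
      have := hOinv _ h (T + 2 - i)
      rw [← Function.iterate_add_apply, Nat.sub_add_cancel hi] at this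
      exact hz this
    have hmT : T + 2 < m := by
      by_contra h
      exact hnot m (by omega) (hm ▸ haO)
    refine ⟨z, m, by omega, hm, hm', fun h => ?_, fun h => ?_, fun h => ?_, fun c hc j h => ?_⟩
    · refine hnot 0 (by omega) ?_
      have := fixiter 1 z h.symm m
      rw [one_mul, hm] at this
      exact this ▸ haO
    · refine hnot 0 (by omega) ?_
      have := fixiter 2 z h.symm m
      rw [two_mul, Function.iterate_add_apply, hm] at this
      rw [Function.iterate_zero, id, ← this]
      exact hOinv a haO m
    · refine hnot 1 (by omega) ?_
      have := fixiter 1 (f z) h.symm (m - 1)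
      rw [one_mul, ← Function.iterate_succ_apply, Nat.succ_eq_add_one,
        Nat.sub_add_cancel (by omega), hm] at this
      rw [Function.iterate_one, ← this]
      exact haO
    · have h1 : ∃ t, f^[t] c ∈ O := by
        refine ⟨m - 2 + j, ?_⟩
        rw [Function.iterate_add_apply, h, ← Function.iterate_add_apply,
          Nat.sub_add_cancel (by omega), hm]
        exact haO
      have h2 : t c ≤ T := hT ⟨c, hc, rfl⟩
      have h3 := hOinv _ (ht c h1) (T + j - t c)
      rw [← Function.iterate_add_apply, Nat.sub_add_cancel (by omega),
        Function.iterate_add_apply, h, ← Function.iterate_add_apply] at h3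
      exact hnot _ le_rfl h3
  · have hT : ∀ c : RSphere, ∃ t, ∀ s, f^[s] c = a → s ≤ t := by
      intro c
      by_cases h : ∃ t, f^[t] c = a
      · obtain ⟨t, ht⟩ := h
        refine ⟨t, fun s hs => ?_⟩
        by_contra hlt
        refine hper ⟨s - t, by omega, ?_⟩
        conv_lhs => rw [← ht]
        rw [← Function.iterate_add_apply, Nat.sub_add_cancel (by omega), hs]
      · exact ⟨0, fun s hs => absurd ⟨s, hs⟩ h⟩
    choose t ht using hT
    obtain ⟨T, hT⟩ := (hf.finite_critSet.image t).bddAbove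
    have hback : ∀ n, ∃ x ∈ L, f^[n] x = a := by
      intro n
      induction n with
      | zero => exact ⟨a, ha, rfl⟩
      | succ n ih =>
        obtain ⟨x, hx, hxa⟩ := ih
        rw [← hinv] at hx
        obtain ⟨y, hy, rfl⟩ := hx
        exact ⟨y, hy, by rwa [Function.iterate_succ_apply]⟩
    obtain ⟨z, hz, hza⟩ := hback (T + 3)
    have hno : ∀ s i, 0 < s → i ≤ T + 3 → f^[s] (f^[i] z) ≠ f^[i] z := by
      intro s i hs hi h
      refine hper ⟨s, hs, ?_⟩
      have : f^[T + 3 - i] (f^[i] z) = a := by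
        rw [← Function.iterate_add_apply, Nat.sub_add_cancel hi, hza]
      rw [← this, ← Function.iterate_add_apply, add_comm, Function.iterate_add_apply, h]
    refine ⟨z, T + 3, by omega, hza, (hexp.pos hz _).ne', fun h => ?_, fun h => ?_,
      fun h => ?_, fun c hc j h => ?_⟩
    · exact hno 1 0 (by omega) (by omega) h.symm
    · exact hno 2 0 (by omega) (by omega) h.symm
    · exact hno 1 1 (by omega) (by omega) h.symm
    · have h1 : f^[T + 1 + j] c = a := by
        rw [Function.iterate_add_apply, h, ← Function.iterate_add_apply, hza]
      have h2 : t c ≤ T := hT ⟨c, hc, rfl⟩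
      have := ht c _ h1
      omega

lemma FinHol.exists_bridge_point {f : RSphere → RSphere} (hf : FinHol f)
    (hexc : ∀ S : Set RSphere, S.Finite → S.Nonempty → f ⁻¹' S \ critSet f = S →
      S ∩ juliaSet f = ∅) {L : Set RSphere} (hLJ : L ⊆ juliaSet f) (hinv : f '' L = L)
    (hexp : ExpandingOn f L) {a b : RSphere} (ha : a ∈ L) (hb : b ∈ L) {ρ : ℝ} (hρ : 0 < ρ) :
    ∃ u ∈ ball b ρ, ∃ n, f^[n] u = a ∧ sphDeriv f^[n] u ≠ 0 := by
  obtain ⟨z, m, hm, hza, hz', h1, h2, h3, hc⟩ :=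
    hf.exists_noncritical_preimage hexc hLJ hinv hexp ha
  obtain ⟨K, hK⟩ := exists_sphDeriv_bound h1 h2 h3 (ball_mem_nhds b hρ)
  obtain ⟨n, hn⟩ : ∃ n, K < sphDeriv f^[n] b := by
    obtain ⟨c, hc, l, hl, h⟩ := hexp
    obtain ⟨n, hn⟩ := pow_unbounded_of_one_lt (K / c) hl
    refine ⟨n + 1, ((div_lt_iff₀' hc).1 (hn.trans ?_)).trans_le (h b hb _ (by omega))⟩
    exact pow_lt_pow_right₀ hl (by omega)
  obtain ⟨u, hu, i, hi, hui⟩ : ∃ u ∈ ball b ρ, ∃ i ≤ 2, f^[n] u = f^[i] z := by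
    by_contra! hcon
    exact absurd (hK _ (hf.hol.iterate n) (fun u hu => hcon u hu 0 (by omega))
      (fun u hu => hcon u hu 1 (by omega)) (fun u hu => hcon u hu 2 (by omega))) (not_le.2 hn)
  refine ⟨u, hu, (m - i) + n, ?_, ?_⟩
  · rw [Function.iterate_add_apply, hui, ← Function.iterate_add_apply,
      Nat.sub_add_cancel (by omega), hza]
  · rw [hf.hol.sphDeriv_iterate_add, hui]
    refine mul_ne_zero ?_ ?_
    · refine (hf.hol.noncritical_of_iterate (n := i) ?_).1
      rwa [Nat.sub_add_cancel (by omega)]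
    · rw [hf.hol.sphDeriv_iterate]
      refine Finset.prod_ne_zero_iff.2 fun k hk h0 => ?_
      have hk' : k < n := Finset.mem_range.1 hk
      refine hc (f^[k] u) h0 (2 - i + (n - k)) ?_
      rw [← Function.iterate_add_apply, show 2 - i + (n - k) + k = (2 - i) + n by omega,
        Function.iterate_add_apply, hui, ← Function.iterate_add_apply, Nat.sub_add_cancel hi]

lemma IsCompact.exists_uniform_radius {X : Type*} [TopologicalSpace X] {K : Set X}
    (hK : IsCompact K) {P : X → ℝ → Prop} (anti : ∀ x r r', 0 < r' → r' ≤ r → P x r → P x r')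
    (loc : ∀ x ∈ K, ∃ r > 0, ∀ᶠ y in 𝓝 x, P y r) : ∃ r > 0, ∀ x ∈ K, P x r := by
  refine hK.induction_on (p := fun S => ∃ r > 0, ∀ x ∈ S, P x r) ⟨1, one_pos, by simp⟩ ?_ ?_ ?_
  · rintro s t hst ⟨r, hr, h⟩
    exact ⟨r, hr, fun x hx => h x (hst hx)⟩
  · rintro s t ⟨r, hr, h⟩ ⟨r', hr', h'⟩
    refine ⟨min r r', lt_min hr hr', ?_⟩
    rintro x (hx | hx)
    · exact anti x r _ (lt_min hr hr') (min_le_left _ _) (h x hx)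
    · exact anti x r' _ (lt_min hr hr') (min_le_right _ _) (h' x hx)
  · intro x hx
    obtain ⟨r, hr, h⟩ := loc x hx
    exact ⟨_, mem_nhdsWithin_of_mem_nhds h, r, hr, fun y hy => hy⟩

/-- A map expands distances on `S` by the factor `s`, up to a multiplicative error. -/
def ScalesOn (g : RSphere → RSphere) (S : Set RSphere) (lo hi : ℝ) : Prop :=
  ∀ y ∈ S, ∀ y' ∈ S, lo * dist y y' ≤ dist (g y) (g y') ∧ dist (g y) (g y') ≤ hi * dist y y'

lemma SHol.exists_uniform_scaling {f : RSphere → RSphere} (hf : SHol f) {L : Set RSphere}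
    (hL : IsCompact L) (hpos : ∀ x ∈ L, 0 < sphDeriv f x) {η : ℝ} (hη : 0 < η) :
    ∃ r > 0, ∀ x ∈ L, ScalesOn f (ball x r) (Real.exp (-η) * sphDeriv f x)
      (Real.exp η * sphDeriv f x) := by
  refine hL.exists_uniform_radius (fun x r r' _ hle h y hy y' hy' =>
    h y (ball_subset_ball hle hy) y' (ball_subset_ball hle hy')) fun x hx => ?_
  have hs := hpos x hx
  set s := sphDeriv f x with hsdef
  have e1 : Real.exp (-(η / 2)) * s < s := by
    nlinarith [Real.exp_lt_one_iff.2 (show -(η / 2) < 0 by linarith)]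
  have e2 : s < Real.exp (η / 2) * s := by
    nlinarith [Real.one_lt_exp_iff.2 (show (0 : ℝ) < η / 2 by linarith)]
  have h1 := (hf.hasScaling x).eventually_le e2
  have h2 := (hf.hasScaling x).eventually_ge e1
  have h3 := h1.and h2
  rw [nhds_prod_eq] at h3
  obtain ⟨r, hr, hr'⟩ := (nhds_basis_ball.prod_self.eventually_iff).1 h3
  refine ⟨r / 2, by positivity, ?_⟩
  have hc := hf.continuous_sphDeriv.continuousAt (x := x)
  filter_upwards [ball_mem_nhds x (half_pos hr), hc.eventually (lt_mem_nhds e1),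
    hc.eventually (gt_mem_nhds e2)] with x' hx' hlt hgt
  have hsub : ball x' (r / 2) ⊆ ball x r := by
    refine ball_subset_ball' ?_
    have := mem_ball.1 hx'
    linarith
  intro y hy y' hy'
  obtain ⟨h4, h5⟩ := hr' (show (y, y') ∈ _ from ⟨hsub hy, hsub hy'⟩)
  constructor
  · refine le_trans ?_ h5
    refine mul_le_mul_of_nonneg_right ?_ dist_nonneg
    calc Real.exp (-η) * sphDeriv f x' ≤ Real.exp (-η) * (Real.exp (η / 2) * s) := by gcongr
      _ = Real.exp (-(η / 2)) * s := by rw [← mul_assoc, ← Real.exp_add]; ring_nf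
  · refine h4.trans ?_
    refine mul_le_mul_of_nonneg_right ?_ dist_nonneg
    calc Real.exp (η / 2) * s = Real.exp η * (Real.exp (-(η / 2)) * s) := by
          rw [← mul_assoc, ← Real.exp_add]; ring_nf
      _ ≤ Real.exp η * sphDeriv f x' := by gcongr

lemma FinHol.exists_uniform_open {f : RSphere → RSphere} (hf : FinHol f) {L : Set RSphere}
    (hL : IsCompact L) {ρ : ℝ} (hρ : 0 < ρ) :
    ∃ r > 0, ∀ x ∈ L, closedBall (f x) r ⊆ f '' ball x ρ := by
  refine hL.exists_uniform_radius (fun x r r' _ hle h => (closedBall_subset_closedBall hle).trans h)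
    fun x _ => ?_
  have h1 : f '' ball x (ρ / 2) ∈ 𝓝 (f x) :=
    hf.isOpenMap.image_mem_nhds (ball_mem_nhds x (half_pos hρ))
  obtain ⟨r, hr, h2⟩ := Metric.mem_nhds_iff.1 h1
  refine ⟨r / 2, half_pos hr, ?_⟩
  filter_upwards [ball_mem_nhds x (half_pos hρ),
    hf.hol.continuous.continuousAt.eventually (ball_mem_nhds (f x) (half_pos hr))] with x' h3 h4
  intro y hy
  have h5 : y ∈ ball (f x) r := by
    rw [mem_ball]
    have := dist_triangle y (f x') (f x)
    have h6 := mem_closedBall.1 hy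
    have h7 := mem_ball.1 h4
    linarith
  obtain ⟨w, hw, rfl⟩ := h2 h5
  refine ⟨w, ?_, rfl⟩
  rw [mem_ball] at *
  have := dist_triangle_right w x' x
  linarith

/-- Choosing preimages in a set where `f` scales distances gives an inverse branch scaling
distances. -/
lemma exists_inverse_of_subset_image {f : RSphere → RSphere} {S T : Set RSphere} {lo hi : ℝ}
    (hlo : 0 < lo) (hhi : 0 < hi) (h : ScalesOn f S lo hi) (hT : T ⊆ f '' S) :
    ∃ σ : RSphere → RSphere, (∀ y ∈ T, σ y ∈ S ∧ f (σ y) = y) ∧ ScalesOn σ T hi⁻¹ lo⁻¹ := by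
  have : ∀ y, ∃ x, y ∈ T → x ∈ S ∧ f x = y := by
    intro y
    by_cases hy : y ∈ T
    · obtain ⟨x, hx, hxy⟩ := hT hy
      exact ⟨x, fun _ => ⟨hx, hxy⟩⟩
    · exact ⟨y, fun h => absurd h hy⟩
  choose σ hσ using this
  refine ⟨σ, hσ, fun y hy y' hy' => ?_⟩
  obtain ⟨h1, h2⟩ := h _ (hσ y hy).1 _ (hσ y' hy').1
  rw [(hσ y hy).2, (hσ y' hy').2] at h1 h2
  exact ⟨(inv_mul_le_iff₀ hhi).2 h2, (le_inv_mul_iff₀ hlo).2 h1⟩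

lemma ScalesOn.comp {g h : RSphere → RSphere} {S T : Set RSphere} {lo hi lo' hi' : ℝ}
    (hlo : 0 ≤ lo) (hhi : 0 ≤ hi) (hg : ScalesOn g T lo hi) (hh : ScalesOn h S lo' hi')
    (hST : MapsTo h S T) : ScalesOn (g ∘ h) S (lo * lo') (hi * hi') := by
  intro y hy y' hy'
  obtain ⟨h1, h2⟩ := hh y hy y' hy'
  obtain ⟨h3, h4⟩ := hg _ (hST hy) _ (hST hy')
  refine ⟨?_, ?_⟩
  · rw [mul_assoc]
    exact (mul_le_mul_of_nonneg_left h1 hlo).trans h3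
  · rw [mul_assoc]
    exact h4.trans (mul_le_mul_of_nonneg_left h2 hhi)

lemma ScalesOn.mono {g : RSphere → RSphere} {S T : Set RSphere} {lo hi lo' hi' : ℝ}
    (h : ScalesOn g T lo hi) (hS : S ⊆ T) (hlo : lo' ≤ lo) (hhi : hi ≤ hi') :
    ScalesOn g S lo' hi' := fun y hy y' hy' =>
  ⟨(mul_le_mul_of_nonneg_right hlo dist_nonneg).trans (h y (hS hy) y' (hS hy')).1,
    (h y (hS hy) y' (hS hy')).2.trans (mul_le_mul_of_nonneg_right hhi dist_nonneg)⟩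

lemma FinHol.exists_local_inverse {g : RSphere → RSphere} (hg : FinHol g) {u : RSphere}
    (hu : sphDeriv g u ≠ 0) {ρ : ℝ} (hρ : 0 < ρ) :
    ∃ r > 0, ∃ C ≥ 1, ∃ κ : RSphere → RSphere,
      (∀ y ∈ closedBall (g u) r, κ y ∈ ball u ρ ∧ g (κ y) = y) ∧
      ScalesOn κ (closedBall (g u) r) C⁻¹ C := by
  have hs : 0 < sphDeriv g u := (hg.hol.sphDeriv_nonneg u).lt_of_ne' hu
  obtain ⟨r₁, hr₁, h1⟩ := hg.hol.exists_uniform_scaling (isCompact_singleton (x := u))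
    (by rintro x rfl; exact hs) one_pos
  obtain ⟨r, hr, h2⟩ := hg.exists_uniform_open (isCompact_singleton (x := u)) (lt_min hr₁ hρ)
  obtain ⟨κ, hκ, hsc⟩ := exists_inverse_of_subset_image (by positivity) (by positivity)
    ((h1 u rfl).mono (ball_subset_ball (min_le_left r₁ ρ)) le_rfl le_rfl) (h2 u rfl)
  set A := (Real.exp (-1) * sphDeriv g u)⁻¹
  set A' := Real.exp 1 * sphDeriv g u with hA'
  have hA'0 : 0 < A' := by positivity
  refine ⟨r, hr, max (max A A') 1, le_max_right _ _, κ, fun y hy =>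
    ⟨ball_subset_ball (min_le_right r₁ ρ) (hκ y hy).1, (hκ y hy).2⟩, hsc.mono subset_rfl ?_ ?_⟩
  · exact inv_anti₀ hA'0 ((le_max_right _ _).trans (le_max_left _ _))
  · exact (le_max_left _ _).trans (le_max_left _ _)

/-- Inverse branches of all iterates along orbits of an expanding set. -/
lemma FinHol.exists_shadowing {f : RSphere → RSphere} (hf : FinHol f) {L : Set RSphere}
    (hL : IsCompact L) (hinv : f '' L = L) (hexp : ExpandingOn f L) {η δ : ℝ} (hη : 0 < η)
    (hδ : 0 < δ) : ∃ r > 0, ∀ n, ∀ x ∈ L, ∃ ψ : RSphere → RSphere, ψ (f^[n] x) = x ∧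
      (∀ y ∈ closedBall (f^[n] x) r, f^[n] (ψ y) = y ∧
        ∀ k ≤ n, dist (f^[k] (ψ y)) (f^[k] x) ≤ δ) ∧
      ScalesOn ψ (closedBall (f^[n] x) r) (Real.exp (n * η) * sphDeriv f^[n] x)⁻¹
        (Real.exp (-(n * η)) * sphDeriv f^[n] x)⁻¹ := by
  have hpos := fun (x) (hx : x ∈ L) (n) => hexp.pos hx n
  obtain ⟨c, hc, l, hl, hcl⟩ := hexp
  have hl0 : 0 < l := one_pos.trans hl
  wlog hηl : η ≤ Real.log l generalizing η
  · obtain ⟨r, hr, h⟩ := this (η := Real.log l) (Real.log_pos hl) le_rfl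
    push Not at hηl
    refine ⟨r, hr, fun n x hx => ?_⟩
    obtain ⟨ψ, h1, h2, h3⟩ := h n x hx
    have hp := hpos x hx n
    refine ⟨ψ, h1, h2, h3.mono subset_rfl ?_ ?_⟩
    · refine inv_anti₀ (by positivity) ?_
      gcongr
    · refine inv_anti₀ (by positivity) ?_
      gcongr
  set C : ℝ := max c⁻¹ 1 with hC
  have hC1 : 1 ≤ C := le_max_right _ _
  have hbound : ∀ n : ℕ, ∀ x ∈ L, (Real.exp (-(n * η)) * sphDeriv f^[n] x)⁻¹ ≤ C := by
    intro n x hx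
    rcases Nat.eq_zero_or_pos n with rfl | hn
    · rw [Function.iterate_zero, sphDeriv_id]; simpa using hC1
    · refine le_trans ?_ (le_max_left _ _)
      refine inv_anti₀ hc ?_
      have h1 := hcl x hx n hn
      have h2 : Real.exp (n * η) ≤ l ^ n := by
        rw [Real.exp_nat_mul]
        exact pow_le_pow_left₀ (Real.exp_pos _).le ((Real.le_log_iff_exp_le hl0).1 hηl) n
      rw [Real.exp_neg, inv_mul_eq_div, le_div_iff₀ (Real.exp_pos _)]
      calc c * Real.exp (n * η) ≤ c * l ^ n := by gcongr
        _ ≤ _ := h1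
  obtain ⟨ρ, hρ, hsc⟩ := hf.hol.exists_uniform_scaling hL
    (fun x hx => by simpa using hpos x hx 1) hη
  obtain ⟨r₀, hr₀, hop⟩ := hf.exists_uniform_open hL hρ
  have hC0 : 0 < C := by linarith
  refine ⟨min r₀ δ / C, by positivity, fun n => ?_⟩
  set r := min r₀ δ / C with hr
  have hCr : C * r = min r₀ δ := by rw [hr]; field_simp
  have hr0 : 0 < r := by positivity
  have key : ∀ n : ℕ, ∀ x ∈ L, ∀ ψ : RSphere → RSphere, ψ (f^[n] x) = x →
      ScalesOn ψ (closedBall (f^[n] x) r) (Real.exp (n * η) * sphDeriv f^[n] x)⁻¹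
        (Real.exp (-(n * η)) * sphDeriv f^[n] x)⁻¹ →
      ∀ y ∈ closedBall (f^[n] x) r, dist (ψ y) x ≤ min r₀ δ := by
    intro n x hx ψ h1 h2 y hy
    have h3 := (h2 y hy _ (mem_closedBall_self hr0.le)).2
    rw [h1] at h3
    rw [← hCr]
    exact h3.trans (mul_le_mul (hbound n x hx) (mem_closedBall.1 hy) dist_nonneg hC0.le)
  induction n with
  | zero =>
    intro x hx
    have hsc0 : ScalesOn id (closedBall (f^[0] x) r)
        (Real.exp ((0 : ℕ) * η) * sphDeriv f^[0] x)⁻¹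
        (Real.exp (-((0 : ℕ) * η)) * sphDeriv f^[0] x)⁻¹ := by
      intro y _ y' _
      simp [sphDeriv_id]
    refine ⟨id, rfl, fun y hy => ⟨rfl, fun k hk => ?_⟩, hsc0⟩
    obtain rfl : k = 0 := by omega
    exact (key 0 x hx id rfl hsc0 y hy).trans (min_le_right _ _)
  | succ n ih =>
    intro x hx
    have hfx : f x ∈ L := hinv ▸ mem_image_of_mem f hx
    obtain ⟨ψ₁, h1, h2, h3⟩ := ih (f x) hfx
    have hx0 : 0 < sphDeriv f x := by simpa using hpos x hx 1
    obtain ⟨σ, hσ, hσs⟩ := exists_inverse_of_subset_image (by positivity) (by positivity)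
      (hsc x hx) (hop x hx)
    have hσx : σ (f x) = x := by
      have h4 := hσ (f x) (mem_closedBall_self hr₀.le)
      have h5 := (hsc x hx _ h4.1 x (mem_ball_self hρ)).1
      rw [h4.2, dist_self] at h5
      by_contra hne
      have := dist_pos.2 hne
      have : 0 < Real.exp (-η) * sphDeriv f x * dist (σ (f x)) x := by positivity
      linarith
    have hmaps : MapsTo ψ₁ (closedBall (f^[n] (f x)) r) (closedBall (f x) r₀) := fun y hy =>
      (key n (f x) hfx ψ₁ h1 h3 y hy).trans (min_le_left _ _)
    have hsder : sphDeriv f^[n + 1] x = sphDeriv f^[n] (f x) * sphDeriv f x :=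
      hf.hol.sphDeriv_iterate_add n 1 x
    have hψ : (σ ∘ ψ₁) (f^[n + 1] x) = x := by
      rw [Function.comp_apply, Function.iterate_succ_apply, h1, hσx]
    have hψs : ScalesOn (σ ∘ ψ₁) (closedBall (f^[n + 1] x) r)
        (Real.exp ((n + 1 : ℕ) * η) * sphDeriv f^[n + 1] x)⁻¹
        (Real.exp (-((n + 1 : ℕ) * η)) * sphDeriv f^[n + 1] x)⁻¹ := by
      rw [Function.iterate_succ_apply]
      refine (hσs.comp (by positivity) (by positivity) h3 hmaps).mono subset_rfl
        (le_of_eq ?_) (le_of_eq ?_)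
      · rw [hsder, ← mul_inv]
        push_cast
        rw [add_mul, one_mul, Real.exp_add]
        ring
      · rw [hsder, ← mul_inv]
        push_cast
        rw [add_mul, one_mul, neg_add, Real.exp_add]
        ring
    refine ⟨σ ∘ ψ₁, hψ, fun y hy => ?_, hψs⟩
    have hy' : y ∈ closedBall (f^[n] (f x)) r := by rwa [← Function.iterate_succ_apply]
    have hfσ : f ((σ ∘ ψ₁) y) = ψ₁ y := (hσ _ (hmaps hy')).2
    refine ⟨by rw [Function.iterate_succ_apply, hfσ]; exact (h2 y hy').1, fun k hk => ?_⟩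
    rcases k with _ | k
    · exact (key _ x hx _ hψ hψs y hy).trans (min_le_right _ _)
    · rw [Function.iterate_succ_apply, Function.iterate_succ_apply, hfσ]
      exact (h2 y hy').2 k (by omega)

/-- A family of inverse branches of `f^[n]` mapping `B` into itself with disjoint images, each
contracting by a factor between `exp (-hi)` and `exp (-lo)`. -/
structure IsFam (f : RSphere → RSphere) (B : Set RSphere) (n : ℕ) {ι : Type*}
    (ψ : ι → RSphere → RSphere) (lo hi : ℝ) : Prop where
  maps : ∀ i, MapsTo (ψ i) B B
  right_inv : ∀ i, ∀ x ∈ B, f^[n] (ψ i x) = x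
  scales : ∀ i, ScalesOn (ψ i) B (Real.exp (-hi)) (Real.exp (-lo))
  disj : ∀ i j, i ≠ j → ∀ x ∈ B, ∀ y ∈ B, ψ i x ≠ ψ j y

/-- Existence of a family of `N` inverse branches of `f^[n]`. -/
def HasFam (f : RSphere → RSphere) (B : Set RSphere) (n N : ℕ) (lo hi : ℝ) : Prop :=
  ∃ ψ : Fin N → RSphere → RSphere, IsFam f B n ψ lo hi

namespace IsFam

variable {f : RSphere → RSphere} {B : Set RSphere} {n n' : ℕ} {ι κ : Type*}
  {ψ : ι → RSphere → RSphere} {φ : κ → RSphere → RSphere} {lo hi lo' hi' : ℝ}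

lemma reindex (h : IsFam f B n ψ lo hi) {e : κ → ι} (he : Function.Injective e) :
    IsFam f B n (fun i => ψ (e i)) lo hi :=
  ⟨fun _ => h.maps _, fun _ => h.right_inv _, fun _ => h.scales _,
    fun _ _ hij => h.disj _ _ (he.ne hij)⟩

lemma hasFam [Fintype ι] (h : IsFam f B n ψ lo hi) {N : ℕ} (hN : N ≤ Fintype.card ι) :
    HasFam f B n N lo hi :=
  ⟨_, h.reindex (((Fintype.equivFin ι).symm.injective).comp (Fin.castLE_injective hN))⟩

lemma comp (h : IsFam f B n ψ lo hi) (h' : IsFam f B n' φ lo' hi') :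
    IsFam f B (n + n') (fun p : ι × κ => ψ p.1 ∘ φ p.2) (lo + lo') (hi + hi') := by
  refine ⟨fun p => (h.maps _).comp (h'.maps _), fun p x hx => ?_, fun p => ?_, fun p q hpq => ?_⟩
  · rw [add_comm, Function.iterate_add_apply, Function.comp_apply,
      h.right_inv _ _ (h'.maps _ hx), h'.right_inv _ _ hx]
  · refine ((h.scales p.1).comp (Real.exp_pos _).le (Real.exp_pos _).le (h'.scales p.2)
      (h'.maps _)).mono subset_rfl (le_of_eq ?_) (le_of_eq ?_)
    all_goals rw [← Real.exp_add, neg_add]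
  · intro x hx y hy heq
    by_cases h1 : p.1 = q.1
    · have h2 : p.2 ≠ q.2 := fun h2 => hpq (Prod.ext h1 h2)
      refine h'.disj _ _ h2 x hx y hy ?_
      rw [← h.right_inv p.1 _ (h'.maps p.2 hx), ← h.right_inv q.1 _ (h'.maps q.2 hy)]
      exact congrArg _ heq
    · exact h.disj _ _ h1 _ (h'.maps p.2 hx) _ (h'.maps q.2 hy) heq

end IsFam

namespace HasFam

variable {f : RSphere → RSphere} {B : Set RSphere} {n n' N N' : ℕ} {lo hi lo' hi' : ℝ}

lemma anti (h : HasFam f B n N lo hi) (hN : N' ≤ N) : HasFam f B n N' lo hi := by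
  obtain ⟨ψ, h⟩ := h
  exact h.hasFam (by simpa using hN)

lemma comp (h : HasFam f B n N lo hi) (h' : HasFam f B n' N' lo' hi') :
    HasFam f B (n + n') (N * N') (lo + lo') (hi + hi') := by
  obtain ⟨ψ, h⟩ := h
  obtain ⟨φ, h'⟩ := h'
  exact (h.comp h').hasFam (by simp)

lemma pow (h : HasFam f B n N lo hi) (k : ℕ) :
    HasFam f B (k * n) (N ^ k) (k * lo) (k * hi) := by
  induction k with
  | zero =>
    refine ⟨fun _ => id, fun _ x hx => hx, fun _ x _ => ?_, fun _ x _ y _ => by simp, ?_⟩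
    · rw [zero_mul]; rfl
    · intro i j hij
      have : Subsingleton (Fin (N ^ 0)) := by rw [pow_zero]; infer_instance
      exact absurd (Subsingleton.elim i j) hij
  | succ k ih =>
    have := ih.comp h
    rw [pow_succ, Nat.succ_mul]
    push_cast
    rwa [add_mul, add_mul, one_mul, one_mul]

end HasFam

/-- Existence of a family of inverse branches with contraction rate between `a` and `b` and
cardinality growth rate at least `h`. -/
def HasRate (f : RSphere → RSphere) (B : Set RSphere) (a b h : ℝ) : Prop :=
  ∃ n N : ℕ, 0 < n ∧ 0 < N ∧ HasFam f B n N (n * a) (n * b) ∧ n * h ≤ Real.log N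

namespace HasRate

variable {f : RSphere → RSphere} {B : Set RSphere} {a b h a' b' h' : ℝ}

lemma mix (hr : HasRate f B a b h) (hr' : HasRate f B a' b' h') {P Q : ℕ} (hPQ : 0 < P + Q) :
    HasRate f B ((P * a + Q * a') / (P + Q)) ((P * b + Q * b') / (P + Q))
      ((P * h + Q * h') / (P + Q)) := by
  obtain ⟨n, N, hn, hN, hf, hh⟩ := hr
  obtain ⟨n', N', hn', hN', hf', hh'⟩ := hr'
  have key : ∀ x y : ℝ, ((P * n' * n + Q * n * n' : ℕ) : ℝ) * ((P * x + Q * y) / (P + Q)) =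
      (P * n' : ℕ) * (n * x) + (Q * n : ℕ) * (n' * y) := by
    intro x y
    have : (P + Q : ℝ) ≠ 0 := by exact_mod_cast hPQ.ne'
    push_cast
    field_simp
  refine ⟨P * n' * n + Q * n * n', N ^ (P * n') * N' ^ (Q * n), ?_, by positivity, ?_, ?_⟩
  · have h1 : P * n' * n + Q * n * n' = (P + Q) * (n * n') := by ring
    rw [h1]; positivity
  · rw [key, key]
    exact (hf.pow _).comp (hf'.pow _)
  · rw [key]
    push_cast
    rw [Real.log_mul (by positivity) (by positivity), Real.log_pow, Real.log_pow]
    push_cast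
    gcongr

/-- Two families can be brought to the same time and cardinality. -/
lemma exists_pair (hr : HasRate f B a b h) (hr' : HasRate f B a' b' h') :
    ∃ n N : ℕ, 0 < n ∧ 0 < N ∧ HasFam f B n N (n * a) (n * b) ∧ HasFam f B n N (n * a') (n * b') ∧
      n * min h h' ≤ Real.log N := by
  obtain ⟨n, N, hn, hN, hf, hh⟩ := hr
  obtain ⟨n', N', hn', hN', hf', hh'⟩ := hr'
  refine ⟨n' * n, min (N ^ n') (N' ^ n), by positivity, lt_min (by positivity) (by positivity),
    ?_, ?_, ?_⟩
  · have := hf.pow n'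
    push_cast
    rw [mul_assoc, mul_assoc]
    exact this.anti (min_le_left _ _)
  · have := hf'.pow n
    rw [mul_comm n' n]
    push_cast
    rw [mul_assoc, mul_assoc]
    exact this.anti (min_le_right _ _)
  · have h1 : (n' * n : ℝ) * min h h' ≤ Real.log (N ^ n' : ℕ) := by
      push_cast
      rw [Real.log_pow, mul_assoc]
      refine mul_le_mul_of_nonneg_left (le_trans ?_ hh) (by positivity)
      exact mul_le_mul_of_nonneg_left (min_le_left _ _) (by positivity)
    have h2 : (n' * n : ℝ) * min h h' ≤ Real.log (N' ^ n : ℕ) := by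
      push_cast
      rw [Real.log_pow, mul_comm (n' : ℝ), mul_assoc]
      refine mul_le_mul_of_nonneg_left (le_trans ?_ hh') (by positivity)
      exact mul_le_mul_of_nonneg_left (min_le_right _ _) (by positivity)
    push_cast at h1 h2 ⊢
    rcases min_choice (N ^ n' : ℝ) (N' ^ n) with h3 | h3 <;> rw [h3]
    exacts [h1, h2]

end HasRate

/-- Nonempty compact forward invariant expanding subsets of the Julia set. -/
structure IsExpandingSet (f : RSphere → RSphere) (L : Set RSphere) : Prop where
  nonempty : L.Nonempty
  subset : L ⊆ juliaSet f
  isCompact : IsCompact L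
  image_eq : f '' L = L
  expanding : ExpandingOn f L

/-- No finite exceptional set meets the Julia set. -/
def NoJuliaExceptional (f : RSphere → RSphere) : Prop :=
  ∀ S : Set RSphere, S.Finite → S.Nonempty → f ⁻¹' S \ critSet f = S → S ∩ juliaSet f = ∅

lemma Finset.exists_pos_le_of_forall_pos {α : Type*} (t : Finset α) {r : α → ℝ}
    (h : ∀ i ∈ t, 0 < r i) : ∃ r₀ > 0, ∀ i ∈ t, r₀ ≤ r i := by
  induction t using Finset.cons_induction with
  | empty => exact ⟨1, one_pos, by simp⟩
  | cons a t ha ih =>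
    obtain ⟨r₀, h0, h1⟩ := ih fun i hi => h i (Finset.mem_cons_of_mem hi)
    refine ⟨min r₀ (r a), lt_min h0 (h a (Finset.mem_cons_self a t)), fun i hi => ?_⟩
    rcases Finset.mem_cons.1 hi with rfl | hi
    exacts [min_le_right _ _, (min_le_left _ _).trans (h1 i hi)]

namespace IsExpandingSet

variable {f : RSphere → RSphere} {L : Set RSphere}

lemma iterate_mem (hL : IsExpandingSet f L) {x : RSphere} (hx : x ∈ L) (n : ℕ) : f^[n] x ∈ L := by
  have : MapsTo f L L := fun y hy => hL.image_eq ▸ mem_image_of_mem f hy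
  exact this.iterate n hx

/-- Finitely many inverse branches join a ball around a given point to all points of `L`. -/
lemma exists_bridges_to (hL : IsExpandingSet f L) (hf : FinHol f) (hexc : NoJuliaExceptional f)
    {x₀ : RSphere} (hx₀ : x₀ ∈ L) {ρ : ℝ} (hρ : 0 < ρ) :
    ∃ (t : Finset RSphere) (m : RSphere → ℕ) (κ : RSphere → RSphere → RSphere), ∃ r₀ > 0, ∃ C ≥ 1,
      ∀ x ∈ L, ∃ b ∈ t, (∀ y ∈ closedBall x₀ r₀, κ b y ∈ ball x ρ ∧ f^[m b] (κ b y) = y) ∧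
        ScalesOn (κ b) (closedBall x₀ r₀) C⁻¹ C := by
  have loc : ∀ b ∈ L, ∃ m : ℕ, ∃ κ : RSphere → RSphere, ∃ r > 0, ∃ C ≥ 1,
      (∀ y ∈ closedBall x₀ r, κ y ∈ ball b (ρ / 2) ∧ f^[m] (κ y) = y) ∧
        ScalesOn κ (closedBall x₀ r) C⁻¹ C := by
    intro b hb
    obtain ⟨u, hu, m, hm, hm'⟩ := hf.exists_bridge_point hexc hL.subset hL.image_eq hL.expanding
      hx₀ hb (show (0 : ℝ) < ρ / 4 by positivity)
    obtain ⟨r, hr, C, hC, κ, h1, h2⟩ :=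
      (hf.iterate m).exists_local_inverse hm' (show (0 : ℝ) < ρ / 4 by positivity)
    rw [hm] at h1 h2
    refine ⟨m, κ, r, hr, C, hC, fun y hy => ⟨?_, (h1 y hy).2⟩, h2⟩
    refine ball_subset_ball' ?_ (h1 y hy).1
    have := mem_ball.1 hu
    linarith
  choose! m κ r hr C hC h1 h2 using loc
  obtain ⟨t, htL, ht⟩ := hL.isCompact.elim_nhds_subcover (fun b => ball b (ρ / 2))
    fun b _ => ball_mem_nhds b (half_pos hρ)
  obtain ⟨r₀, hr₀, hr₀'⟩ := t.exists_pos_le_of_forall_pos fun b hb => hr b (htL b hb)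
  obtain ⟨C₀, hC₀⟩ := (t.finite_toSet.image C).bddAbove
  refine ⟨t, m, κ, r₀, hr₀, max C₀ 1, le_max_right _ _, fun x hx => ?_⟩
  obtain ⟨b, hb, hxb⟩ := mem_iUnion₂.1 (ht hx)
  have hsub := closedBall_subset_closedBall (x := x₀) (hr₀' b hb)
  have hCb : C b ≤ max C₀ 1 := (hC₀ ⟨b, hb, rfl⟩).trans (le_max_left _ _)
  refine ⟨b, hb, fun y hy => ⟨?_, (h1 b (htL b hb) y (hsub hy)).2⟩, (h2 b (htL b hb)).mono hsub
    (inv_anti₀ (one_pos.trans_le (hC b (htL b hb))) hCb) hCb⟩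
  refine ball_subset_ball' ?_ (h1 b (htL b hb) y (hsub hy)).1
  have := mem_ball'.1 hxb
  linarith

/-- Finitely many inverse branches join balls around all points of `L` to a given ball. -/
lemma exists_bridges_from (hL : IsExpandingSet f L) (hf : FinHol f) (hexc : NoJuliaExceptional f)
    {x₀ : RSphere} (hx₀ : x₀ ∈ L) {ρ : ℝ} (hρ : 0 < ρ) :
    ∃ (t : Finset RSphere) (m : RSphere → ℕ) (κ : RSphere → RSphere → RSphere), ∃ r₀ > 0, ∃ C ≥ 1,
      ∀ x ∈ L, ∃ a ∈ t, (∀ y ∈ closedBall x r₀, κ a y ∈ ball x₀ ρ ∧ f^[m a] (κ a y) = y) ∧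
        ScalesOn (κ a) (closedBall x r₀) C⁻¹ C := by
  have loc : ∀ a ∈ L, ∃ m : ℕ, ∃ κ : RSphere → RSphere, ∃ r > 0, ∃ C ≥ 1,
      (∀ y ∈ closedBall a r, κ y ∈ ball x₀ ρ ∧ f^[m] (κ y) = y) ∧
        ScalesOn κ (closedBall a r) C⁻¹ C := by
    intro a ha
    obtain ⟨u, hu, m, hm, hm'⟩ := hf.exists_bridge_point hexc hL.subset hL.image_eq hL.expanding
      ha hx₀ (show (0 : ℝ) < ρ / 2 by positivity)
    obtain ⟨r, hr, C, hC, κ, h1, h2⟩ :=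
      (hf.iterate m).exists_local_inverse hm' (show (0 : ℝ) < ρ / 2 by positivity)
    rw [hm] at h1 h2
    refine ⟨m, κ, r, hr, C, hC, fun y hy => ⟨?_, (h1 y hy).2⟩, h2⟩
    refine ball_subset_ball' ?_ (h1 y hy).1
    have := mem_ball.1 hu
    linarith
  choose! m κ r hr C hC h1 h2 using loc
  obtain ⟨t, htL, ht⟩ := hL.isCompact.elim_nhds_subcover (fun a => ball a (r a / 2))
    fun a ha => ball_mem_nhds a (half_pos (hr a ha))
  obtain ⟨r₀, hr₀, hr₀'⟩ := t.exists_pos_le_of_forall_pos fun a ha => half_pos (hr a (htL a ha))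
  obtain ⟨C₀, hC₀⟩ := (t.finite_toSet.image C).bddAbove
  refine ⟨t, m, κ, r₀, hr₀, max C₀ 1, le_max_right _ _, fun x hx => ?_⟩
  obtain ⟨a, ha, hxa⟩ := mem_iUnion₂.1 (ht hx)
  have hsub : closedBall x r₀ ⊆ closedBall a (r a) := by
    refine closedBall_subset_closedBall' ?_
    have := mem_ball.1 hxa
    have := hr₀' a ha
    linarith
  have hCa : C a ≤ max C₀ 1 := (hC₀ ⟨a, ha, rfl⟩).trans (le_max_left _ _)
  exact ⟨a, ha, fun y hy => h1 a (htL a ha) y (hsub hy), (h2 a (htL a ha)).mono hsub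
    (inv_anti₀ (one_pos.trans_le (hC a (htL a ha))) hCa) hCa⟩

end IsExpandingSet

/-- The pair `(χ, h)` is realised by separated sets in `L` of growth rate `h` consisting of points
whose finite time exponents are close to `χ`. -/
def GrowthPoint (f : RSphere → RSphere) (L : Set RSphere) (ε₀ χ h : ℝ) : Prop :=
  ∀ ε > 0, ∃ᶠ n : ℕ in atTop, ∃ E : Finset RSphere, IsSepSet f L n ε₀ E ∧
    (∀ x ∈ E, Real.exp (n * (χ - ε)) ≤ sphDeriv f^[n] x ∧
      sphDeriv f^[n] x ≤ Real.exp (n * (χ + ε))) ∧ Real.exp (n * (h - ε)) ≤ E.card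

lemma GrowthPoint.mono {f : RSphere → RSphere} {L L' : Set RSphere} {ε₀ ε₀' χ h : ℝ}
    (hp : GrowthPoint f L ε₀ χ h) (hL : L ⊆ L') (hε : ε₀' ≤ ε₀) : GrowthPoint f L' ε₀' χ h := by
  refine fun ε hε0 => (hp ε hε0).mono ?_
  rintro n ⟨E, ⟨h1, h2⟩, h3⟩
  refine ⟨E, ⟨h1.trans hL, fun x hx y hy hxy => ?_⟩, h3⟩
  obtain ⟨k, hk, hk'⟩ := h2 x hx y hy hxy
  exact ⟨k, hk, hε.trans hk'⟩

lemma perfect_closure_ball (x : RSphere) (r : ℝ) : Perfect (closure (ball x r)) := by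
  have : Preperfect (univ : Set RSphere) := fun x _ => by
    rw [AccPt, principal_univ, inf_top_eq]
    infer_instance
  have h := this.open_inter (isOpen_ball (x := x) (ε := r))
  rw [inter_univ] at h
  exact h.perfect_closure

namespace IsExpandingSet

variable {f : RSphere → RSphere} {L : Set RSphere}

lemma exists_contraction (hL : IsExpandingSet f L) : ∃ η₀ > 0, ∀ η ≤ η₀, ∀ r > 0,
    ∀ᶠ n : ℕ in atTop, ∀ x ∈ L, (Real.exp (-(n * η)) * sphDeriv f^[n] x)⁻¹ ≤ r := by
  obtain ⟨c, hc, l, hl, h⟩ := hL.expanding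
  have hl0 : 0 < l := one_pos.trans hl
  have hlog := Real.log_pos hl
  refine ⟨Real.log l / 2, by positivity, fun η hη r hr => ?_⟩
  set θ := Real.exp (η - Real.log l) with hθ
  have hθ1 : θ < 1 := Real.exp_lt_one_iff.2 (by linarith)
  have hlim : Tendsto (fun n : ℕ => c⁻¹ * θ ^ n) atTop (𝓝 (c⁻¹ * 0)) :=
    (tendsto_pow_atTop_nhds_zero_of_lt_one (Real.exp_pos _).le hθ1).const_mul _
  rw [mul_zero] at hlim
  filter_upwards [hlim.eventually (gt_mem_nhds hr), eventually_ge_atTop 1] with n hn hn1 x hx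
  refine le_trans ?_ hn.le
  have h1 := h x hx n hn1
  have h2 : θ ^ n = Real.exp (n * η) / l ^ n := by
    rw [hθ, Real.exp_sub, Real.exp_log hl0, div_pow, ← Real.exp_nat_mul]
  rw [h2, mul_inv, ← Real.exp_neg, neg_neg, ← div_eq_mul_inv, inv_mul_eq_div, div_div, mul_comm _ c]
  gcongr

/-- Growth points of an expanding set yield families of inverse branches on a common ball. -/
lemma exists_hasRate (hL : IsExpandingSet f L) (hf : FinHol f) (hexc : NoJuliaExceptional f)
    {ε₀ ε : ℝ} (hε₀ : 0 < ε₀) (hε : 0 < ε) : ∃ x₀, ∃ r₀ > 0, ∀ χ h, GrowthPoint f L ε₀ χ h →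
      HasRate f (closure (ball x₀ r₀)) (χ - ε) (χ + ε) (h - ε) := by
  classical
  obtain ⟨η₀, hη₀, hcontr⟩ := hL.exists_contraction
  set η := min η₀ (ε / 4) with hη
  have hη0 : 0 < η := by positivity
  obtain ⟨r, hr, hshadow⟩ := hf.exists_shadowing hL.isCompact hL.image_eq hL.expanding hη0
    (show (0 : ℝ) < ε₀ / 4 by positivity)
  obtain ⟨x₀, hx₀⟩ := hL.nonempty
  obtain ⟨tb, mb, κb, r₀, hr₀, Cb, hCb, hb⟩ := hL.exists_bridges_to hf hexc hx₀ hr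
  obtain ⟨ta, ma, κa, r₁, hr₁, Ca, hCa, ha⟩ := hL.exists_bridges_from hf hexc hx₀ hr₀
  refine ⟨x₀, r₀, hr₀, fun χ h hg => ?_⟩
  have hBsub : closure (ball x₀ r₀) ⊆ closedBall x₀ r₀ := closure_ball_subset_closedBall
  obtain ⟨Mb, hMb⟩ := (tb.finite_toSet.image mb).bddAbove
  obtain ⟨Ma, hMa⟩ := (ta.finite_toSet.image ma).bddAbove
  set T : ℕ := (ta ×ˢ tb).card with hT
  set K : ℝ := Real.log Ca + Real.log Cb + (Ma + Mb) * (|χ| + |h| + ε) + |Real.log T| with hK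
  have hlarge : ∀ᶠ n : ℕ in atTop, K ≤ n * (ε / 2) := by
    have : Tendsto (fun n : ℕ => (n : ℝ) * (ε / 2)) atTop atTop :=
      tendsto_natCast_atTop_atTop.atTop_mul_const (by positivity)
    exact this.eventually_ge_atTop K
  obtain ⟨n, ⟨E, ⟨hEL, hEsep⟩, hEs, hEcard⟩, hnK, hn1, hnr⟩ :=
    ((hg (ε / 4) (by positivity)).and_eventually (hlarge.and ((eventually_ge_atTop 1).and
      (hcontr η (min_le_left _ _) (r₁ / r) (by positivity))))).exists
  have hsh := hshadow n
  choose! ψ hψ1 hψ2 hψ3 using hsh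
  choose! b hbt hb1 hb2 using hb
  choose! a hat ha1 ha2 using ha
  have hmaps : ∀ x ∈ E, (x ∈ L ∧ f^[n] x ∈ L) := fun x hx => ⟨hEL hx, hL.iterate_mem (hEL hx) n⟩
  have hE0 : 0 < (E.card : ℝ) := (Real.exp_pos _).trans_le hEcard
  have hEne : E.Nonempty := Finset.card_pos.1 (by exact_mod_cast hE0)
  obtain ⟨e, he⟩ := hEne
  have hTne : (ta ×ˢ tb).Nonempty :=
    ⟨(a e, b (f^[n] e)), Finset.mem_product.2 ⟨hat e (hmaps e he).1, hbt _ (hmaps e he).2⟩⟩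
  have hT0 : 0 < (T : ℝ) := by exact_mod_cast Finset.card_pos.2 hTne
  obtain ⟨⟨a', b'⟩, hab, hcard⟩ := Finset.exists_le_card_fiber_of_nsmul_le_card_of_maps_to
    (s := E) (t := ta ×ˢ tb) (f := fun x => (a x, b (f^[n] x))) (b := (E.card : ℝ) / T)
    (fun x hx => Finset.mem_product.2 ⟨hat x (hmaps x hx).1, hbt _ (hmaps x hx).2⟩) hTne
    (by rw [nsmul_eq_mul, ← hT]; field_simp; exact le_rfl)
  rw [Finset.mem_product] at hab
  set E' := E.filter fun x => (a x, b (f^[n] x)) = (a', b') with hE'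
  have hE'mem : ∀ x ∈ E', x ∈ E ∧ a x = a' ∧ b (f^[n] x) = b' := by
    intro x hx
    obtain ⟨h1, h2⟩ := Finset.mem_filter.1 hx
    exact ⟨h1, (Prod.ext_iff.1 h2).1, (Prod.ext_iff.1 h2).2⟩
  have hE'0 : 0 < (E'.card : ℝ) := (by positivity : 0 < (E.card : ℝ) / T).trans_le hcard
  have hmb : (mb b' : ℝ) ≤ Mb := by exact_mod_cast hMb ⟨b', hab.2, rfl⟩
  have hma : (ma a' : ℝ) ≤ Ma := by exact_mod_cast hMa ⟨a', hab.1, rfl⟩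
  set N := ma a' + (n + mb b') with hN
  have hNcast : (N : ℝ) = n + (ma a' + mb b') := by rw [hN]; push_cast; ring
  have hm0 : (0 : ℝ) ≤ ma a' + mb b' := by positivity
  have hmM : (ma a' + mb b' : ℝ) ≤ Ma + Mb := add_le_add hma hmb
  have hprod : ∀ u : ℝ, u ≤ |χ| + |h| + ε →
      (ma a' + mb b' : ℝ) * u ≤ (Ma + Mb) * (|χ| + |h| + ε) := fun u hu =>
    (mul_le_mul_of_nonneg_left hu hm0).trans (mul_le_mul_of_nonneg_right hmM (by positivity))
  have hlogCa := Real.log_nonneg hCa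
  have hlogCb := Real.log_nonneg hCb
  have hlogT := le_abs_self (Real.log T)
  have hlogT' := abs_nonneg (Real.log T)
  have hη4 : n * η ≤ n * (ε / 4) := by gcongr; exact min_le_right _ _
  have hmap_b : ∀ x ∈ E', MapsTo (κb b') (closure (ball x₀ r₀)) (closedBall (f^[n] x) r) := by
    intro x hx y hy
    obtain ⟨h1, h2, h3⟩ := hE'mem x hx
    exact ball_subset_closedBall (h3 ▸ (hb1 _ (hmaps x h1).2 y (hBsub hy)).1)
  have hmap_orbit : ∀ x ∈ E', MapsTo (ψ x) (closedBall (f^[n] x) r) (closedBall x r₁) := by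
    intro x hx y hy
    obtain ⟨h1, h2, h3⟩ := hE'mem x hx
    have h4 := (hψ3 x (hmaps x h1).1 y hy _ (mem_closedBall_self hr.le)).2
    rw [hψ1 x (hmaps x h1).1] at h4
    rw [mem_closedBall]
    refine h4.trans ?_
    calc _ ≤ r₁ / r * r :=
          mul_le_mul (hnr x (hmaps x h1).1) (mem_closedBall.1 hy) dist_nonneg (by positivity)
      _ = r₁ := by field_simp
  have hκa : ∀ x ∈ E', ∀ y ∈ closedBall x r₁, κa a' y ∈ ball x₀ r₀ ∧ f^[ma a'] (κa a' y) = y := by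
    intro x hx
    obtain ⟨h1, h2, h3⟩ := hE'mem x hx
    exact h2 ▸ ha1 x (hmaps x h1).1
  have hκb : ∀ y ∈ closure (ball x₀ r₀), f^[mb b'] (κb b' y) = y := by
    obtain ⟨x, hx⟩ := Finset.card_pos.1 (by exact_mod_cast hE'0 : 0 < E'.card)
    obtain ⟨h1, h2, h3⟩ := hE'mem x hx
    intro y hy
    exact h3 ▸ (hb1 _ (hmaps x h1).2 y (hBsub hy)).2
  have hfam : IsFam f (closure (ball x₀ r₀)) N
      (fun x : E' => κa a' ∘ (ψ x.1 ∘ κb b')) (N * (χ - ε)) (N * (χ + ε)) := by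
    refine ⟨?_, ?_, ?_, ?_⟩
    · rintro ⟨x, hx⟩ y hy
      exact subset_closure (hκa x hx _ (hmap_orbit x hx (hmap_b x hx hy))).1
    · rintro ⟨x, hx⟩ y hy
      rw [hN, add_comm, Function.iterate_add_apply, Function.comp_apply, Function.comp_apply,
        (hκa x hx _ (hmap_orbit x hx (hmap_b x hx hy))).2, add_comm, Function.iterate_add_apply,
        (hψ2 x (hmaps x (hE'mem x hx).1).1 _ (hmap_b x hx hy)).1, hκb y hy]
    · rintro ⟨x, hx⟩
      obtain ⟨h1, h2, h3⟩ := hE'mem x hx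
      have hs := hEs x h1
      have hs0 : 0 < sphDeriv f^[n] x := (Real.exp_pos _).trans_le hs.1
      have sa := ha2 x (hmaps x h1).1
      rw [h2] at sa
      have sb := (hb2 _ (hmaps x h1).2).mono hBsub le_rfl le_rfl
      rw [h3] at sb
      refine (sa.comp (by positivity) (by positivity) ((hψ3 x (hmaps x h1).1).comp (by positivity)
        (by positivity) sb (hmap_b x hx)) ((hmap_orbit x hx).comp (hmap_b x hx))).mono subset_rfl ?_ ?_
      · rw [← mul_inv, ← mul_inv, Real.exp_neg]
        refine inv_anti₀ (by positivity) ?_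
        rw [← Real.exp_log (show 0 < Ca by linarith), ← Real.exp_log (show 0 < Cb by linarith)]
        calc _ ≤ Real.exp (Real.log Ca) * (Real.exp (n * η) * Real.exp (n * (χ + ε / 4)) *
              Real.exp (Real.log Cb)) := by gcongr; exact hs.2
          _ ≤ _ := by
            rw [← Real.exp_add, ← Real.exp_add, ← Real.exp_add]
            refine Real.exp_le_exp.2 ?_
            have := hprod (-χ - ε) (by linarith [neg_abs_le χ, abs_nonneg h])
            rw [hNcast]
            linarith
      · rw [Real.exp_neg (N * (χ - ε))]
        rw [← Real.exp_log (show 0 < Ca by linarith), ← Real.exp_log (show 0 < Cb by linarith)]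
        calc _ ≤ Real.exp (Real.log Ca) * ((Real.exp (-(n * η)) * Real.exp (n * (χ - ε / 4)))⁻¹ *
              Real.exp (Real.log Cb)) := by gcongr; exact hs.1
          _ ≤ _ := by
            rw [← Real.exp_add, ← Real.exp_neg, ← Real.exp_neg, ← Real.exp_add, ← Real.exp_add]
            refine Real.exp_le_exp.2 ?_
            have := hprod (χ - ε) (by linarith [le_abs_self χ, abs_nonneg h])
            rw [hNcast]
            linarith
    · rintro ⟨x, hx⟩ ⟨x', hx'⟩ hne y hy y' hy' heq
      have hxx : x ≠ x' := fun h => hne (Subtype.ext h)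
      have h4 := hmap_b x hx hy
      have h5 := hmap_b x' hx' hy'
      have h6 : ψ x (κb b' y) = ψ x' (κb b' y') := by
        rw [← (hκa x hx _ (hmap_orbit x hx h4)).2, ← (hκa x' hx' _ (hmap_orbit x' hx' h5)).2]
        exact congrArg _ heq
      obtain ⟨k, hk, hk'⟩ := hEsep x (hE'mem x hx).1 x' (hE'mem x' hx').1 hxx
      have h7 := (hψ2 x (hmaps x (hE'mem x hx).1).1 _ h4).2 k hk.le
      have h8 := (hψ2 x' (hmaps x' (hE'mem x' hx').1).1 _ h5).2 k hk.le
      rw [← h6] at h8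
      have := dist_triangle_left (f^[k] x) (f^[k] x') (f^[k] (ψ x (κb b' y)))
      linarith
  refine ⟨N, E'.card, by omega, by exact_mod_cast hE'0, hfam.hasFam (by simp), ?_⟩
  have h1 : Real.log (E.card / T) ≤ Real.log E'.card := Real.log_le_log (by positivity) hcard
  rw [Real.log_div hE0.ne' hT0.ne'] at h1
  have h2 : n * (h - ε / 4) ≤ Real.log E.card := (Real.le_log_iff_exp_le hE0).2 hEcard
  have := hprod (h - ε) (by linarith [le_abs_self h, abs_nonneg χ])
  rw [hNcast]
  have hnε : 0 ≤ n * ε := by positivity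
  linarith

end IsExpandingSet

lemma ScalesOn.continuousOn {g : RSphere → RSphere} {S : Set RSphere} {lo hi : ℝ}
    (h : ScalesOn g S lo hi) (hhi : 0 ≤ hi) : ContinuousOn g S := by
  have : LipschitzOnWith ⟨hi, hhi⟩ g S :=
    LipschitzOnWith.of_dist_le_mul fun y hy y' hy' => (h y hy y' hy').2
  exact this.continuousOn

/-- The derivative of a map along a scaling inverse branch. -/
lemma SHol.sphDeriv_inverse_bounds {g κ : RSphere → RSphere} (hg : SHol g) {B : Set RSphere}
    {lo hi : ℝ} (hlo : 0 < lo) (hhi : 0 < hi) (hκ : ScalesOn κ B lo hi)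
    (hinv : ∀ y ∈ B, g (κ y) = y) (hB : Preperfect B) {y : RSphere} (hy : y ∈ B) :
    hi⁻¹ ≤ sphDeriv g (κ y) ∧ sphDeriv g (κ y) ≤ lo⁻¹ := by
  have key : ∀ ε > 0, ∃ y' ∈ B, y' ≠ y ∧
      |dist (g (κ y')) (g (κ y)) - sphDeriv g (κ y) * dist (κ y') (κ y)| ≤
        ε * dist (κ y') (κ y) := by
    intro ε hε
    have h1 := hg.hasScaling (κ y) ε hε
    have h2 : Tendsto (fun y' => (κ y', κ y)) (𝓝[B] y) (𝓝 (κ y, κ y)) :=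
      ((hκ.continuousOn hhi.le) y hy).prodMk_nhds tendsto_const_nhds
    have h3 := h2.eventually h1
    rw [eventually_nhdsWithin_iff] at h3
    obtain ⟨y', ⟨hne, hyB⟩, h4⟩ := ((accPt_iff_frequently.1 (hB y hy)).and_eventually h3).exists
    exact ⟨y', hyB, hne, h4 hyB⟩
  constructor
  · refine le_of_forall_pos_le_add fun ε hε => ?_
    obtain ⟨y', hy', hne, h⟩ := key ε hε
    rw [hinv y hy, hinv y' hy'] at h
    have h1 := (hκ y' hy' y hy).2
    have hd := dist_pos.2 hne
    have h2 : dist y' y ≤ (sphDeriv g (κ y) + ε) * (hi * dist y' y) := by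
      refine le_trans ?_ (mul_le_mul_of_nonneg_left h1 ?_)
      · linarith [(abs_le.1 h).2]
      · linarith [hg.sphDeriv_nonneg (κ y)]
    rw [← mul_assoc] at h2
    rw [inv_le_iff_one_le_mul₀ hhi]
    exact le_of_mul_le_mul_right (by linarith) hd
  · refine le_of_forall_pos_le_add fun ε hε => ?_
    obtain ⟨y', hy', hne, h⟩ := key ε hε
    rw [hinv y hy, hinv y' hy'] at h
    have h1 := (hκ y' hy' y hy).1
    have hd := dist_pos.2 hne
    have hd' : 0 < dist (κ y') (κ y) := (by positivity : 0 < lo * dist y' y).trans_le h1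
    have h2 : dist y' y ≤ lo⁻¹ * dist (κ y') (κ y) := (le_inv_mul_iff₀ hlo).2 h1
    refine le_of_mul_le_mul_right (a := dist (κ y') (κ y)) ?_ hd'
    linarith [(abs_le.1 h).1]

lemma IsCompact.exists_abs_sub_le {K : Set RSphere} (hK : IsCompact K) {g : RSphere → ℝ}
    (hg : ContinuousOn g K) {ε : ℝ} (hε : 0 < ε) :
    ∃ C ≥ 0, ∀ u ∈ K, ∀ v ∈ K, |g u - g v| ≤ ε + C * dist u v := by
  obtain ⟨δ, hδ, h⟩ := Metric.uniformContinuousOn_iff.1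
    (hK.uniformContinuousOn_of_continuous hg) ε hε
  obtain ⟨M, hM⟩ := hK.exists_bound_of_continuousOn hg
  refine ⟨2 * |M| / δ, by positivity, fun u hu v hv => ?_⟩
  rcases lt_or_ge (dist u v) δ with hlt | hge
  · have := h u hu v hv hlt
    rw [Real.dist_eq] at this
    have : 0 ≤ 2 * |M| / δ * dist u v := by positivity
    linarith
  · have h1 : 2 * |M| ≤ 2 * |M| / δ * dist u v := by
      rw [div_mul_eq_mul_div, le_div_iff₀ hδ]
      gcongr
    have h2 := hM u hu
    have h3 := hM v hv
    rw [Real.norm_eq_abs] at h2 h3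
    have := abs_sub (g u) (g v)
    have := le_abs_self M
    linarith

open Classical in
/-- The type of inverse branch used next, so as to keep the exponent close to the target `α`. -/
noncomputable def greedyType (f : RSphere → RSphere) (n : ℕ) (α : ℝ) (x₀ : RSphere) (k : ℕ)
    (g : RSphere → RSphere) : Bool :=
  decide (Real.log (sphDeriv f^[n * k] (g x₀)) ≤ n * α * k)

/-- The composition of inverse branches along a sequence of symbols, the types of which are
chosen greedily. -/
noncomputable def greedyBranch {N : ℕ} (f : RSphere → RSphere) (n : ℕ) (α : ℝ) (x₀ : RSphere)
    (ψ : Bool → Fin N → RSphere → RSphere) (i : ℕ → Fin N) : ℕ → RSphere → RSphere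
  | 0 => id
  | k + 1 => greedyBranch f n α x₀ ψ i k ∘
      ψ (greedyType f n α x₀ k (greedyBranch f n α x₀ ψ i k)) (i k)

/-- Two families of inverse branches of the same iterate, contracting respectively less and more
than the rate `α`. -/
structure IsGreedy {N : ℕ} (f : RSphere → RSphere) (B : Set RSphere) (n : ℕ) (α : ℝ)
    (x₀ : RSphere) (ψ : Bool → Fin N → RSphere → RSphere) (lo hi : Bool → ℝ) : Prop where
  finHol : FinHol f
  n_pos : 0 < n
  isCompact : IsCompact B
  preperfect : Preperfect B
  mem : x₀ ∈ B
  fam : ∀ t, IsFam f B n (ψ t) (lo t) (hi t)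
  lo_pos : ∀ t, 0 < lo t
  hi_lt : hi false < n * α
  lt_lo : n * α < lo true

namespace IsGreedy

variable {N : ℕ} {f : RSphere → RSphere} {B : Set RSphere} {n : ℕ} {α : ℝ} {x₀ : RSphere}
  {ψ : Bool → Fin N → RSphere → RSphere} {lo hi : Bool → ℝ}

lemma deriv_bounds (h : IsGreedy f B n α x₀ ψ lo hi) (t : Bool) (a : Fin N) {y : RSphere}
    (hy : y ∈ B) : Real.exp (lo t) ≤ sphDeriv f^[n] (ψ t a y) ∧
      sphDeriv f^[n] (ψ t a y) ≤ Real.exp (hi t) := by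
  have := (h.finHol.hol.iterate n).sphDeriv_inverse_bounds (Real.exp_pos _) (Real.exp_pos _)
    ((h.fam t).scales a) ((h.fam t).right_inv a) h.preperfect hy
  rwa [← Real.exp_neg, ← Real.exp_neg, neg_neg, neg_neg] at this

lemma log_deriv_bounds (h : IsGreedy f B n α x₀ ψ lo hi) (t : Bool) (a : Fin N) {y : RSphere}
    (hy : y ∈ B) : lo t ≤ Real.log (sphDeriv f^[n] (ψ t a y)) ∧
      Real.log (sphDeriv f^[n] (ψ t a y)) ≤ hi t := by
  obtain ⟨h1, h2⟩ := h.deriv_bounds t a hy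
  have hp := (Real.exp_pos _).trans_le h1
  exact ⟨(Real.le_log_iff_exp_le hp).2 h1, (Real.log_le_iff_le_exp hp).2 h2⟩

lemma lo_le_hi (h : IsGreedy f B n α x₀ ψ lo hi) (hN : 0 < N) (t : Bool) : lo t ≤ hi t :=
  (h.log_deriv_bounds t ⟨0, hN⟩ h.mem).1.trans (h.log_deriv_bounds t ⟨0, hN⟩ h.mem).2

lemma branch_right_inv (h : IsGreedy f B n α x₀ ψ lo hi) (i : ℕ → Fin N) (k : ℕ) {y : RSphere}
    (hy : y ∈ B) : f^[n * k] (greedyBranch f n α x₀ ψ i k y) = y := by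
  induction k generalizing y with
  | zero => rfl
  | succ k ih =>
    rw [Nat.mul_succ, add_comm, Function.iterate_add_apply, greedyBranch, Function.comp_apply,
      ih ((h.fam _).maps _ hy), (h.fam _).right_inv _ _ hy]

lemma branch_scales (h : IsGreedy f B n α x₀ ψ lo hi) (i : ℕ → Fin N) (k : ℕ) :
    ScalesOn (greedyBranch f n α x₀ ψ i k) B (Real.exp (-(k * max (hi false) (hi true))))
      (Real.exp (-(k * min (lo false) (lo true)))) := by
  induction k with
  | zero => intro y _ y' _; simp [greedyBranch]
  | succ k ih =>
    refine (ih.comp (Real.exp_pos _).le (Real.exp_pos _).le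
      ((h.fam _).scales _) ((h.fam _).maps _)).mono subset_rfl ?_ ?_
    all_goals
      rw [← Real.exp_add]
      refine Real.exp_le_exp.2 ?_
      push_cast
    · cases greedyType f n α x₀ k (greedyBranch f n α x₀ ψ i k)
      · linarith [le_max_left (hi false) (hi true)]
      · linarith [le_max_right (hi false) (hi true)]
    · cases greedyType f n α x₀ k (greedyBranch f n α x₀ ψ i k)
      · linarith [min_le_left (lo false) (lo true)]
      · linarith [min_le_right (lo false) (lo true)]

lemma branch_deriv_pos (h : IsGreedy f B n α x₀ ψ lo hi) (i : ℕ → Fin N) (k : ℕ) {y : RSphere}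
    (hy : y ∈ B) : 0 < sphDeriv f^[n * k] (greedyBranch f n α x₀ ψ i k y) := by
  have := (h.finHol.hol.iterate (n * k)).sphDeriv_inverse_bounds (Real.exp_pos _)
    (Real.exp_pos _) (h.branch_scales i k) (fun y hy => h.branch_right_inv i k hy) h.preperfect hy
  exact (by positivity : (0 : ℝ) < _).trans_le this.1

lemma log_branch_succ (h : IsGreedy f B n α x₀ ψ lo hi) (i : ℕ → Fin N) (k : ℕ) {y : RSphere}
    (hy : y ∈ B) {t : Bool} (ht : t = greedyType f n α x₀ k (greedyBranch f n α x₀ ψ i k)) :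
    Real.log (sphDeriv f^[n * (k + 1)] (greedyBranch f n α x₀ ψ i (k + 1) y)) =
      Real.log (sphDeriv f^[n] (ψ t (i k) y)) +
        Real.log (sphDeriv f^[n * k] (greedyBranch f n α x₀ ψ i k (ψ t (i k) y))) := by
  have hy' := (h.fam t).maps (i k) hy
  rw [Nat.mul_succ, add_comm (n * k), h.finHol.hol.sphDeriv_iterate_add, greedyBranch,
    Function.comp_apply, ← ht, h.branch_right_inv i k hy', Real.log_mul]
  · exact ((Real.exp_pos _).trans_le (h.deriv_bounds t (i k) hy).1).ne'
  · exact (h.branch_deriv_pos i k hy').ne'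

lemma exists_distortion (h : IsGreedy f B n α x₀ ψ lo hi) {ε : ℝ} (hε : 0 < ε) :
    ∃ C ≥ 0, ∀ (i : ℕ → Fin N) (k : ℕ), ∀ y ∈ B, ∀ y' ∈ B,
      |Real.log (sphDeriv f^[n * k] (greedyBranch f n α x₀ ψ i k y)) -
        Real.log (sphDeriv f^[n * k] (greedyBranch f n α x₀ ψ i k y'))| ≤ ε * k + C := by
  set K : Set RSphere := ⋃ t, ⋃ a, ψ t a '' B with hK
  have hKc : IsCompact K := isCompact_iUnion fun t => isCompact_iUnion fun a =>
    h.isCompact.image_of_continuousOn (((h.fam t).scales a).continuousOn (Real.exp_pos _).le)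
  have hmem : ∀ t a, ∀ y ∈ B, ψ t a y ∈ K := fun t a y hy =>
    mem_iUnion.2 ⟨t, mem_iUnion.2 ⟨a, y, hy, rfl⟩⟩
  have hcont : ContinuousOn (fun u => Real.log (sphDeriv f^[n] u)) K := by
    refine ((h.finHol.hol.iterate n).continuous_sphDeriv.continuousOn).log fun u hu => ?_
    obtain ⟨t, hu⟩ := mem_iUnion.1 hu
    obtain ⟨a, y, hy, rfl⟩ := mem_iUnion.1 hu
    exact ((Real.exp_pos _).trans_le (h.deriv_bounds t a hy).1).ne'
  obtain ⟨C, hC, hg⟩ := hKc.exists_abs_sub_le hcont hε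
  set q := Real.exp (-min (lo false) (lo true)) with hq
  have hq1 : q < 1 := Real.exp_lt_one_iff.2 (neg_lt_zero.2 (lt_min (h.lo_pos _) (h.lo_pos _)))
  have hq0 : 0 < q := Real.exp_pos _
  obtain ⟨D, hD⟩ := exists_dist_le
  have hD0 : 0 ≤ D := dist_nonneg.trans (hD x₀ x₀)
  set C' := C * q / (1 - q) with hC'
  have h1q : 0 < 1 - q := by linarith
  have hC'0 : 0 ≤ C' := by positivity
  have hCq : (C + C') * q = C' := by rw [hC']; field_simp; ring
  refine ⟨C' * D, by positivity, fun i k => ?_⟩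
  suffices H : ∀ y ∈ B, ∀ y' ∈ B,
      |Real.log (sphDeriv f^[n * k] (greedyBranch f n α x₀ ψ i k y)) -
        Real.log (sphDeriv f^[n * k] (greedyBranch f n α x₀ ψ i k y'))| ≤ ε * k + C' * dist y y' by
    intro y hy y' hy'
    refine (H y hy y' hy').trans ?_
    gcongr
    exact hD _ _
  induction k with
  | zero =>
    intro y _ y' _
    simp only [Nat.mul_zero, Function.iterate_zero, sphDeriv_id, sub_self, abs_zero]
    positivity
  | succ k ih =>
    intro y hy y' hy'
    set t := greedyType f n α x₀ k (greedyBranch f n α x₀ ψ i k) with ht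
    rw [h.log_branch_succ i k hy ht, h.log_branch_succ i k hy' ht]
    have h1 := hg _ (hmem t (i k) y hy) _ (hmem t (i k) y' hy')
    have h2 := ih _ ((h.fam t).maps (i k) hy) _ ((h.fam t).maps (i k) hy')
    have h3 : dist (ψ t (i k) y) (ψ t (i k) y') ≤ q * dist y y' := by
      refine (((h.fam t).scales (i k)) y hy y' hy').2.trans ?_
      refine mul_le_mul_of_nonneg_right (Real.exp_le_exp.2 (neg_le_neg ?_)) dist_nonneg
      cases t
      exacts [min_le_left _ _, min_le_right _ _]
    have h4 : (C + C') * dist (ψ t (i k) y) (ψ t (i k) y') ≤ C' * dist y y' := by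
      calc _ ≤ (C + C') * (q * dist y y') := by gcongr
        _ = ((C + C') * q) * dist y y' := by ring
        _ = _ := by rw [hCq]
    push_cast
    rw [abs_le] at *
    constructor <;> linarith [h1.1, h1.2, h2.1, h2.2]

end IsGreedy

lemma greedyBranch_congr {N : ℕ} {f : RSphere → RSphere} {n : ℕ} {α : ℝ} {x₀ : RSphere}
    {ψ : Bool → Fin N → RSphere → RSphere} {i j : ℕ → Fin N} {k : ℕ}
    (h : ∀ m < k, i m = j m) :
    greedyBranch f n α x₀ ψ i k = greedyBranch f n α x₀ ψ j k := by
  induction k with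
  | zero => rfl
  | succ k ih =>
    rw [greedyBranch, greedyBranch, ih fun m hm => h m (hm.trans k.lt_succ_self),
      h k k.lt_succ_self]

namespace IsGreedy

variable {N : ℕ} {f : RSphere → RSphere} {B : Set RSphere} {n : ℕ} {α : ℝ} {x₀ : RSphere}
  {ψ : Bool → Fin N → RSphere → RSphere} {lo hi : Bool → ℝ}

lemma continuousOn_branch (h : IsGreedy f B n α x₀ ψ lo hi) (i : ℕ → Fin N) (k : ℕ) :
    ContinuousOn (greedyBranch f n α x₀ ψ i k) B :=
  (h.branch_scales i k).continuousOn (Real.exp_pos _).le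

lemma exists_limit (h : IsGreedy f B n α x₀ ψ lo hi) (i : ℕ → Fin N) :
    ∃ x, ∀ k, x ∈ greedyBranch f n α x₀ ψ i k '' B := by
  have hc : ∀ k, IsCompact (greedyBranch f n α x₀ ψ i k '' B) := fun k =>
    h.isCompact.image_of_continuousOn (h.continuousOn_branch i k)
  have := IsCompact.nonempty_iInter_of_sequence_nonempty_isCompact_isClosed
    (fun k => greedyBranch f n α x₀ ψ i k '' B)
    (fun k => by
      rintro _ ⟨y, hy, rfl⟩
      exact ⟨_, (h.fam _).maps _ hy, rfl⟩)
    (fun k => ⟨_, x₀, h.mem, rfl⟩) (hc 0) (fun k => (hc k).isClosed)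
  obtain ⟨x, hx⟩ := this
  exact ⟨x, fun k => mem_iInter.1 hx k⟩

/-- The points coded by a symbol sequence. -/
def IsLimit (f : RSphere → RSphere) (B : Set RSphere) (n : ℕ) (α : ℝ) (x₀ : RSphere)
    (ψ : Bool → Fin N → RSphere → RSphere) (i : ℕ → Fin N) (x : RSphere) : Prop :=
  ∀ k, x ∈ greedyBranch f n α x₀ ψ i k '' B

lemma IsLimit.iterate_mem (h : IsGreedy f B n α x₀ ψ lo hi) {i : ℕ → Fin N} {x : RSphere}
    (hx : IsLimit f B n α x₀ ψ i x) (k : ℕ) :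
    f^[n * k] x ∈ B ∧ greedyBranch f n α x₀ ψ i k (f^[n * k] x) = x := by
  obtain ⟨y, hy, rfl⟩ := hx k
  rw [h.branch_right_inv i k hy]
  exact ⟨hy, rfl⟩

lemma IsLimit.iterate_eq (h : IsGreedy f B n α x₀ ψ lo hi) {i : ℕ → Fin N} {x : RSphere}
    (hx : IsLimit f B n α x₀ ψ i x) (k : ℕ) :
    f^[n * k] x = ψ (greedyType f n α x₀ k (greedyBranch f n α x₀ ψ i k)) (i k)
      (f^[n * (k + 1)] x) := by
  obtain ⟨hy, hyx⟩ := hx.iterate_mem h (k + 1)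
  conv_lhs => rw [← hyx]
  rw [greedyBranch, Function.comp_apply, h.branch_right_inv i k ((h.fam _).maps _ hy)]

lemma exists_min_dist (h : IsGreedy f B n α x₀ ψ lo hi) :
    ∃ δ > 0, ∀ t a b, a ≠ b → ∀ y ∈ B, ∀ y' ∈ B, δ ≤ dist (ψ t a y) (ψ t b y') := by
  have key : ∀ p : {p : Bool × Fin N × Fin N // p.2.1 ≠ p.2.2}, ∃ δ > 0,
      ∀ y ∈ B, ∀ y' ∈ B, δ ≤ dist (ψ p.1.1 p.1.2.1 y) (ψ p.1.1 p.1.2.2 y') := by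
    rintro ⟨⟨t, a, b⟩, hab⟩
    have hc : ∀ a, IsCompact (ψ t a '' B) := fun a =>
      h.isCompact.image_of_continuousOn (((h.fam t).scales a).continuousOn (Real.exp_pos _).le)
    have hd : Disjoint (ψ t a '' B) (ψ t b '' B) := by
      rw [Set.disjoint_left]
      rintro _ ⟨y, hy, rfl⟩ ⟨y', hy', he⟩
      exact (h.fam t).disj a b hab y hy y' hy' he.symm
    obtain ⟨δ, hδ, hh⟩ := hd.exists_thickenings (hc a) (hc b).isClosed
    refine ⟨δ, hδ, fun y hy y' hy' => ?_⟩
    by_contra! hlt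
    refine Set.disjoint_left.1 hh (Metric.self_subset_thickening hδ _ ⟨y, hy, rfl⟩) ?_
    exact Metric.mem_thickening_iff.2 ⟨_, ⟨y', hy', rfl⟩, hlt⟩
  choose δ hδ hh using key
  obtain ⟨d, hd, hle⟩ := Finset.exists_pos_le_of_forall_pos (r := δ) Finset.univ fun p _ => hδ p
  exact ⟨d, hd, fun t a b hab y hy y' hy' =>
    (hle ⟨(t, a, b), hab⟩ (Finset.mem_univ _)).trans (hh ⟨(t, a, b), hab⟩ y hy y' hy')⟩

lemma exists_le_dist (h : IsGreedy f B n α x₀ ψ lo hi) :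
    ∃ δ > 0, ∀ (i j : ℕ → Fin N) (x x' : RSphere) (k : ℕ), IsLimit f B n α x₀ ψ i x →
      IsLimit f B n α x₀ ψ j x' → (∀ m < k, i m = j m) → i k ≠ j k →
      δ * Real.exp (-(k * max (hi false) (hi true))) ≤ dist x x' := by
  obtain ⟨δ, hδ, hh⟩ := h.exists_min_dist
  refine ⟨δ, hδ, fun i j x x' k hx hx' hij hk => ?_⟩
  obtain ⟨y, hy, rfl⟩ := hx (k + 1)
  obtain ⟨y', hy', rfl⟩ := hx' (k + 1)
  simp only [greedyBranch, ← greedyBranch_congr hij, Function.comp_apply]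
  set t := greedyType f n α x₀ k (greedyBranch f n α x₀ ψ i k)
  refine le_trans ?_ (h.branch_scales i k _ ((h.fam t).maps _ hy) _ ((h.fam t).maps _ hy')).1
  rw [mul_comm]
  gcongr
  exact hh t _ _ hk y hy y' hy'

lemma mem_juliaSet (h : IsGreedy f B n α x₀ ψ lo hi) {i : ℕ → Fin N}
    {x : RSphere} (hx : IsLimit f B n α x₀ ψ i x) : x ∈ juliaSet f := by
  rintro ⟨U, hU, hxU, heq⟩
  obtain ⟨y₀, hy₀, hne⟩ : ∃ y₀ ∈ B, y₀ ≠ x₀ := by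
    obtain ⟨y', hne, hy'⟩ := (accPt_iff_frequently.1 (h.preperfect x₀ h.mem)).exists
    exact ⟨y', hy', hne⟩
  have hd := dist_pos.2 hne
  have h2 := heq x hxU _ (Metric.dist_mem_uniformity (ε := dist y₀ x₀ / 2) (by positivity))
  rw [hU.nhdsWithin_eq hxU] at h2
  obtain ⟨r, hr, h3⟩ := Metric.eventually_nhds_iff.1 h2
  obtain ⟨D, hD⟩ := exists_dist_le
  have hD0 : 0 ≤ D := dist_nonneg.trans (hD x₀ x₀)
  set l := min (lo false) (lo true) with hl
  have hl0 : 0 < l := lt_min (h.lo_pos _) (h.lo_pos _)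
  obtain ⟨k, hk⟩ : ∃ k : ℕ, Real.exp (-(k * l)) * D < r := by
    have : Tendsto (fun k : ℕ => Real.exp (-(k * l)) * D) atTop (𝓝 (0 * D)) := by
      refine Tendsto.mul_const _ (Real.tendsto_exp_neg_atTop_nhds_zero.comp ?_)
      exact tendsto_natCast_atTop_atTop.atTop_mul_const hl0
    rw [zero_mul] at this
    exact (this.eventually (gt_mem_nhds hr)).exists
  have h4 : ∀ y ∈ B, dist (f^[n * k] x) y < dist y₀ x₀ / 2 := by
    intro y hy
    obtain ⟨hxB, hxx⟩ := hx.iterate_mem h k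
    have h5 : dist (greedyBranch f n α x₀ ψ i k y) x < r := by
      refine lt_of_le_of_lt ?_ hk
      conv_lhs => rw [← hxx]
      refine (h.branch_scales i k y hy _ hxB).2.trans ?_
      gcongr
      exact hD _ _
    have : dist (f^[n * k] x) (f^[n * k] (greedyBranch f n α x₀ ψ i k y)) < dist y₀ x₀ / 2 :=
      h3 h5 (n * k)
    rwa [h.branch_right_inv i k hy] at this
  have := dist_triangle_left y₀ x₀ (f^[n * k] x)
  linarith [h4 y₀ hy₀, h4 x₀ h.mem]

end IsGreedy

namespace IsGreedy

variable {N : ℕ} {f : RSphere → RSphere} {B : Set RSphere} {n : ℕ} {α : ℝ} {x₀ : RSphere}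
  {ψ : Bool → Fin N → RSphere → RSphere} {lo hi : Bool → ℝ}

lemma IsLimit.deriv_pos (h : IsGreedy f B n α x₀ ψ lo hi) {i : ℕ → Fin N} {x : RSphere}
    (hx : IsLimit f B n α x₀ ψ i x) (k : ℕ) : 0 < sphDeriv f^[n * k] x := by
  obtain ⟨hy, hyx⟩ := hx.iterate_mem h k
  have := h.branch_deriv_pos i k hy
  rwa [hyx] at this

lemma exists_log_deriv_bound (h : IsGreedy f B n α x₀ ψ lo hi) {ε : ℝ} (hε : 0 < ε) :
    ∃ C ≥ 0, ∀ (i : ℕ → Fin N) (x : RSphere), IsLimit f B n α x₀ ψ i x → ∀ k : ℕ,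
      |Real.log (sphDeriv f^[n * k] x) - n * α * k| ≤ ε * k + C := by
  obtain ⟨C, hC, hdist⟩ := h.exists_distortion hε
  set R := max |hi true - n * α| |lo false - n * α| with hR
  refine ⟨C + R, by positivity, fun i x hx k => ?_⟩
  induction k with
  | zero => simp only [Nat.mul_zero, Function.iterate_zero, sphDeriv_id]; simp; positivity
  | succ k ih =>
    obtain ⟨hy, hyx⟩ := hx.iterate_mem h k
    obtain ⟨hy1, hyx1⟩ := hx.iterate_mem h (k + 1)
    set t := greedyType f n α x₀ k (greedyBranch f n α x₀ ψ i k) with ht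
    have h1 := h.log_branch_succ i k hy1 ht
    rw [← hx.iterate_eq h k, hyx1, hyx] at h1
    have h2 := h.log_deriv_bounds t (i k) hy1
    rw [← hx.iterate_eq h k] at h2
    have h3 := hdist i k _ hy _ h.mem
    rw [hyx] at h3
    have h4 : hi true - n * α ≤ R := (le_abs_self _).trans (le_max_left _ _)
    have h5 : -R ≤ lo false - n * α := neg_le_of_neg_le
      ((neg_le_abs _).trans (le_max_right _ _))
    have h6 := h.hi_lt
    have h7 := h.lt_lo
    rw [h1]
    push_cast
    have hεk : 0 ≤ ε * k := by positivity
    rw [abs_le] at *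
    cases htt : t with
    | true =>
      have h8 : Real.log (sphDeriv f^[n * k] (greedyBranch f n α x₀ ψ i k x₀)) ≤ n * α * k := by
        simpa [greedyType] using ht.symm.trans htt
      rw [htt] at h2
      constructor <;> linarith
    | false =>
      have h8 : ¬ Real.log (sphDeriv f^[n * k] (greedyBranch f n α x₀ ψ i k x₀)) ≤ n * α * k := by
        simpa [greedyType] using ht.symm.trans htt
      rw [htt] at h2
      constructor <;> linarith

lemma tendsto_exponent (h : IsGreedy f B n α x₀ ψ lo hi) {i : ℕ → Fin N} {x : RSphere}
    (hx : IsLimit f B n α x₀ ψ i x) :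
    Tendsto (fun m : ℕ => Real.log (sphDeriv f^[m] x) / m) atTop (𝓝 α) := by
  have hn : (0 : ℝ) < n := by exact_mod_cast h.n_pos
  obtain ⟨K, hK1, hK⟩ := h.finHol.hol.exists_lipschitz
  have hup : ∀ r z, sphDeriv f^[r] z ≤ K ^ r := by
    intro r z
    rw [h.finHol.hol.sphDeriv_iterate]
    calc _ ≤ ∏ _k ∈ Finset.range r, K := Finset.prod_le_prod
          (fun _ _ => h.finHol.hol.sphDeriv_nonneg _)
          (fun _ _ => sphDeriv_le_of_lipschitz h.finHol.hol hK _)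
      _ = _ := by simp
  have hpos : ∀ m, 0 < sphDeriv f^[m] x := by
    intro m
    have h1 := hx.deriv_pos h m
    obtain ⟨r, hr⟩ := Nat.exists_eq_add_of_le (Nat.le_mul_of_pos_left m h.n_pos)
    rw [hr, add_comm, h.finHol.hol.sphDeriv_iterate_add] at h1
    exact pos_of_mul_pos_right h1 (h.finHol.hol.iterate r |>.sphDeriv_nonneg _)
  have hlK : 0 ≤ Real.log K := Real.log_nonneg hK1
  rw [Metric.tendsto_atTop]
  intro ε hε
  obtain ⟨C, hC, hb⟩ := h.exists_log_deriv_bound (half_pos hε)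
  have hb := hb i x hx
  set A := C + n * |α| + n * Real.log K + max |lo true| |lo false| with hA
  have hA0 : 0 ≤ A := by positivity
  obtain ⟨M, hM⟩ := exists_nat_gt (2 * A / ε)
  refine ⟨M + 1, fun m hm => ?_⟩
  have hm0 : (0 : ℝ) < m := by exact_mod_cast (by omega : 0 < m)
  have hmM : 2 * A < ε * m := by
    have : (M : ℝ) ≤ m := by exact_mod_cast (by omega : M ≤ m)
    rw [div_lt_iff₀ hε] at hM
    nlinarith
  set k := m / n with hk
  set r := m % n with hr
  have hmk : r + n * k = m := Nat.mod_add_div m n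
  have hrn : r < n := Nat.mod_lt _ h.n_pos
  have hmk' : (r : ℝ) + n * k = m := by exact_mod_cast hmk
  have hrn' : (r : ℝ) ≤ n := by exact_mod_cast hrn.le
  have hkm : (k : ℝ) ≤ m := by exact_mod_cast Nat.div_le_self m n
  have hr0 : (0 : ℝ) ≤ r := Nat.cast_nonneg _
  have e1 : Real.log (sphDeriv f^[m] x) = Real.log (sphDeriv f^[r] (f^[n * k] x)) +
      Real.log (sphDeriv f^[n * k] x) := by
    have := hpos m
    rw [← hmk, h.finHol.hol.sphDeriv_iterate_add] at this ⊢
    rw [Real.log_mul (pos_of_mul_pos_left this (hpos _).le).ne' (hpos _).ne']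
  have hposr : 0 < sphDeriv f^[r] (f^[n * k] x) := by
    have := hpos m
    rw [← hmk, h.finHol.hol.sphDeriv_iterate_add] at this
    exact pos_of_mul_pos_left this (hpos _).le
  have hupr : ∀ r ≤ n, ∀ z, 0 < sphDeriv f^[r] z →
      Real.log (sphDeriv f^[r] z) ≤ n * Real.log K := by
    intro r hrn z hz
    calc _ ≤ Real.log (K ^ r) := Real.log_le_log hz (hup r z)
      _ = r * Real.log K := Real.log_pow _ _
      _ ≤ _ := by gcongr
  have e2 : Real.log (sphDeriv f^[r] (f^[n * k] x)) ≤ n * Real.log K := hupr r hrn.le _ hposr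
  have e3 : -max |lo true| |lo false| - n * Real.log K ≤
      Real.log (sphDeriv f^[r] (f^[n * k] x)) := by
    obtain ⟨hy1, -⟩ := hx.iterate_mem h (k + 1)
    set t := greedyType f n α x₀ k (greedyBranch f n α x₀ ψ i k) with ht
    have h2 := h.log_deriv_bounds t (i k) hy1
    have h2p := (Real.exp_pos _).trans_le (h.deriv_bounds t (i k) hy1).1
    rw [← hx.iterate_eq h k] at h2 h2p
    have e4 : n = (n - r) + r := by omega
    have e5 := h.finHol.hol.sphDeriv_iterate_add (n - r) r (f^[n * k] x)
    rw [← e4] at e5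
    have hp2 : 0 < sphDeriv f^[n - r] (f^[r] (f^[n * k] x)) := by
      rw [e5] at h2p
      exact pos_of_mul_pos_left h2p hposr.le
    rw [e5, Real.log_mul hp2.ne' hposr.ne'] at h2
    have h3 := hupr (n - r) (Nat.sub_le _ _) _ hp2
    have h4 : -max |lo true| |lo false| ≤ lo t := by
      cases t
      · linarith [neg_abs_le (lo false), le_max_right |lo true| |lo false|]
      · linarith [neg_abs_le (lo true), le_max_left |lo true| |lo false|]
    linarith [h2.1]
  have e6 := abs_le.1 (hb k)
  have e7 : |α * r| ≤ n * |α| := by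
    rw [abs_mul, abs_of_nonneg hr0, mul_comm]
    gcongr
  have e8 := abs_le.1 e7
  have e9 : n * α * k = α * m - α * r := by rw [← hmk']; ring
  have e11 : (0 : ℝ) ≤ max |lo true| |lo false| := by positivity
  have e12 : ε / 2 * k ≤ ε / 2 * m := by gcongr
  have e13 : 0 ≤ (n : ℝ) * Real.log K := by positivity
  rw [e9] at e6
  rw [Real.dist_eq, div_sub' hm0.ne', abs_div, abs_of_pos hm0, div_lt_iff₀ hm0, abs_lt, e1]
  constructor <;> linarith [e6.1, e6.2, e8.1, e8.2]

lemma mem_levelSet (h : IsGreedy f B n α x₀ ψ lo hi) {i : ℕ → Fin N} {x : RSphere}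
    (hx : IsLimit f B n α x₀ ψ i x) : x ∈ levelSet f α α := by
  have h1 := (continuous_coe_real_ereal.tendsto α).comp (h.tendsto_exponent hx)
  exact ⟨h.mem_juliaSet hx, h1.liminf_eq, h1.limsup_eq⟩

end IsGreedy

/-- A set coded by digit sequences, with cylinders of level `k` separated at scale `exp (-k H)`,
has dimension at least `log N / H`. -/
lemma le_dimH_of_coding {N : ℕ} {X : Type*} [MetricSpace X] {A : Set X} (xx : (ℕ → Fin N) → X)
    (hA : ∀ i, xx i ∈ A) {δ H s : ℝ} (hδ : 0 < δ) (hs : 0 < s) (hH : 0 < H)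
    (hsep : ∀ (i j : ℕ → Fin N) (k : ℕ), (∀ m < k, i m = j m) → i k ≠ j k →
      δ * Real.exp (-(k * H)) ≤ dist (xx i) (xx j))
    (hN : s * H ≤ Real.log N) : ENNReal.ofReal s ≤ dimH A := by
  have hN1 : 1 < N := by
    by_contra! hle
    have : Real.log N = 0 := by
      have : N = 0 ∨ N = 1 := by omega
      rcases this with rfl | rfl <;> simp
    nlinarith [mul_pos hs hH]
  have hNr : (1 : ℝ) < N := by exact_mod_cast hN1
  have hfirst : ∀ i j : ℕ → Fin N, i ≠ j → ∃ k, (∀ m < k, i m = j m) ∧ i k ≠ j k := by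
    classical
    intro i j hij
    have hex := Function.ne_iff.1 hij
    exact ⟨Nat.find hex, fun m hm => not_not.1 (Nat.find_min hex hm), Nat.find_spec hex⟩
  have hinj : Function.Injective xx := by
    intro i j hij
    by_contra hne
    obtain ⟨k, h1, h2⟩ := hfirst i j hne
    have := hsep i j k h1 h2
    rw [hij, dist_self] at this
    exact absurd this (not_le.2 (by positivity))
  have : Nonempty (ℕ → Fin N) := ⟨fun _ => ⟨0, by omega⟩⟩
  set Θ : X → ℝ := fun x => Real.ofDigits (Function.invFun xx x) with hΘ
  have hΘx : ∀ i, Θ (xx i) = Real.ofDigits i := fun i => by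
    rw [hΘ]; simp only; rw [Function.leftInverse_invFun hinj i]
  have hol : HolderOnWith (Real.toNNReal (δ ^ (-s))) (Real.toNNReal s) Θ (range xx) := by
    rintro _ ⟨i, rfl⟩ _ ⟨j, rfl⟩
    rw [hΘx, hΘx, edist_dist, edist_dist, Real.coe_toNNReal s hs.le,
      ENNReal.ofReal_rpow_of_nonneg dist_nonneg hs.le]
    change _ ≤ ENNReal.ofReal (δ ^ (-s)) * _
    rw [← ENNReal.ofReal_mul (by positivity)]
    refine ENNReal.ofReal_le_ofReal ?_
    rcases eq_or_ne i j with rfl | hij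
    · rw [dist_self]; positivity
    obtain ⟨k, h1, h2⟩ := hfirst i j hij
    have h3 := Real.rpow_le_rpow (by positivity) (hsep i j k h1 h2) hs.le
    rw [Real.dist_eq]
    calc _ ≤ ((N : ℝ) ^ k)⁻¹ := Real.abs_ofDigits_sub_ofDigits_le h1
      _ = Real.exp (-(k * Real.log N)) := by
        rw [Real.exp_neg, mul_comm, Real.exp_mul, Real.exp_log (by positivity),
          Real.rpow_natCast]
      _ ≤ Real.exp (-(k * H) * s) := by
        refine Real.exp_le_exp.2 ?_
        have : (k : ℝ) * (s * H) ≤ k * Real.log N := by gcongr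
        linarith
      _ = δ ^ (-s) * (δ * Real.exp (-(k * H))) ^ s := by
        rw [Real.mul_rpow hδ.le (Real.exp_pos _).le, ← mul_assoc, ← Real.rpow_add hδ,
          neg_add_cancel, Real.rpow_zero, one_mul, Real.exp_mul]
      _ ≤ _ := by gcongr
  have h1 := hol.dimH_image_le (Real.toNNReal_pos.2 hs)
  have h2 : (1 : ℝ≥0∞) ≤ dimH (Θ '' range xx) := by
    have : Icc (0 : ℝ) 1 ⊆ Θ '' range xx := by
      intro y hy
      obtain ⟨i, -, hi⟩ := Real.ofDigits_SurjOn hN1 hy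
      exact ⟨xx i, ⟨i, rfl⟩, by rw [hΘx, hi]⟩
    refine le_trans ?_ (dimH_mono this)
    rw [Real.dimH_of_nonempty_interior (by rw [interior_Icc]; exact nonempty_Ioo.2 one_pos)]
    simp
  have h3 := h2.trans h1
  have hs' : ((Real.toNNReal s : ℝ≥0) : ℝ≥0∞) ≠ 0 := by simpa using hs
  rw [ENNReal.le_div_iff_mul_le (Or.inl hs') (Or.inl ENNReal.coe_ne_top), one_mul] at h3
  exact h3.trans (dimH_mono (range_subset_iff.2 hA))

lemma IsGreedy.le_dimH {N : ℕ} {f : RSphere → RSphere} {B : Set RSphere} {n : ℕ} {α : ℝ}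
    {x₀ : RSphere} {ψ : Bool → Fin N → RSphere → RSphere} {lo hi : Bool → ℝ}
    (h : IsGreedy f B n α x₀ ψ lo hi) {s : ℝ} (hs : 0 < s) (hH : 0 < max (hi false) (hi true))
    (hN : s * max (hi false) (hi true) ≤ Real.log N) :
    ENNReal.ofReal s ≤ dimH (levelSet f α α) := by
  choose xx hxx using h.exists_limit
  obtain ⟨δ, hδ, hsep⟩ := h.exists_le_dist
  exact le_dimH_of_coding xx (fun i => h.mem_levelSet (hxx i)) hδ hs hH
    (fun i j k => hsep i j _ _ k (hxx i) (hxx j)) hN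

lemma eventually_const_mul_lt (c : ℝ) {d : ℝ} (hd : 0 < d) :
    ∀ᶠ ε in 𝓝[>] (0 : ℝ), c * ε < d := by
  have : Tendsto (fun ε : ℝ => c * ε) (𝓝[>] 0) (𝓝 (c * 0)) :=
    (tendsto_id.const_mul c).mono_left nhdsWithin_le_nhds
  rw [mul_zero] at this
  exact this.eventually (gt_mem_nhds hd)

lemma HasRate.mono {f : RSphere → RSphere} {B : Set RSphere} {a b h a' b' h' : ℝ}
    (hr : HasRate f B a b h) (ha : a' ≤ a) (hb : b ≤ b') (hh : h' ≤ h) :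
    HasRate f B a' b' h' := by
  obtain ⟨n, N, hn, hN, ⟨ψ, hψ⟩, hl⟩ := hr
  refine ⟨n, N, hn, hN, ⟨ψ, hψ.maps, hψ.right_inv, fun i => (hψ.scales i).mono subset_rfl ?_ ?_,
    hψ.disj⟩, le_trans ?_ hl⟩ <;> gcongr

lemma HasRate.mix_real {f : RSphere → RSphere} {B : Set RSphere} {a b h a' b' h' : ℝ}
    (hr : HasRate f B a b h) (hr' : HasRate f B a' b' h') {θ η : ℝ} (hθ : 0 ≤ θ) (hθ1 : θ ≤ 1)
    (hη : 0 < η) : HasRate f B (θ * a + (1 - θ) * a' - η) (θ * b + (1 - θ) * b' + η)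
      (θ * h + (1 - θ) * h' - η) := by
  have h1 : Tendsto (fun n : ℕ => ((⌊θ * n⌋₊ : ℕ) : ℝ) / (n : ℝ)) atTop (𝓝 θ) :=
    (tendsto_nat_floor_mul_div_atTop hθ).comp tendsto_natCast_atTop_atTop
  have h2 : ∀ u v : ℝ, Tendsto (fun n : ℕ => ((⌊θ * n⌋₊ : ℕ) : ℝ) / (n : ℝ) * u +
      (1 - ((⌊θ * n⌋₊ : ℕ) : ℝ) / (n : ℝ)) * v) atTop (𝓝 (θ * u + (1 - θ) * v)) := fun u v =>
    (h1.mul_const u).add ((h1.const_sub 1).mul_const v)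
  obtain ⟨n, hn, ha, hb, hh⟩ := ((eventually_gt_atTop 0).and
    (((h2 a a').eventually (lt_mem_nhds (sub_lt_self _ hη))).and
    (((h2 b b').eventually (gt_mem_nhds (lt_add_of_pos_right _ hη))).and
    ((h2 h h').eventually (lt_mem_nhds (sub_lt_self _ hη)))))).exists
  have hle : ⌊θ * n⌋₊ ≤ n := Nat.floor_le_of_le (mul_le_of_le_one_left (Nat.cast_nonneg n) hθ1)
  have hn' : (n : ℝ) ≠ 0 := by exact_mod_cast hn.ne'
  have e : ((⌊θ * n⌋₊ : ℕ) : ℝ) + ((n - ⌊θ * n⌋₊ : ℕ) : ℝ) = n := by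
    exact_mod_cast Nat.add_sub_cancel' hle
  have key := hr.mix hr' (P := ⌊θ * n⌋₊) (Q := n - ⌊θ * n⌋₊) (by omega)
  rw [e] at key
  have e2 : ((n - ⌊θ * n⌋₊ : ℕ) : ℝ) = n - (⌊θ * n⌋₊ : ℕ) := by linarith
  rw [e2] at key
  have e3 : ∀ u v : ℝ, ((⌊θ * n⌋₊ : ℝ) * u + (n - (⌊θ * n⌋₊ : ℕ)) * v) / n =
      ((⌊θ * n⌋₊ : ℕ) : ℝ) / (n : ℝ) * u + (1 - ((⌊θ * n⌋₊ : ℕ) : ℝ) / (n : ℝ)) * v := by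
    intro u v
    field_simp
  rw [e3, e3, e3] at key
  exact key.mono ha.le hb.le hh.le

lemma HasRate.le_dimH {f : RSphere → RSphere} {B : Set RSphere} {a b h a' b' h' α s : ℝ}
    (hf : FinHol f) (hB : IsCompact B) (hp : Preperfect B) (hne : B.Nonempty)
    (hr : HasRate f B a b h) (hr' : HasRate f B a' b' h') (ha : 0 < a) (hb : b < α) (ha' : α < a')
    (hs : 0 < s) (hα : 0 < α) (h1 : s * max b b' ≤ min h h') :
    ENNReal.ofReal s ≤ dimH (levelSet f α α) := by
  obtain ⟨n, N, hn, hN, ⟨ψ, hψ⟩, ⟨ψ', hψ'⟩, hl⟩ := hr.exists_pair hr'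
  obtain ⟨x₀, hx₀⟩ := hne
  have hn' : (0 : ℝ) < n := by exact_mod_cast hn
  have hg : IsGreedy f B n α x₀ (fun t => if t then ψ' else ψ)
      (fun t => if t then n * a' else n * a) (fun t => if t then n * b' else n * b) := by
    refine ⟨hf, hn, hB, hp, hx₀, ?_, ?_, ?_, ?_⟩
    · rintro (_ | _) <;> simpa
    · rintro (_ | _)
      · simpa using mul_pos hn' ha
      · simpa using mul_pos hn' (hα.trans ha')
    · simpa using mul_lt_mul_of_pos_left hb hn'
    · simpa using mul_lt_mul_of_pos_left ha' hn'
  have hlohi := hg.lo_le_hi hN true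
  have hlo := hg.lo_pos true
  refine hg.le_dimH hs (lt_max_of_lt_right (hlo.trans_le hlohi)) ?_
  simp only [Bool.false_eq_true, if_false, if_true]
  rw [← mul_max_of_nonneg _ _ hn'.le]
  refine le_trans ?_ hl
  calc s * (n * max b b') = n * (s * max b b') := by ring
    _ ≤ _ := by gcongr

/-- Some expanding set carries, at infinitely many times, about `exp (n h)` separated orbits of
length `n` with exponent about `χ`. -/
def HasGrowth (f : RSphere → RSphere) (χ h : ℝ) : Prop :=
  0 < χ ∧ ∃ L, IsExpandingSet f L ∧ ∃ ε₀ > 0, GrowthPoint f L ε₀ χ h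

lemma IsExpandingSet.union {f : RSphere → RSphere} {L L' : Set RSphere} (hL : IsExpandingSet f L)
    (hL' : IsExpandingSet f L') : IsExpandingSet f (L ∪ L') := by
  refine ⟨hL.nonempty.inl, union_subset hL.subset hL'.subset, hL.isCompact.union hL'.isCompact,
    by rw [image_union, hL.image_eq, hL'.image_eq], ?_⟩
  obtain ⟨c, hc, l, hl, h⟩ := hL.expanding
  obtain ⟨c', hc', l', hl', h'⟩ := hL'.expanding
  refine ⟨min c c', lt_min hc hc', min l l', lt_min hl hl', ?_⟩
  have hm : 0 ≤ min l l' := by positivity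
  rintro x (hx | hx) m hm1
  · refine le_trans ?_ (h x hx m hm1)
    gcongr
    exacts [min_le_left _ _, min_le_left _ _]
  · refine le_trans ?_ (h' x hx m hm1)
    gcongr
    exacts [min_le_right _ _, min_le_right _ _]

lemma HasGrowth.le_dimH {f : RSphere → RSphere} (hf : FinHol f) (hexc : NoJuliaExceptional f)
    {χ₁ χ₂ χ₃ χ₄ h₁ h₂ h₃ h₄ α s θ θ' : ℝ} (H₁ : HasGrowth f χ₁ h₁) (H₂ : HasGrowth f χ₂ h₂)
    (H₃ : HasGrowth f χ₃ h₃) (H₄ : HasGrowth f χ₄ h₄) (hθ : 0 ≤ θ) (hθ1 : θ ≤ 1)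
    (hθ' : 0 ≤ θ') (hθ1' : θ' ≤ 1) (hs : 0 < s)
    (hb : θ * χ₁ + (1 - θ) * χ₂ < α) (ha : α < θ' * χ₃ + (1 - θ') * χ₄)
    (hsb : s * (θ' * χ₃ + (1 - θ') * χ₄) < θ * h₁ + (1 - θ) * h₂)
    (hsa : s * (θ' * χ₃ + (1 - θ') * χ₄) < θ' * h₃ + (1 - θ') * h₄) :
    ENNReal.ofReal s ≤ dimH (levelSet f α α) := by
  obtain ⟨hχ₁, L₁, hL₁, e₁, he₁, G₁⟩ := H₁
  obtain ⟨hχ₂, L₂, hL₂, e₂, he₂, G₂⟩ := H₂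
  obtain ⟨hχ₃, L₃, hL₃, e₃, he₃, G₃⟩ := H₃
  obtain ⟨hχ₄, L₄, hL₄, e₄, he₄, G₄⟩ := H₄
  have hL := (hL₁.union hL₂).union (hL₃.union hL₄)
  set e := min (min e₁ e₂) (min e₃ e₄) with he
  have he0 : 0 < e := by positivity
  replace G₁ : GrowthPoint f ((L₁ ∪ L₂) ∪ (L₃ ∪ L₄)) e χ₁ h₁ :=
    G₁.mono (by grind) (by simp [he])
  replace G₂ : GrowthPoint f ((L₁ ∪ L₂) ∪ (L₃ ∪ L₄)) e χ₂ h₂ :=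
    G₂.mono (by grind) (by simp [he])
  replace G₃ : GrowthPoint f ((L₁ ∪ L₂) ∪ (L₃ ∪ L₄)) e χ₃ h₃ :=
    G₃.mono (by grind) (by simp [he])
  replace G₄ : GrowthPoint f ((L₁ ∪ L₂) ∪ (L₃ ∪ L₄)) e χ₄ h₄ :=
    G₄.mono (by grind) (by simp [he])
  set cb := θ * χ₁ + (1 - θ) * χ₂ with hcb
  set ca := θ' * χ₃ + (1 - θ') * χ₄ with hca
  set gb := θ * h₁ + (1 - θ) * h₂ with hgb
  set ga := θ' * h₃ + (1 - θ') * h₄ with hga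
  have hcb0 : 0 < cb := by
    rcases hθ.eq_or_lt with h | h
    · rw [hcb, ← h]; linarith
    · have := mul_pos h hχ₁
      have := mul_nonneg (sub_nonneg.2 hθ1) hχ₂.le
      linarith
  obtain ⟨ε, hε, q1, q2, q3, q4, q5⟩ : ∃ ε > 0, 2 * ε < cb ∧ 2 * ε < α - cb ∧ 2 * ε < ca - α ∧
      (2 + 2 * s) * ε < gb - s * ca ∧ (2 + 2 * s) * ε < ga - s * ca := by
    exact (eventually_mem_nhdsWithin.and ((eventually_const_mul_lt 2 hcb0).and ((eventually_const_mul_lt 2 (sub_pos.2 hb)).and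
      ((eventually_const_mul_lt 2 (sub_pos.2 ha)).and ((eventually_const_mul_lt _ (sub_pos.2 hsb)).and
      (eventually_const_mul_lt _ (sub_pos.2 hsa))))))).exists
  obtain ⟨x₀, r₀, hr₀, hrate⟩ := hL.exists_hasRate hf hexc he0 hε
  have hRb := (hrate _ _ G₁).mix_real (hrate _ _ G₂) hθ hθ1 hε
  have hRa := (hrate _ _ G₃).mix_real (hrate _ _ G₄) hθ' hθ1' hε
  have hfin : s * max (cb + 2 * ε) (ca + 2 * ε) ≤ min (gb - 2 * ε) (ga - 2 * ε) := by
    rw [max_eq_right (by linarith)]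
    refine le_min ?_ ?_ <;> linarith
  refine (hRb.mono (a' := cb - 2 * ε) (b' := cb + 2 * ε) (h' := gb - 2 * ε) ?_ ?_ ?_).le_dimH hf
    isClosed_closure.isCompact (perfect_closure_ball x₀ r₀).acc
    ⟨x₀, subset_closure (mem_ball_self hr₀)⟩
    (hRa.mono (a' := ca - 2 * ε) (b' := ca + 2 * ε) (h' := ga - 2 * ε) ?_ ?_ ?_)
    (by linarith) (by linarith) (by linarith) hs (by linarith) hfin
  all_goals apply le_of_eq; ring

lemma HasGrowth.le_dimH_of_eq {f : RSphere → RSphere} (hf : FinHol f) (hexc : NoJuliaExceptional f)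
    {χ₁ χ₂ α s h₁ h₂ h : ℝ} (H : HasGrowth f α h) (H₁ : HasGrowth f χ₁ h₁) (h1 : χ₁ < α)
    (H₂ : HasGrowth f χ₂ h₂) (h2 : α < χ₂) (hs : 0 < s) (hh : s * α < h) :
    ENNReal.ofReal s ≤ dimH (levelSet f α α) := by
  obtain ⟨η, hη, e1, e2, e3⟩ := (eventually_mem_nhdsWithin.and
    ((eventually_const_mul_lt 1 one_pos).and
    ((eventually_const_mul_lt (s * (χ₂ - α) - (h₁ - h)) (sub_pos.2 hh)).and
    (eventually_const_mul_lt (s * (χ₂ - α) - (h₂ - h)) (sub_pos.2 hh))))).exists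
  rw [mem_Ioi] at hη
  refine HasGrowth.le_dimH hf hexc H₁ H H₂ H (θ := η) (θ' := η) hη.le (by linarith) hη.le
    (by linarith) hs ?_ ?_ ?_ ?_
  · linarith [mul_pos hη (sub_pos.2 h1)]
  · linarith [mul_pos hη (sub_pos.2 h2)]
  · linarith
  · linarith

lemma HasGrowth.le_dimH_of_lt_of_lt {f : RSphere → RSphere} (hf : FinHol f)
    (hexc : NoJuliaExceptional f) {χ₁ χ₂ α s h₁ h₂ : ℝ} (H₁ : HasGrowth f χ₁ h₁) (h1 : χ₁ < α)
    (H₂ : HasGrowth f χ₂ h₂) (h2 : α < χ₂) (hs : 0 < s)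
    (hh : s * α * (χ₂ - χ₁) < (χ₂ - α) * h₁ + (α - χ₁) * h₂) :
    ENNReal.ofReal s ≤ dimH (levelSet f α α) := by
  have hΔ : 0 < χ₂ - χ₁ := by linarith
  set θ := (χ₂ - α) / (χ₂ - χ₁) with hθ
  have hθ0 : 0 < θ := div_pos (by linarith) hΔ
  have hθ1 : 0 < 1 - θ := by
    have : 1 - θ = (α - χ₁) / (χ₂ - χ₁) := by rw [hθ]; field_simp; ring
    rw [this]
    exact div_pos (by linarith) hΔ
  have hmix : θ * χ₁ + (1 - θ) * χ₂ = α := by rw [hθ]; field_simp; ring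
  have hmixh : s * α < θ * h₁ + (1 - θ) * h₂ := by
    have : θ * h₁ + (1 - θ) * h₂ = ((χ₂ - α) * h₁ + (α - χ₁) * h₂) / (χ₂ - χ₁) := by
      rw [hθ]; field_simp; ring
    rw [this, lt_div_iff₀ hΔ]
    exact hh
  obtain ⟨η, hη, e1, e2, e3, e4⟩ := (eventually_mem_nhdsWithin.and
    ((eventually_const_mul_lt 1 hθ0).and ((eventually_const_mul_lt 1 hθ1).and
    ((eventually_const_mul_lt (s * (χ₂ - χ₁) - (h₁ - h₂)) (sub_pos.2 hmixh)).and
    (eventually_const_mul_lt (s * (χ₂ - χ₁) + (h₁ - h₂)) (sub_pos.2 hmixh)))))).exists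
  rw [mem_Ioi] at hη
  have hηΔ := mul_pos hη hΔ
  have es : s * ((θ - η) * χ₁ + (1 - (θ - η)) * χ₂) = s * α + s * (χ₂ - χ₁) * η := by
    rw [← hmix]; ring
  refine HasGrowth.le_dimH hf hexc H₁ H₂ H₁ H₂ (θ := θ + η) (θ' := θ - η) (by linarith)
    (by linarith) (by linarith) (by linarith) hs ?_ ?_ ?_ ?_
  · linarith
  · linarith
  · rw [es]; linarith
  · rw [es]; linarith

lemma le_dimH_of_forall_hasGrowth {f : RSphere → RSphere} (hf : FinHol f)
    (hexc : NoJuliaExceptional f) {α s s' : ℝ} (hα : 0 < α) (hs : 0 < s) (hss : s < s')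
    (H : ∀ d, ∃ χ h, HasGrowth f χ h ∧ s' * α + d * (χ - α) ≤ h)
    (hl : ∃ χ h, HasGrowth f χ h ∧ χ < α) (hr : ∃ χ h, HasGrowth f χ h ∧ α < χ) :
    ENNReal.ofReal s ≤ dimH (levelSet f α α) := by
  obtain ⟨χ₁, h₁, H₁, h1⟩ := hl
  obtain ⟨χ₂, h₂, H₂, h2⟩ := hr
  by_cases h0 : ∃ h, HasGrowth f α h ∧ s' * α ≤ h
  · obtain ⟨h, Hh, hle⟩ := h0
    exact Hh.le_dimH_of_eq hf hexc H₁ h1 H₂ h2 hs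
      ((mul_lt_mul_of_pos_right hss hα).trans_le hle)
  set Dm : Set ℝ := {d | ∃ χ h, HasGrowth f χ h ∧ χ < α ∧ s' * α + d * (χ - α) ≤ h} with hDm
  set Dp : Set ℝ := {d | ∃ χ h, HasGrowth f χ h ∧ α < χ ∧ s' * α + d * (χ - α) ≤ h} with hDp
  have hcov : ∀ d, d ∉ Dm → d ∈ Dp := by
    intro d hd
    obtain ⟨χ, h, Hh, hle⟩ := H d
    rcases lt_trichotomy χ α with hlt | rfl | hgt
    · exact absurd ⟨χ, h, Hh, hlt, hle⟩ hd
    · exact absurd ⟨h, Hh, by linarith⟩ h0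
    · exact ⟨χ, h, Hh, hgt, hle⟩
  obtain ⟨a, ha⟩ : Dp.Nonempty := by
    refine ⟨(h₂ - s' * α) / (χ₂ - α), χ₂, h₂, H₂, h2, ?_⟩
    rw [div_mul_cancel₀ _ (sub_pos.2 h2).ne']
    linarith
  obtain ⟨b, hb⟩ : Dm.Nonempty := by
    refine ⟨(h₁ - s' * α) / (χ₁ - α), χ₁, h₁, H₁, h1, ?_⟩
    rw [div_mul_cancel₀ _ (sub_neg.2 h1).ne]
    linarith
  set τ := (s' - s) / 2 with hτ
  have hτ0 : 0 < τ := by rw [hτ]; linarith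
  obtain ⟨dm, hdm, dp, hdp, hd⟩ : ∃ dm ∈ Dm, ∃ dp ∈ Dp, dm ≤ dp + τ := by
    by_contra! hcon
    have hall : ∀ n : ℕ, a + n * τ ∈ Dp := by
      intro n
      induction n with
      | zero => simpa using ha
      | succ n ih =>
        refine hcov _ fun hmem => ?_
        have := hcon _ hmem _ ih
        push_cast at this
        linarith
    obtain ⟨n, hn⟩ := exists_nat_gt ((b - a) / τ)
    rw [div_lt_iff₀ hτ0] at hn
    have := hcon b hb _ (hall n)
    linarith
  obtain ⟨χm, hm, Hm, hmα, hmle⟩ := hdm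
  obtain ⟨χp, hp, Hp, hpα, hple⟩ := hdp
  refine Hm.le_dimH_of_lt_of_lt hf hexc hmα Hp hpα hs ?_
  have hχm := Hm.1
  have e1 := mul_le_mul_of_nonneg_left hmle (sub_nonneg.2 hpα.le)
  have e2 := mul_le_mul_of_nonneg_left hple (sub_nonneg.2 hmα.le)
  have e3 : 0 < (χp - α) * (α - χm) := mul_pos (sub_pos.2 hpα) (sub_pos.2 hmα)
  have e4 := mul_le_mul_of_nonneg_left hd e3.le
  have e5 : (χp - α) * (α - χm) ≤ α * (χp - χm) := by nlinarith [mul_pos hχm hχm]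
  have e6 := mul_le_mul_of_nonneg_left e5 hτ0.le
  have e7 : 0 < τ * α * (χp - χm) := mul_pos (mul_pos hτ0 hα) (by linarith)
  have e8 : s' = s + 2 * τ := by rw [hτ]; ring
  rw [e8] at e1 e2
  nlinarith

/-- A volume bound for the number of separated points in a ball. -/
lemma card_le_of_separated_of_ball {E : Type*} [NormedAddCommGroup E] [NormedSpace ℝ E]
    [FiniteDimensional ℝ E] (s : Finset E) {a : E} {D r : ℝ} (hD : 0 ≤ D) (hr : 0 < r)
    (hs : ∀ x ∈ s, dist x a ≤ D) (h : ∀ x ∈ s, ∀ y ∈ s, x ≠ y → r ≤ dist x y) :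
    (s.card : ℝ) ≤ (2 * D / r + 1) ^ Module.finrank ℝ E := by
  borelize E
  let μ : Measure E := Measure.addHaar
  have hr2 : 0 < r / 2 := half_pos hr
  have hρ : 0 < D + r / 2 := by positivity
  have hdisj : Set.Pairwise (s : Set E) (Function.onFun Disjoint fun c => ball (c : E) (r / 2)) := by
    intro c hc d hd hcd
    refine ball_disjoint_ball ?_
    rw [add_halves]
    exact h c hc d hd hcd
  have hsub : ⋃ c ∈ s, ball (c : E) (r / 2) ⊆ ball a (D + r / 2) := by
    refine iUnion₂_subset fun x hx => ball_subset_ball' ?_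
    linarith [hs x hx]
  have h1 := measure_mono (μ := μ) hsub
  rw [measure_biUnion_finset hdisj fun c _ => measurableSet_ball] at h1
  simp only [μ.addHaar_ball_of_pos _ hr2, μ.addHaar_ball_of_pos _ hρ, Finset.sum_const,
    nsmul_eq_mul, ← mul_assoc] at h1
  have h2 : (s.card : ℝ≥0∞) * ENNReal.ofReal ((r / 2) ^ Module.finrank ℝ E) ≤
      ENNReal.ofReal ((D + r / 2) ^ Module.finrank ℝ E) :=
    (ENNReal.mul_le_mul_iff_left (measure_ball_pos _ _ zero_lt_one).ne' measure_ball_lt_top.ne).1 h1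
  have h3 := ENNReal.toReal_le_of_le_ofReal (by positivity) h2
  rw [ENNReal.toReal_mul, ENNReal.toReal_natCast, ENNReal.toReal_ofReal (by positivity),
    ← le_div_iff₀ (by positivity), ← div_pow] at h3
  have h4 : (D + r / 2) / (r / 2) = 2 * D / r + 1 := by field_simp
  rwa [h4] at h3

lemma RSphere.exists_card_le : ∃ (d : ℕ) (D : ℝ), 0 ≤ D ∧ ∀ r > 0, ∀ s : Finset RSphere,
    (∀ x ∈ s, ∀ y ∈ s, x ≠ y → r ≤ dist x y) → (s.card : ℝ) ≤ (2 * D / r + 1) ^ d := by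
  classical
  obtain ⟨D, hD⟩ := exists_dist_le
  refine ⟨Module.finrank ℝ (WithLp 2 (ℂ × ℝ)), D, dist_nonneg.trans (hD infty infty), ?_⟩
  intro r hr s hs
  rw [← Finset.card_image_of_injective s embed_injective]
  refine card_le_of_separated_of_ball _ (a := embed infty) (dist_nonneg.trans (hD infty infty)) hr
    ?_ ?_
  · intro x hx
    obtain ⟨x, -, rfl⟩ := Finset.mem_image.1 hx
    exact hD x infty
  · intro x hx y hy hxy
    obtain ⟨x', hx', rfl⟩ := Finset.mem_image.1 hx
    obtain ⟨y', hy', rfl⟩ := Finset.mem_image.1 hy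
    exact hs x' hx' y' hy' fun h => hxy (by rw [h])

/-- Separated sets grow at most exponentially, with a rate not depending on the scale. -/
lemma SHol.exists_sep_card_le {f : RSphere → RSphere} (hf : SHol f) :
    ∃ H ≥ 0, ∀ ε > 0, ∃ A ≥ 1, ∀ (Λ : Set RSphere) (m : ℕ) (E : Finset RSphere),
      IsSepSet f Λ m ε E → (E.card : ℝ) ≤ A * Real.exp (m * H) := by
  obtain ⟨K, hK1, hK⟩ := hf.exists_lipschitz
  obtain ⟨d, D, hD, hcard⟩ := RSphere.exists_card_le
  refine ⟨d * Real.log K, mul_nonneg (Nat.cast_nonneg _) (Real.log_nonneg hK1), fun ε hε =>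
    ⟨(2 * D / ε + 1) ^ d, one_le_pow₀ (by linarith [div_nonneg (mul_nonneg zero_le_two hD) hε.le]),
    fun Λ m E hE => ?_⟩⟩
  have hit : ∀ k x y, dist (f^[k] x) (f^[k] y) ≤ K ^ k * dist x y := by
    intro k x y
    induction k with
    | zero => simp
    | succ k ih =>
      rw [Function.iterate_succ_apply', Function.iterate_succ_apply', pow_succ']
      refine (hK _ _).trans ?_
      rw [mul_assoc]
      gcongr
  have hKm : 1 ≤ K ^ m := one_le_pow₀ hK1
  have h1 := hcard (ε / K ^ m) (by positivity) E ?_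
  · refine h1.trans ?_
    have h2 : Real.exp (m * (d * Real.log K)) = (K ^ m) ^ d := by
      rw [show (m : ℝ) * (d * Real.log K) = ((m * d : ℕ) : ℝ) * Real.log K by push_cast; ring,
        ← Real.log_pow, Real.exp_log (by positivity), pow_mul]
    rw [h2, ← mul_pow]
    refine pow_le_pow_left₀ (by positivity) ?_ d
    rw [div_div_eq_mul_div, add_mul, one_mul, div_mul_eq_mul_div]
    gcongr
  · intro x hx y hy hxy
    obtain ⟨k, hk, hk'⟩ := hE.2 x hx y hy hxy
    rw [div_le_iff₀ (by positivity), mul_comm]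
    refine (hk'.trans (hit k x y)).trans ?_
    gcongr

lemma IsExpandingSet.birkhoff_eq {f : RSphere → RSphere} {L : Set RSphere}
    (hL : IsExpandingSet f L) (hf : SHol f) (d : ℝ) {x : RSphere} (hx : x ∈ L) (m : ℕ) :
    birkhoff f (fun x => -d * Real.log (sphDeriv f x)) m x =
      -d * Real.log (sphDeriv f^[m] x) := by
  rw [birkhoff, ← Finset.mul_sum, hf.sphDeriv_iterate, Real.log_prod]
  intro k _
  have := hL.expanding.pos (hL.iterate_mem hx k) 1
  rw [Function.iterate_one] at this
  exact this.ne'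

/-- Uniform two-sided control of the exponents along an expanding set. -/
lemma IsExpandingSet.exists_log_deriv_bounds {f : RSphere → RSphere} {L : Set RSphere}
    (hL : IsExpandingSet f L) (hf : SHol f) {K : ℝ}
    (hK : ∀ x y, dist (f x) (f y) ≤ K * dist x y) :
    ∃ c ≥ 0, ∃ l > 0, ∀ x ∈ L, ∀ m : ℕ, 1 ≤ m → m * l - c ≤ Real.log (sphDeriv f^[m] x) ∧
      Real.log (sphDeriv f^[m] x) ≤ m * Real.log K := by
  obtain ⟨c, hc, l, hl, h⟩ := hL.expanding
  refine ⟨|Real.log c|, abs_nonneg _, Real.log l, Real.log_pos hl, fun x hx m hm => ⟨?_, ?_⟩⟩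
  · have := Real.log_le_log (by positivity) (h x hx m hm)
    rw [Real.log_mul hc.ne' (by positivity), Real.log_pow] at this
    linarith [neg_abs_le (Real.log c)]
  · rw [← Real.log_pow]
    refine Real.log_le_log (hL.expanding.pos hx m) ?_
    rw [hf.sphDeriv_iterate]
    calc _ ≤ ∏ _k ∈ Finset.range m, K := Finset.prod_le_prod
          (fun _ _ => hf.sphDeriv_nonneg _)
          (fun _ _ => sphDeriv_le_of_lipschitz hf hK _)
      _ = _ := by simp

/-- The partition function of the geometric potential over separated sets. -/
noncomputable def partitionFun (f : RSphere → RSphere) (L : Set RSphere) (d : ℝ) (ε : ℝ)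
    (m : ℕ) : ℝ :=
  ⨆ E : {E : Finset RSphere // IsSepSet f L m ε E},
    ∑ x ∈ E.1, Real.exp (birkhoff f (fun x => -d * Real.log (sphDeriv f x)) m x)

lemma SHol.exists_partitionFun_bound {f : RSphere → RSphere} (hf : SHol f) :
    ∃ M ≥ 0, ∀ d L, IsExpandingSet f L → ∀ ε > 0, ∀ᶠ m : ℕ in atTop,
      0 < partitionFun f L d ε m ∧ |Real.log (partitionFun f L d ε m) / m| ≤ M * (1 + |d|) := by
  obtain ⟨K, hK1, hK⟩ := hf.exists_lipschitz
  obtain ⟨H, hH, hcard⟩ := hf.exists_sep_card_le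
  have hlK : 0 ≤ Real.log K := Real.log_nonneg hK1
  refine ⟨H + Real.log K + 1, by positivity, fun d L hL ε hε => ?_⟩
  obtain ⟨A, hA, hE⟩ := hcard ε hε
  obtain ⟨c, hc, l, hl, hb⟩ := hL.exists_log_deriv_bounds hf hK
  have hlA : 0 ≤ Real.log A := Real.log_nonneg hA
  obtain ⟨m₀, hm₀⟩ := exists_nat_gt (Real.log A + |d| * c)
  filter_upwards [eventually_ge_atTop (m₀ + 1)] with m hm
  have hm1 : 1 ≤ m := by omega
  have hm0 : (0 : ℝ) < m := by exact_mod_cast hm1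
  have hmm : Real.log A + |d| * c ≤ m := hm₀.le.trans (by exact_mod_cast (by omega : m₀ ≤ m))
  have habs : ∀ x ∈ L, |birkhoff f (fun x => -d * Real.log (sphDeriv f x)) m x| ≤
      |d| * (c + m * Real.log K) := by
    intro x hx
    rw [hL.birkhoff_eq hf d hx, abs_mul, abs_neg]
    refine mul_le_mul_of_nonneg_left ?_ (abs_nonneg d)
    have := hb x hx m hm1
    have h1 : 0 < m * l := by positivity
    have h2 : 0 ≤ m * Real.log K := by positivity
    rw [abs_le]
    constructor <;> linarith
  set G := |d| * (c + m * Real.log K) with hG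
  have hup : ∀ E : {E : Finset RSphere // IsSepSet f L m ε E},
      ∑ x ∈ E.1, Real.exp (birkhoff f (fun x => -d * Real.log (sphDeriv f x)) m x) ≤
        Real.exp (Real.log A + m * H + G) := by
    intro E
    calc _ ≤ ∑ x ∈ E.1, Real.exp G := Finset.sum_le_sum fun x hx =>
          Real.exp_le_exp.2 ((le_abs_self _).trans (habs x (E.2.1 hx)))
      _ = E.1.card * Real.exp G := by simp
      _ ≤ A * Real.exp (m * H) * Real.exp G := by
          gcongr
          exact hE L m E.1 E.2
      _ = _ := by rw [Real.exp_add, Real.exp_add, Real.exp_log (by positivity)]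
  obtain ⟨x, hx⟩ := hL.nonempty
  have hsing : IsSepSet f L m ε {x} := by
    refine ⟨by simpa using hx, fun y hy z hz hyz => ?_⟩
    rw [Finset.mem_singleton] at hy hz
    exact absurd (hy.trans hz.symm) hyz
  have : Nonempty {E : Finset RSphere // IsSepSet f L m ε E} := ⟨⟨_, hsing⟩⟩
  have hlow : Real.exp (-G) ≤ partitionFun f L d ε m := by
    have h1 := le_ciSup (f := fun E : {E : Finset RSphere // IsSepSet f L m ε E} =>
      ∑ x ∈ E.1, Real.exp (birkhoff f (fun x => -d * Real.log (sphDeriv f x)) m x))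
      ⟨_, forall_mem_range.2 hup⟩ ⟨_, hsing⟩
    refine le_trans ?_ h1
    rw [Finset.sum_singleton]
    exact Real.exp_le_exp.2 (neg_le_of_abs_le (habs x hx))
  have hupp : partitionFun f L d ε m ≤ Real.exp (Real.log A + m * H + G) := ciSup_le hup
  have hpos := (Real.exp_pos _).trans_le hlow
  have h1 := (Real.le_log_iff_exp_le hpos).2 hlow
  have h2 := (Real.log_le_iff_le_exp hpos).2 hupp
  have h3 : Real.log A + m * H + G ≤ m * ((H + Real.log K + 1) * (1 + |d|)) := by
    have := mul_nonneg hm0.le (mul_nonneg hH (abs_nonneg d))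
    have := mul_nonneg hm0.le hlK
    have := mul_nonneg hm0.le (abs_nonneg d)
    rw [hG]
    nlinarith
  have h4 : 0 ≤ m * H := by positivity
  refine ⟨hpos, ?_⟩
  rw [abs_div, abs_of_pos hm0, div_le_iff₀ hm0, abs_le]
  constructor <;> linarith

lemma SHol.exists_pressureOn_bound {f : RSphere → RSphere} (hf : SHol f) :
    ∃ M ≥ 0, ∀ d L, IsExpandingSet f L →
      |pressureOn f L fun x => -d * Real.log (sphDeriv f x)| ≤ M * (1 + |d|) ∧
      ∀ c, c < pressureOn f L (fun x => -d * Real.log (sphDeriv f x)) → ∃ ε > 0,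
        ∃ᶠ m : ℕ in atTop, Real.exp (m * c) < partitionFun f L d ε m := by
  obtain ⟨M, hM, hb⟩ := hf.exists_partitionFun_bound
  refine ⟨M, hM, fun d L hL => ?_⟩
  have hub : ∀ ε > 0, IsBoundedUnder (· ≤ ·) atTop
      fun m : ℕ => Real.log (partitionFun f L d ε m) / m := fun ε hε =>
    isBoundedUnder_of_eventually_le ((hb d L hL ε hε).mono fun m hm => (abs_le.1 hm.2).2)
  have hlb : ∀ ε > 0, IsCoboundedUnder (· ≤ ·) atTop
      fun m : ℕ => Real.log (partitionFun f L d ε m) / m := fun ε hε =>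
    (isBoundedUnder_of_eventually_ge
      ((hb d L hL ε hε).mono fun m hm => (abs_le.1 hm.2).1)).isCoboundedUnder_le
  have hlim : ∀ ε > 0, |limsup (fun m : ℕ => Real.log (partitionFun f L d ε m) / m) atTop| ≤
      M * (1 + |d|) := fun ε hε => abs_le.2
    ⟨le_limsup_of_frequently_le ((hb d L hL ε hε).mono fun m hm => (abs_le.1 hm.2).1).frequently
      (hub ε hε),
    limsup_le_of_le (hlb ε hε) ((hb d L hL ε hε).mono fun m hm => (abs_le.1 hm.2).2)⟩
  have hpr : pressureOn f L (fun x => -d * Real.log (sphDeriv f x)) =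
    ⨆ ε : {ε : ℝ // 0 < ε},
      limsup (fun m : ℕ => Real.log (partitionFun f L d ε.1 m) / m) atTop := rfl
  have : Nonempty {ε : ℝ // 0 < ε} := ⟨⟨1, one_pos⟩⟩
  rw [hpr]
  refine ⟨abs_le.2 ⟨?_, ciSup_le fun ε => (abs_le.1 (hlim ε.1 ε.2)).2⟩, fun c hc => ?_⟩
  · exact (abs_le.1 (hlim 1 one_pos)).1.trans
      (le_ciSup (f := fun ε : {ε : ℝ // 0 < ε} =>
        limsup (fun m : ℕ => Real.log (partitionFun f L d ε.1 m) / m) atTop)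
        ⟨_, forall_mem_range.2 fun ε => (abs_le.1 (hlim ε.1 ε.2)).2⟩ ⟨1, one_pos⟩)
  · obtain ⟨⟨ε, hε⟩, h⟩ := exists_lt_of_lt_ciSup hc
    refine ⟨ε, hε, ((frequently_lt_of_lt_limsup (hlb ε hε) h).and_eventually
      ((hb d L hL ε hε).and (eventually_gt_atTop 0))).mono ?_⟩
    rintro m ⟨h1, ⟨h2, -⟩, h3⟩
    rw [lt_div_iff₀' (by exact_mod_cast h3)] at h1
    exact (Real.lt_log_iff_exp_lt h2).1 h1

lemma SHol.exists_pressFamily_bound {f : RSphere → RSphere} (hf : SHol f) :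
    ∃ M ≥ 0, ∀ d, |pressFamily f d| ≤ M * (1 + |d|) := by
  obtain ⟨M, hM, hb⟩ := hf.exists_pressureOn_bound
  refine ⟨M, hM, fun d => ?_⟩
  rcases isEmpty_or_nonempty {L : Set RSphere //
      L.Nonempty ∧ L ⊆ juliaSet f ∧ IsCompact L ∧ f '' L = L ∧ ExpandingOn f L} with h | h
  · rw [pressFamily, pressureTop, Real.iSup_of_isEmpty, abs_zero]
    positivity
  · have hb' := fun L : {L : Set RSphere //
      L.Nonempty ∧ L ⊆ juliaSet f ∧ IsCompact L ∧ f '' L = L ∧ ExpandingOn f L} =>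
        abs_le.1 (hb d L.1 ⟨L.2.1, L.2.2.1, L.2.2.2.1, L.2.2.2.2.1, L.2.2.2.2.2⟩).1
    refine abs_le.2 ⟨?_, ciSup_le fun L => (hb' L).2⟩
    exact (hb' h.some).1.trans (le_ciSup (f := fun L : {L : Set RSphere //
      L.Nonempty ∧ L ⊆ juliaSet f ∧ IsCompact L ∧ f '' L = L ∧ ExpandingOn f L} =>
        pressureOn f L.1 fun x => -d * Real.log (sphDeriv f x))
      ⟨_, forall_mem_range.2 fun L => (hb' L).2⟩ h.some)

/-- A large partition function forces a large growth rate at some exponent. -/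
lemma IsExpandingSet.exists_growthPoint {f : RSphere → RSphere} {L : Set RSphere}
    (hL : IsExpandingSet f L) (hf : SHol f) {ε₀ c d : ℝ}
    (h : ∃ᶠ m : ℕ in atTop, Real.exp (m * c) < partitionFun f L d ε₀ m) :
    ∃ χ, 0 < χ ∧ GrowthPoint f L ε₀ χ (c + d * χ) := by
  obtain ⟨K, hK1, hK⟩ := hf.exists_lipschitz
  obtain ⟨a, ha, l, hl, hb⟩ := hL.exists_log_deriv_bounds hf hK
  by_contra! hcon
  have hloc : ∀ χ ∈ Icc (l / 2) (Real.log K), ∃ ε > 0, ∀ᶠ n : ℕ in atTop,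
      ∀ E : Finset RSphere, IsSepSet f L n ε₀ E →
        (∀ x ∈ E, Real.exp (n * (χ - ε)) ≤ sphDeriv f^[n] x ∧
          sphDeriv f^[n] x ≤ Real.exp (n * (χ + ε))) →
        (E.card : ℝ) < Real.exp (n * (c + d * χ - ε)) := by
    intro χ hχ
    have := hcon χ (lt_of_lt_of_le (half_pos hl) hχ.1)
    rw [GrowthPoint] at this
    push Not at this
    obtain ⟨ε, hε, hE⟩ := this
    exact ⟨ε, hε, hE⟩
  choose! e he hcard using hloc
  set δ : ℝ → ℝ := fun χ => e χ / (2 * (1 + |d|)) with hδ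
  have hδ0 : ∀ χ ∈ Icc (l / 2) (Real.log K), 0 < δ χ := fun χ hχ => by
    have := he χ hχ
    simp only [hδ]
    positivity
  obtain ⟨t, htI, ht⟩ := isCompact_Icc.elim_nhds_subcover (fun χ => ball χ (δ χ))
    fun χ hχ => ball_mem_nhds χ (hδ0 χ hχ)
  have hsmall : ∀ᶠ n : ℕ in atTop, ∑ χ ∈ t, Real.exp (-(n * (e χ / 2))) < 1 := by
    have : Tendsto (fun n : ℕ => ∑ χ ∈ t, Real.exp (-(n * (e χ / 2)))) atTop
        (𝓝 (∑ χ ∈ t, 0)) := by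
      refine tendsto_finsetSum _ fun χ hχ => ?_
      refine Real.tendsto_exp_neg_atTop_nhds_zero.comp ?_
      exact tendsto_natCast_atTop_atTop.atTop_mul_const (half_pos (he χ (htI χ hχ)))
    rw [Finset.sum_const_zero] at this
    exact this.eventually_lt_const one_pos
  have hall := (t.eventually_all (l := atTop)).2 fun χ hχ => hcard χ (htI χ hχ)
  obtain ⟨n₀, hn₀⟩ := exists_nat_gt (2 * a / l)
  obtain ⟨n, hZ, hs, hc, hn⟩ :=
    (h.and_eventually (hsmall.and (hall.and (eventually_ge_atTop (n₀ + 1))))).exists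
  have hn0 : (0 : ℝ) < n := by exact_mod_cast (by omega : 0 < n)
  have hnl : a ≤ n * (l / 2) := by
    have h1 : (n₀ : ℝ) ≤ n := by exact_mod_cast (by omega : n₀ ≤ n)
    have h2 := hn₀.trans_le h1
    rw [div_lt_iff₀ hl] at h2
    linarith
  have hZ' := hZ
  rw [partitionFun] at hZ'
  have : Nonempty {E : Finset RSphere // IsSepSet f L n ε₀ E} :=
    ⟨⟨∅, by simp, by simp⟩⟩
  obtain ⟨⟨E, hE⟩, hEZ⟩ := exists_lt_of_lt_ciSup hZ'
  refine absurd hEZ (not_lt.2 ?_)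
  classical
  set X : RSphere → ℝ := fun x => Real.log (sphDeriv f^[n] x) / n with hX
  have hXn : ∀ x, Real.log (sphDeriv f^[n] x) = n * X x := fun x => by
    simp only [hX]
    field_simp
  have hXI : ∀ x ∈ E, X x ∈ Icc (l / 2) (Real.log K) := by
    intro x hx
    have := hb x (hE.1 hx) n (by omega)
    rw [hXn] at this
    constructor
    · exact le_of_mul_le_mul_left (by linarith) hn0
    · exact le_of_mul_le_mul_left this.2 hn0
  have hterm : ∀ χ ∈ t, ∑ x ∈ E with X x ∈ ball χ (δ χ), Real.exp (-d * (n * X x)) ≤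
      Real.exp (n * c) * Real.exp (-(n * (e χ / 2))) := by
    intro χ hχ
    have heχ := he χ (htI χ hχ)
    have hd1 : 0 < 1 + |d| := by positivity
    have hδe : δ χ * (1 + |d|) = e χ / 2 := by
      simp only [hδ]
      field_simp
    have hδχ := hδ0 χ (htI χ hχ)
    have hδd : δ χ ≤ e χ := by
      have := mul_nonneg hδχ.le (abs_nonneg d)
      linarith
    have hXe : ∀ x ∈ E, X x ∈ ball χ (δ χ) → |X x - χ| ≤ δ χ := fun x _ hx => by
      rw [mem_ball, Real.dist_eq] at hx
      exact hx.le
    set E' := E.filter fun x => X x ∈ ball χ (δ χ) with hE'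
    have h1 := hc χ hχ E' ⟨(Finset.coe_subset.2 (Finset.filter_subset _ _)).trans hE.1,
      fun x hx y hy => hE.2 x (Finset.mem_of_mem_filter x hx) y (Finset.mem_of_mem_filter y hy)⟩
      (fun x hx => by
        rw [hE', Finset.mem_filter] at hx
        have h2 := abs_le.1 (hXe x hx.1 hx.2)
        have h3 := hL.expanding.pos (hE.1 hx.1) n
        rw [← Real.le_log_iff_exp_le h3, ← Real.log_le_iff_le_exp h3, hXn]
        constructor <;> exact mul_le_mul_of_nonneg_left (by linarith) hn0.le)
    calc ∑ x ∈ E', Real.exp (-d * (n * X x)) ≤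
          ∑ x ∈ E', Real.exp (n * (-d * χ + |d| * δ χ)) := by
          refine Finset.sum_le_sum fun x hx => Real.exp_le_exp.2 ?_
          rw [hE', Finset.mem_filter] at hx
          have h2 : -d * (X x - χ) ≤ |d| * δ χ := (le_abs_self _).trans (by
            rw [abs_mul, abs_neg]
            exact mul_le_mul_of_nonneg_left (hXe x hx.1 hx.2) (abs_nonneg d))
          have := mul_le_mul_of_nonneg_left h2 hn0.le
          linarith
      _ = E'.card * Real.exp (n * (-d * χ + |d| * δ χ)) := by simp
      _ ≤ Real.exp (n * (c + d * χ - e χ)) * Real.exp (n * (-d * χ + |d| * δ χ)) := by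
          gcongr
      _ ≤ _ := by
          rw [← Real.exp_add, ← Real.exp_add]
          refine Real.exp_le_exp.2 ?_
          have := mul_le_mul_of_nonneg_left (by linarith : |d| * δ χ ≤ e χ / 2) hn0.le
          linarith
  calc ∑ x ∈ E, Real.exp (birkhoff f (fun x => -d * Real.log (sphDeriv f x)) n x) =
        ∑ x ∈ E, Real.exp (-d * (n * X x)) := Finset.sum_congr rfl fun x hx => by
          rw [hL.birkhoff_eq hf d (hE.1 hx), hXn]
    _ ≤ ∑ χ ∈ t, ∑ x ∈ E with X x ∈ ball χ (δ χ), Real.exp (-d * (n * X x)) := by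
        simp_rw [Finset.sum_filter]
        rw [Finset.sum_comm]
        refine Finset.sum_le_sum fun x hx => ?_
        obtain ⟨χ, hχ, hx'⟩ := mem_iUnion₂.1 (ht (hXI x hx))
        refine le_trans (if_pos hx').ge (Finset.single_le_sum (f := fun χ =>
          if X x ∈ ball χ (δ χ) then Real.exp (-d * (n * X x)) else 0) (fun χ _ => ?_) hχ)
        positivity
    _ ≤ ∑ χ ∈ t, Real.exp (n * c) * Real.exp (-(n * (e χ / 2))) := Finset.sum_le_sum hterm
    _ = Real.exp (n * c) * ∑ χ ∈ t, Real.exp (-(n * (e χ / 2))) := by rw [Finset.mul_sum]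
    _ ≤ Real.exp (n * c) := mul_le_of_le_one_right (Real.exp_pos _).le hs.le

lemma SHol.hasGrowth_of_lt_pressFamily {f : RSphere → RSphere} (hf : SHol f)
    (hne : ∃ L, IsExpandingSet f L) {c d : ℝ} (h : c < pressFamily f d) :
    ∃ χ, HasGrowth f χ (c + d * χ) := by
  obtain ⟨M, -, hM⟩ := hf.exists_pressureOn_bound
  obtain ⟨L₀, hL₀⟩ := hne
  have : Nonempty {L : Set RSphere //
      L.Nonempty ∧ L ⊆ juliaSet f ∧ IsCompact L ∧ f '' L = L ∧ ExpandingOn f L} :=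
    ⟨⟨L₀, hL₀.nonempty, hL₀.subset, hL₀.isCompact, hL₀.image_eq, hL₀.expanding⟩⟩
  rw [pressFamily, pressureTop] at h
  obtain ⟨⟨L, h1, h2, h3, h4, h5⟩, hc⟩ := exists_lt_of_lt_ciSup h
  have hL : IsExpandingSet f L := ⟨h1, h2, h3, h4, h5⟩
  obtain ⟨ε₀, hε₀, hfr⟩ := (hM d L hL).2 c hc
  obtain ⟨χ, hχ, hg⟩ := hL.exists_growthPoint hf hfr
  exact ⟨χ, hχ, L, hL, ε₀, hε₀, hg⟩

lemma SHol.exists_growth_le {f : RSphere → RSphere} (hf : SHol f) :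
    ∃ H ≥ 0, ∀ χ h, HasGrowth f χ h → h ≤ H := by
  obtain ⟨H, hH, hcard⟩ := hf.exists_sep_card_le
  refine ⟨H, hH, fun χ h hg => ?_⟩
  obtain ⟨-, L, -, ε₀, hε₀, hg⟩ := hg
  obtain ⟨A, hA, hE⟩ := hcard ε₀ hε₀
  refine le_of_forall_pos_le_add fun ε hε => ?_
  by_contra! hlt
  obtain ⟨n₀, hn₀⟩ := exists_nat_gt (Real.log A / (h - (H + ε)))
  obtain ⟨n, ⟨E, hs, -, hc⟩, hn⟩ := ((hg ε hε).and_eventually (eventually_ge_atTop n₀)).exists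
  have h1 := hc.trans (hE L n E hs)
  rw [← Real.exp_log (by positivity : 0 < A), ← Real.exp_add, Real.exp_le_exp] at h1
  have h2 := hn₀.trans_le (Nat.cast_le.2 hn : (n₀ : ℝ) ≤ n)
  rw [div_lt_iff₀ (by linarith)] at h2
  linarith

lemma exists_isExpandingSet_of_alphaMinus_lt {f : RSphere → RSphere}
    (hlt : alphaMinus f < alphaPlus f) : ∃ L, IsExpandingSet f L := by
  by_contra! hno
  have : IsEmpty {L : Set RSphere //
      L.Nonempty ∧ L ⊆ juliaSet f ∧ IsCompact L ∧ f '' L = L ∧ ExpandingOn f L} :=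
    ⟨fun ⟨L, h1, h2, h3, h4, h5⟩ => hno L ⟨h1, h2, h3, h4, h5⟩⟩
  have hQ : (fun d => -pressFamily f d / d) = fun _ => 0 := by
    funext d
    rw [pressFamily, pressureTop, Real.iSup_of_isEmpty, neg_zero, zero_div]
  rw [alphaMinus, alphaPlus, alphaMinusOf, alphaPlusOf, hQ, limsup_const, limsup_const] at hlt
  exact lt_irrefl _ hlt

lemma SHol.exists_abs_pressFamily_div_le {f : RSphere → RSphere} (hf : SHol f) :
    ∃ M, ∀ d, 1 ≤ |d| → |-pressFamily f d / d| ≤ M := by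
  obtain ⟨M, hM, hb⟩ := hf.exists_pressFamily_bound
  refine ⟨2 * M, fun d hd => ?_⟩
  rw [abs_div, abs_neg, div_le_iff₀ (by linarith)]
  nlinarith [hb d]

lemma SHol.exists_hasGrowth_lt {f : RSphere → RSphere} (hf : SHol f)
    (hne : ∃ L, IsExpandingSet f L) {α : ℝ} (hα : alphaMinus f < α) :
    ∃ χ h, HasGrowth f χ h ∧ χ < α := by
  obtain ⟨β, hβ, hβα⟩ := exists_between hα
  obtain ⟨M, hM⟩ := hf.exists_abs_pressFamily_div_le
  obtain ⟨H, -, hH⟩ := hf.exists_growth_le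
  have hbd : IsBoundedUnder (· ≤ ·) atTop fun d => -pressFamily f d / d :=
    isBoundedUnder_of_eventually_le (a := M) ((eventually_ge_atTop 1).mono fun d hd =>
      (abs_le.1 (hM d (hd.trans (le_abs_self d)))).2)
  obtain ⟨d, h1, h2, h3⟩ := ((eventually_lt_of_limsup_lt hβ hbd).and
    ((eventually_gt_atTop 0).and (eventually_gt_atTop (H / (α - β))))).exists
  rw [div_lt_iff₀ h2] at h1
  obtain ⟨χ, hχ⟩ := hf.hasGrowth_of_lt_pressFamily hne (c := -(β * d)) (d := d) (by linarith)
  refine ⟨χ, _, hχ, ?_⟩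
  have h4 := hH _ _ hχ
  rw [div_lt_iff₀ (by linarith)] at h3
  by_contra! h5
  have := mul_le_mul_of_nonneg_left h5 h2.le
  linarith

lemma SHol.exists_lt_hasGrowth {f : RSphere → RSphere} (hf : SHol f)
    (hne : ∃ L, IsExpandingSet f L) {α : ℝ} (hα : α < alphaPlus f) :
    ∃ χ h, HasGrowth f χ h ∧ α < χ := by
  obtain ⟨β, hβα, hβ⟩ := exists_between hα
  obtain ⟨M, hM⟩ := hf.exists_abs_pressFamily_div_le
  obtain ⟨H, -, hH⟩ := hf.exists_growth_le
  have hbd : IsCoboundedUnder (· ≤ ·) atBot fun d => -pressFamily f d / d :=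
    (isBoundedUnder_of_eventually_ge (a := -M) ((eventually_le_atBot (-1)).mono fun d hd =>
      (abs_le.1 (hM d (le_abs.2 (Or.inr (by linarith))))).1)).isCoboundedUnder_le
  obtain ⟨d, h1, h2, h3⟩ := ((frequently_lt_of_lt_limsup hbd hβ).and_eventually
    ((eventually_lt_atBot 0).and (eventually_lt_atBot (-(H / (β - α)))))).exists
  rw [lt_div_iff_of_neg h2] at h1
  obtain ⟨χ, hχ⟩ := hf.hasGrowth_of_lt_pressFamily hne (c := -(β * d)) (d := d) (by linarith)
  refine ⟨χ, _, hχ, ?_⟩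
  have h4 := hH _ _ hχ
  rw [lt_neg, div_lt_iff₀ (by linarith)] at h3
  by_contra! h5
  have := mul_le_mul_of_nonpos_left h5 h2.le
  linarith

lemma noJuliaExceptional {f : RSphere → RSphere}
    (hexc : ¬ IsExceptional f ∨ maxExceptional f ∩ juliaSet f = ∅) : NoJuliaExceptional f := by
  intro S h1 h2 h3
  rcases hexc with h | h
  · exact absurd ⟨S, h1, h2, h3⟩ h
  · rw [← subset_empty_iff, ← h]
    exact inter_subset_inter_left _ (subset_sUnion_of_mem ⟨h1, h2, h3⟩)

lemma lt_add_of_lt_specF {Q : ℝ → ℝ} {α s s' : ℝ} (hα : 0 < α) (hs : s < s')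
    (h : (s' : EReal) < specF Q α) (d : ℝ) : s * α - d * α < Q d := by
  have h1 : specF Q α ≤ ((α⁻¹ * (Q d + d * α) : ℝ) : EReal) := by
    rw [specF, EReal.coe_mul]
    exact mul_le_mul_of_nonneg_left (iInf_le _ d) (by exact_mod_cast (inv_pos.2 hα).le)
  have h2 := EReal.coe_lt_coe_iff.1 (h.trans_le h1)
  rw [inv_mul_eq_div, lt_div_iff₀ hα] at h2
  have := mul_lt_mul_of_pos_right hs hα
  linarith

end

/-- **Proposition (lower bound in the interior of the spectrum).**
Assume `f` is non-exceptional, or exceptional with `Σ ∩ J = ∅`, and that `α⁻ < α⁺`.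
Then `dim_H 𝓛(α) ≥ F(α)` for every `α ∈ (α⁻, α⁺)`. -/
theorem lower_bound_interior (f : RSphere → RSphere) (p q : Polynomial ℂ)
    (hf : IsRationalMap f p q) (hdeg : 2 ≤ ratDeg p q)
    (hexc : ¬ IsExceptional f ∨ maxExceptional f ∩ juliaSet f = ∅)
    (hlt : alphaMinus f < alphaPlus f) :
    ∀ α : ℝ, alphaMinus f < α → α < alphaPlus f →
      Ffun f α ≤ (dimH (levelSet f (α : EReal) (α : EReal)) : EReal) := by
  intro α hα hα'
  have hF := hf.finHol hdeg
  have hne := exists_isExpandingSet_of_alphaMinus_lt hlt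
  have hl := hF.hol.exists_hasGrowth_lt hne hα
  have hr := hF.hol.exists_lt_hasGrowth hne hα'
  have hα0 : 0 < α := by
    obtain ⟨χ, h, hg, hχ⟩ := hl
    exact hg.1.trans hχ
  rw [Ffun, specFext, if_neg hα0.ne']
  by_contra! hcon
  obtain ⟨s, hs, hs'⟩ := EReal.lt_iff_exists_real_btwn.1 hcon
  obtain ⟨t, ht, ht'⟩ := EReal.lt_iff_exists_real_btwn.1 hs'
  rw [EReal.coe_lt_coe_iff] at ht
  obtain ⟨r, hr1, hr2⟩ := exists_between ht
  have hs0 : 0 < s := by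
    have := (EReal.coe_ennreal_nonneg _).trans_lt hs
    exact_mod_cast this
  have hle := le_dimH_of_forall_hasGrowth hF (noJuliaExceptional hexc) hα0 hs0 hr1
    (fun d => by
      obtain ⟨χ, hχ⟩ := hF.hol.hasGrowth_of_lt_pressFamily hne
        (lt_add_of_lt_specF hα0 hr2 ht' d)
      exact ⟨χ, _, hχ, by linarith⟩) hl hr
  refine absurd hs (not_lt.2 ?_)
  rw [← EReal.coe_ennreal_le_coe_ennreal_iff] at hle
  rwa [EReal.coe_ennreal_ofReal, max_eq_left hs0.le] at hle
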